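/- Suppose K and K′ are quadratic fields, c ∈ K and c′ ∈ K′, the map f_c admits both a fixed point in K and a point of exact period 4 in K, and the map f_{c′} admits both a fixed point in K′ and a point of exact period 4 in K′. Then c is the image in K of a rational number q, c′ is the image in K′ of a rational number q′, and q = q′. (In particular, there is at most one quadratic pair (K,c), up to the value of c, that simultaneously admits points of period 1 and period 4, and for such a pair c ∈ ℚ.) -/

import Mathlib

/-- The quadratic map `z ↦ z ^ 2 + c`. -/
def fc {K : Type*} [Field K] (c : K) : K → K := fun z => z ^ 2 + c

/-- `α` has exact period `m` under `fc c`. -/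
def HasExactPeriod {K : Type*} [Field K] (c : K) (m : ℕ) (α : K) : Prop :=
  (fc c)^[m] α = α ∧ ∀ j : ℕ, 1 ≤ j → j < m → (fc c)^[j] α ≠ α

/-- `α` has preperiodic type `m_n` under `fc c`: preperiod exactly `n`, eventual period `m`. -/
def HasPreperiodicType {K : Type*} [Field K] (c : K) (m n : ℕ) (α : K) : Prop :=
  HasExactPeriod c m ((fc c)^[n] α) ∧ (fc c)^[n + m - 1] α ≠ (fc c)^[n - 1] α

namespace Kummer

section Forms

variable {R : Type*} [CommRing R]

/-- Discriminant of the quadratic form attached to `(a, b, c)`. -/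
def disc (a b c : R) : R := b ^ 2 + c ^ 2 - a ^ 2

/-- First node form. -/
def normA (a c : R) : R := a ^ 2 - c ^ 2

/-- Second node form. -/
def normB (b c : R) : R := b ^ 2 + c ^ 2

/-- Third node form. -/
def normC (a b c : R) : R := 2 * a ^ 2 - (b + c) ^ 2

/-- The Kummer quartic. -/
def quartic (a b c d : R) : R :=
  (b ^ 2 + c ^ 2 - a ^ 2) * (d ^ 2 + b ^ 2 - c ^ 2 - 2 * b * c) + 2 * a * b * d * (c - b)
    + (a ^ 2 - b ^ 2) * (c - b) ^ 2 + 2 * a ^ 2 * b ^ 2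

end Forms

/-- Multiples of the four nodes that form the kernel of the isogeny. -/
def IsNode (a b c d : ℤ) : Prop :=
  (a = 0 ∧ b = 0 ∧ c = 0) ∨ (b = 0 ∧ c = 0 ∧ d = 0) ∨ (a = 0 ∧ c = 0 ∧ d = 0) ∨
    (a = 0 ∧ b + c = 0 ∧ d = 0)

/-- Multiples of the eight cusps. -/
def IsCusp (a b c d : ℤ) : Prop :=
  (a = 0 ∧ b = 0 ∧ c ^ 2 = d ^ 2) ∨ (c = 0 ∧ d = a ∧ b ^ 2 = a ^ 2) ∨
    (d = 0 ∧ c = b ∧ a ^ 2 = b ^ 2) ∨ (c = -b ∧ d = 2 * a ∧ b ^ 2 = a ^ 2)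

/-- A point of the Kummer quartic, not a node, with the square classes of a liftable point. -/
structure State (a b c d : ℤ) : Prop where
  eq : quartic a b c d = 0
  sqM : IsSquare (2 * (d + b + c) * (a - c) * normC a b c)
  sqL : IsSquare (2 * (d - b - c) * (a + c) * normC a b c)
  nontriv : ¬ IsNode a b c d

theorem isSquare_of_eq {x y : ℤ} (hxy : y = x) (h : IsSquare x) : IsSquare y := hxy ▸ h

theorem isSquare_of_mul_sq {x k : ℤ} (hk : k ≠ 0) (h : IsSquare (x * k ^ 2)) : IsSquare x := by
  obtain ⟨y, hy⟩ := h
  have h1 : k ∣ y := by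
    rw [← Int.pow_dvd_pow_iff two_ne_zero]
    exact ⟨x, by rw [pow_two y, ← hy]; ring⟩
  obtain ⟨z, rfl⟩ := h1
  refine ⟨z, ?_⟩
  have : k ^ 2 ≠ 0 := pow_ne_zero 2 hk
  apply mul_right_cancel₀ this
  rw [hy]; ring

theorem isSquare_left_of_mul {x y : ℤ} (hy : y ≠ 0) (h : IsSquare (x * y)) (h' : IsSquare y) :
    IsSquare x := by
  obtain ⟨z, rfl⟩ := h'
  have hz : z ≠ 0 := by rintro rfl; simp at hy
  exact isSquare_of_mul_sq hz (by rwa [pow_two])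

/-- Square classes are transitive. -/
theorem isSquare_mul_trans {x y z : ℤ} (hy : y ≠ 0) (h : IsSquare (x * y))
    (h' : IsSquare (y * z)) : IsSquare (x * z) := by
  apply isSquare_of_mul_sq hy
  have := h.mul h'
  exact isSquare_of_eq (by ring) this

section Identities

variable (a b c d : ℤ)

theorem disc_mul_quartic :
    (d * disc a b c + a * b * (c - b)) ^ 2 =
      normA a c * normB b c * normC a b c + disc a b c * quartic a b c d := by
  simp only [disc, normA, normB, normC, quartic]; ring

theorem normB_mul_dual :
    normB b c * ((a - d) ^ 2 + a ^ 2) = (a * d - b * c - c ^ 2) ^ 2 + quartic a b c d := by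
  simp only [normB, quartic]; ring

theorem normC_mul_dual :
    normC a b c * (d ^ 2 - 2 * c ^ 2) =
      ((c - b) * d + 2 * a * b) ^ 2 - 2 * quartic a b c d := by
  simp only [normC, quartic]; ring

theorem linear_mul_normA :
    (d - b - c) * (d + b + c) * normA a c =
      (b * d + a * (c - b)) ^ 2 - quartic a b c d := by
  simp only [normA, quartic]; ring

end Identities

variable {a b c d : ℤ}

theorem sq_add_sq_eq_zero {x y : ℤ} (h : x ^ 2 + y ^ 2 = 0) : x = 0 ∧ y = 0 := by
  constructor <;> nlinarith [sq_nonneg x, sq_nonneg y, sq_nonneg (x+y)]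

theorem two_mul_sq_eq_sq {x y : ℤ} (h : 2 * x ^ 2 = y ^ 2) : x = 0 ∧ y = 0 := by
  by_cases hx : x = 0
  · subst hx; simp at h; exact ⟨rfl, by simpa using h.symm⟩
  · have : IsSquare (2 : ℤ) := isSquare_of_mul_sq hx ⟨y, by rw [h]; ring⟩
    exact absurd this Int.prime_two.irreducible.not_isSquare

theorem State.normB_ne (h : State a b c d) : normB b c ≠ 0 := by
  intro h0
  obtain ⟨rfl, rfl⟩ := sq_add_sq_eq_zero h0
  have := h.eq
  have h2 : a ^ 2 * d ^ 2 = 0 := by simp only [quartic] at this; linarith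
  apply h.nontriv
  simp only [IsNode]
  rcases mul_eq_zero.1 h2 with h2 | h2 <;> simp_all

theorem State.normC_ne (h : State a b c d) : normC a b c ≠ 0 := by
  intro h0
  obtain ⟨rfl, hbc⟩ := two_mul_sq_eq_sq (x := a) (y := b + c) (by simp only [normC] at h0; linarith)
  have := h.eq
  obtain rfl : c = -b := by linarith
  have h2 : b ^ 2 * d ^ 2 = 0 := by simp only [quartic] at this; linarith
  apply h.nontriv
  simp only [IsNode]
  rcases mul_eq_zero.1 h2 with h2 | h2 <;> simp_all

theorem sq_add_two_mul_sub_sq {x y : ℤ} (h : x ^ 2 + 2 * x * y - y ^ 2 = 0) : x = 0 ∧ y = 0 := by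
  have := two_mul_sq_eq_sq (x := y) (y := x + y) (by linarith)
  omega

/-- The tropes `a - c`, `d + b + c` meet the surface only in nodes. -/
theorem State.not_both_M (h : State a b c d) (h1 : a - c = 0) (h2 : d + b + c = 0) : False := by
  have := h.eq
  obtain rfl : a = c := by linarith
  obtain rfl : d = -b - a := by linarith
  have h3 : (b ^ 2 + 2 * b * a - a ^ 2) ^ 2 = 0 := by
    rw [← this]; simp only [quartic]; ring
  obtain ⟨rfl, rfl⟩ := sq_add_two_mul_sub_sq (pow_eq_zero_iff two_ne_zero |>.1 h3)
  exact h.nontriv (by simp [IsNode])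

theorem State.not_both_L (h : State a b c d) (h1 : a + c = 0) (h2 : d - b - c = 0) : False := by
  have := h.eq
  obtain rfl : c = -a := by linarith
  obtain rfl : d = b - a := by linarith
  have h3 : (b ^ 2 - 2 * b * a - a ^ 2) ^ 2 = 0 := by
    rw [← this]; simp only [quartic]; ring
  obtain ⟨h4, rfl⟩ := sq_add_two_mul_sub_sq (x := -b) (y := a)
    (by linarith [pow_eq_zero_iff two_ne_zero |>.1 h3])
  exact h.nontriv (by simp [IsNode]; omega)

theorem State.not_both_L' (h : State a b c d) (h1 : a - c = 0) (h2 : d - b - c = 0) : False := by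
  have := h.eq
  obtain rfl : a = c := by linarith
  obtain rfl : d = b + a := by linarith
  have h3 : (b ^ 2 + a ^ 2) ^ 2 = 0 := by
    rw [← this]; simp only [quartic]; ring
  obtain ⟨rfl, rfl⟩ := sq_add_sq_eq_zero (pow_eq_zero_iff two_ne_zero |>.1 h3)
  exact h.nontriv (by simp [IsNode])

theorem State.not_both_M' (h : State a b c d) (h1 : a + c = 0) (h2 : d + b + c = 0) : False := by
  have := h.eq
  obtain rfl : c = -a := by linarith
  obtain rfl : d = -b + a := by linarith
  have h3 : (b ^ 2 + a ^ 2) ^ 2 = 0 := by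
    rw [← this]; simp only [quartic]; ring
  obtain ⟨rfl, rfl⟩ := sq_add_sq_eq_zero (pow_eq_zero_iff two_ne_zero |>.1 h3)
  exact h.nontriv (by simp [IsNode])

theorem State.not_both_A (h : State a b c d) (h1 : a - c = 0) (h2 : a + c = 0) : False := by
  have := h.eq
  obtain rfl : a = 0 := by linarith
  obtain rfl : c = 0 := by linarith
  have h3 : b ^ 2 * d ^ 2 = 0 := by simp only [quartic] at this; linarith
  apply h.nontriv
  simp only [IsNode]
  rcases mul_eq_zero.1 h3 with h2 | h2 <;> simp_all

theorem State.not_both_D (h : State a b c d) (h1 : d - b - c = 0) (h2 : d + b + c = 0) : False := by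
  have := h.eq
  obtain rfl : d = 0 := by linarith
  obtain rfl : c = -b := by linarith
  have h3 : a ^ 2 * b ^ 2 = 0 := by simp only [quartic] at this; linarith
  apply h.nontriv
  simp only [IsNode]
  rcases mul_eq_zero.1 h3 with h2 | h2 <;> simp_all

theorem State.isSquare_norms (h : State a b c d) :
    IsSquare (normA a c * normB b c * normC a b c) :=
  ⟨d * disc a b c + a * b * (c - b), by
    rw [← pow_two, disc_mul_quartic, h.eq]; ring⟩

theorem State.isSquare_linear (h : State a b c d) :
    IsSquare ((d - b - c) * (d + b + c) * normA a c) :=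
  ⟨b * d + a * (c - b), by rw [← pow_two, linear_mul_normA, h.eq]; ring⟩

theorem State.isSquare_dualC (h : State a b c d) :
    IsSquare (normC a b c * (d ^ 2 - 2 * c ^ 2)) :=
  ⟨(c - b) * d + 2 * a * b, by rw [← pow_two, normC_mul_dual, h.eq]; ring⟩

theorem State.isSquare_dualB (h : State a b c d) :
    IsSquare (normB b c * ((a - d) ^ 2 + a ^ 2)) :=
  ⟨a * d - b * c - c ^ 2, by rw [← pow_two, normB_mul_dual, h.eq]; ring⟩

theorem State.translate_one (h : State a b c d) : State c (a - d) (-a) (b + c) where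
  eq := by
    have := h.eq
    rw [← this]; simp only [quartic]; ring
  sqM := by
    have := isSquare_mul_trans h.normC_ne h.sqL h.isSquare_dualC
    exact isSquare_of_eq (by simp only [normC]; ring) this
  sqL := by
    have := isSquare_mul_trans h.normC_ne h.sqM h.isSquare_dualC
    exact isSquare_of_eq (by simp only [normC]; ring) this
  nontriv := by
    intro hn; apply h.nontriv
    simp only [IsNode] at *; omega

theorem State.translate_two (h : State a b c d) : State d (c - b) (c + b) (2 * a) where
  eq := by
    have : quartic d (c - b) (c + b) (2 * a) = 4 * quartic a b c d := by
      simp only [quartic]; ring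
    rw [this, h.eq]; ring
  sqM := by
    have := (isSquare_mul_trans h.normC_ne h.sqL h.isSquare_dualC).mul (IsSquare.sq (2 : ℤ))
    exact isSquare_of_eq (by simp only [normC]; ring) this
  sqL := by
    have := (isSquare_mul_trans h.normC_ne h.sqM h.isSquare_dualC).mul (IsSquare.sq (2 : ℤ))
    exact isSquare_of_eq (by simp only [normC]; ring) this
  nontriv := by
    intro hn; apply h.nontriv
    simp only [IsNode] at *; omega

end Kummer

namespace Kummer

variable {a b c d p q r s k : ℤ}

theorem IsNode.of_smul (hk : k ≠ 0) (h : IsNode (k * a) (k * b) (k * c) (k * d)) :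
    IsNode a b c d := by
  simp only [IsNode, ← mul_add, mul_eq_zero, hk, false_or] at h ⊢
  exact h

theorem IsCusp.of_smul (hk : k ≠ 0) (h : IsCusp (k * a) (k * b) (k * c) (k * d)) :
    IsCusp a b c d := by
  have hk2 : k ^ 2 ≠ 0 := pow_ne_zero 2 hk
  simp only [IsCusp, mul_pow, mul_eq_zero, hk, false_or, mul_right_inj' hk, mul_right_inj' hk2,
    neg_mul_eq_mul_neg, mul_left_comm (2 : ℤ) k] at h ⊢
  exact h

theorem IsCusp.of_translate_one (h : IsCusp c (a - d) (-a) (b + c)) : IsCusp a b c d := by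
  simp only [IsCusp] at h ⊢
  rcases h with ⟨h1, h2, h3⟩ | ⟨h1, h2, h3⟩ | ⟨h1, h2, h3⟩ | ⟨h1, h2, h3⟩
  · refine Or.inr (Or.inl ⟨h1, by omega, ?_⟩); subst h1; nlinarith
  · refine Or.inl ⟨by omega, by omega, ?_⟩
    obtain rfl : a = 0 := by omega
    nlinarith
  · refine Or.inr (Or.inr (Or.inr ⟨by omega, by omega, ?_⟩))
    obtain rfl : c = -b := by omega
    obtain rfl : d = 2 * a := by omega
    nlinarith
  · refine Or.inr (Or.inr (Or.inl ⟨by omega, by omega, ?_⟩))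
    obtain rfl : d = 0 := by omega
    obtain rfl : c = b := by omega
    nlinarith

theorem IsCusp.of_translate_two (h : IsCusp d (c - b) (c + b) (2 * a)) : IsCusp a b c d := by
  simp only [IsCusp] at h ⊢
  rcases h with ⟨h1, h2, h3⟩ | ⟨h1, h2, h3⟩ | ⟨h1, h2, h3⟩ | ⟨h1, h2, h3⟩
  · refine Or.inr (Or.inr (Or.inl ⟨h1, by omega, ?_⟩))
    obtain rfl : c = b := by omega
    nlinarith
  · refine Or.inr (Or.inr (Or.inr ⟨by omega, by omega, ?_⟩))
    obtain rfl : c = -b := by omega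
    obtain rfl : d = 2 * a := by omega
    nlinarith
  · refine Or.inl ⟨by omega, by omega, ?_⟩
    obtain rfl : b = 0 := by omega
    nlinarith
  · refine Or.inr (Or.inl ⟨by omega, by omega, ?_⟩)
    obtain rfl : c = 0 := by omega
    obtain rfl : d = a := by omega
    nlinarith

section Isogeny

/-- Coordinates of the isogeny. -/
def phiA (p q r s : ℤ) : ℤ := 2 * (p * r - q * s)

/-- Coordinates of the isogeny. -/
def phiB (p q r s : ℤ) : ℤ := -2 * (p * s + q * r)

/-- Coordinates of the isogeny. -/
def phiC (p q r s : ℤ) : ℤ := 2 * (p * q + 2 * r * s) - 2 * (p * s + q * r)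

/-- Coordinates of the isogeny. -/
def phiD (p q r s : ℤ) : ℤ := p ^ 2 - q ^ 2 + 2 * r ^ 2 - 2 * s ^ 2

theorem IsNode.phi (h : IsNode r (q - s) s p) :
    IsNode (phiA p q r s) (phiB p q r s) (phiC p q r s) (phiD p q r s) := by
  simp only [IsNode, phiA, phiB, phiC, phiD] at h ⊢
  rcases h with ⟨h1, h2, h3⟩ | ⟨h1, h2, h3⟩ | ⟨h1, h2, h3⟩ | ⟨h1, h2, h3⟩
  · obtain rfl : q = 0 := by omega
    subst h1 h3; simp
  · obtain rfl : q = 0 := by omega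
    subst h2 h3; simp
  · subst h1 h2 h3; simp
  · obtain rfl : q = 0 := by omega
    subst h1 h3; simp

theorem IsCusp.phi (h : IsCusp r (q - s) s p) :
    IsCusp (phiA p q r s) (phiB p q r s) (phiC p q r s) (phiD p q r s) := by
  simp only [IsCusp, phiA, phiB, phiC, phiD] at h ⊢
  rcases h with ⟨h1, h2, h3⟩ | ⟨h1, h2, h3⟩ | ⟨h1, h2, h3⟩ | ⟨h1, h2, h3⟩
  · obtain rfl : q = s := by omega
    subst h1
    refine Or.inr (Or.inl ⟨by ring, by linear_combination -h3, by linear_combination (-4 * q ^ 2) * h3⟩)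
  · subst h1 h2
    obtain h3 | h3 := sq_eq_sq_iff_eq_or_eq_neg.1 h3
    · obtain rfl : q = p := by omega
      exact Or.inr (Or.inl ⟨by ring, by ring, by ring⟩)
    · obtain rfl : q = -p := by omega
      exact Or.inr (Or.inl ⟨by ring, by ring, by ring⟩)
  · subst h1
    obtain rfl : q = 2 * s := by omega
    obtain rfl | rfl := sq_eq_sq_iff_eq_or_eq_neg.1 h3
    · exact Or.inr (Or.inl ⟨by ring, by ring, by ring⟩)
    · exact Or.inr (Or.inl ⟨by ring, by ring, by ring⟩)
  · obtain rfl : q = 0 := by omega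
    subst h2
    obtain h3 | h3 := sq_eq_sq_iff_eq_or_eq_neg.1 h3
    · obtain rfl : r = -s := by omega
      exact Or.inr (Or.inl ⟨by ring, by ring, by ring⟩)
    · obtain rfl : r = s := by omega
      exact Or.inr (Or.inl ⟨by ring, by ring, by ring⟩)

theorem phi_sub_mul (p q r s : ℤ) :
    (phiA p q r s - phiC p q r s) * ((p + q) * (r - s)) =
      ((r - q) * p + 2 * q * r - 2 * r * s - q * s) ^ 2 - quartic r (q - s) s p := by
  simp only [phiA, phiC, quartic]; ring

theorem phi_add_mul (p q r s : ℤ) :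
    (phiA p q r s + phiC p q r s) * ((p - q) * (r + s)) =
      ((r + q) * p - 2 * q * r + 2 * r * s - q * s) ^ 2 - quartic r (q - s) s p := by
  simp only [phiA, phiC, quartic]; ring

theorem phi_L_mul (p q r s : ℤ) :
    (phiD p q r s - phiB p q r s - phiC p q r s) * (2 * r ^ 2 - q ^ 2) =
      ((q - 2 * s) * p - (2 * r ^ 2 - q ^ 2 + 2 * r * q - 2 * r * s)) ^ 2
        - 2 * quartic r (q - s) s p := by
  simp only [phiB, phiC, phiD, quartic]; ring

theorem phi_M_mul (p q r s : ℤ) :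
    (phiD p q r s + phiB p q r s + phiC p q r s) * (2 * r ^ 2 - q ^ 2) =
      ((q - 2 * s) * p + (2 * r ^ 2 - q ^ 2 - 2 * r * q + 2 * r * s)) ^ 2
        - 2 * quartic r (q - s) s p := by
  simp only [phiB, phiC, phiD, quartic]; ring

theorem phi_sub_of_zero (h : quartic r (q - s) s p = 0) (h0 : (p + q) * (r - s) = 0) :
    phiA p q r s - phiC p q r s = (p - q) * (r + s) := by
  have h1 := phi_sub_mul p q r s
  rw [h, h0, mul_zero, sub_zero, eq_comm, pow_eq_zero_iff two_ne_zero] at h1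
  simp only [phiA, phiC]
  linear_combination 2 * h1 - h0

theorem phi_add_of_zero (h : quartic r (q - s) s p = 0) (h0 : (p - q) * (r + s) = 0) :
    phiA p q r s + phiC p q r s = (p + q) * (r - s) := by
  have h1 := phi_add_mul p q r s
  rw [h, h0, mul_zero, sub_zero, eq_comm, pow_eq_zero_iff two_ne_zero] at h1
  simp only [phiA, phiC]
  linear_combination 2 * h1 - h0

theorem isSquare_tropes (h : quartic r (q - s) s p = 0) :
    IsSquare (((p + q) * (r - s)) * ((p - q) * (r + s))) :=
  ⟨(q - s) * p + r * (s - (q - s)), by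
    have := linear_mul_normA r (q - s) s p
    rw [h] at this
    rw [← pow_two, ← sub_zero ((_ : ℤ) ^ 2), ← this, normA]; ring⟩

theorem isSquare_phi_sub (h : quartic r (q - s) s p = 0) :
    IsSquare ((phiA p q r s - phiC p q r s) * ((p + q) * (r - s))) ∧
      IsSquare ((phiA p q r s - phiC p q r s) * ((p - q) * (r + s))) := by
  have h1 : IsSquare ((phiA p q r s - phiC p q r s) * ((p + q) * (r - s))) := by
    rw [phi_sub_mul, h, sub_zero]; exact IsSquare.sq _
  refine ⟨h1, ?_⟩
  by_cases h0 : (p + q) * (r - s) = 0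
  · rw [phi_sub_of_zero h h0]; exact ⟨_, rfl⟩
  · exact isSquare_mul_trans h0 h1 (isSquare_tropes h)

theorem isSquare_phi_add (h : quartic r (q - s) s p = 0) :
    IsSquare ((phiA p q r s + phiC p q r s) * ((p + q) * (r - s))) ∧
      IsSquare ((phiA p q r s + phiC p q r s) * ((p - q) * (r + s))) := by
  have h1 : IsSquare ((phiA p q r s + phiC p q r s) * ((p - q) * (r + s))) := by
    rw [phi_add_mul, h, sub_zero]; exact IsSquare.sq _
  refine ⟨?_, h1⟩
  by_cases h0 : (p - q) * (r + s) = 0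
  · rw [phi_add_of_zero h h0]; exact ⟨_, rfl⟩
  · exact isSquare_mul_trans h0 h1 (isSquare_of_eq (mul_comm _ _) (isSquare_tropes h))

end Isogeny

theorem State.isSquare_linear' (h : State a b c d) :
    IsSquare ((d - b - c) * (d + b + c) * normB b c * normC a b c) :=
  ⟨a * d * (c - b) + b * (b + c) ^ 2, by
    have : (d - b - c) * (d + b + c) * normB b c * normC a b c =
      (a * d * (c - b) + b * (b + c) ^ 2) ^ 2 - (b + c) ^ 2 * quartic a b c d := by
      simp only [normB, normC, quartic]; ring
    rw [this, h.eq]; ring⟩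

theorem State.isSquare_LB (h : State a b c d) :
    IsSquare (2 * (d - b - c) * (a - c) * normB b c) := by
  by_cases hM : d + b + c = 0
  · have hb : a + c ≠ 0 := fun h0 => h.not_both_M' h0 hM
    have := h.sqL.mul h.isSquare_norms
    refine isSquare_of_mul_sq (mul_ne_zero hb h.normC_ne) (isSquare_of_eq ?_ this)
    simp only [normA]; ring
  · have := h.sqM.mul h.isSquare_linear'
    refine isSquare_of_mul_sq (mul_ne_zero hM h.normC_ne) (isSquare_of_eq ?_ this)
    ring

theorem State.isSquare_MB (h : State a b c d) :
    IsSquare (2 * (d + b + c) * (a + c) * normB b c) := by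
  by_cases hL : d - b - c = 0
  · have hb : a - c ≠ 0 := fun h0 => h.not_both_L' h0 hL
    have := h.sqM.mul h.isSquare_norms
    refine isSquare_of_mul_sq (mul_ne_zero hb h.normC_ne) (isSquare_of_eq ?_ this)
    simp only [normA]; ring
  · have := h.sqL.mul h.isSquare_linear'
    refine isSquare_of_mul_sq (mul_ne_zero hL h.normC_ne) (isSquare_of_eq ?_ this)
    ring

/-- A preimage of a state under the isogeny is a state. -/
theorem State.of_phi (h : State a b c d) (hB : IsSquare (normB b c)) (hk : k ≠ 0)
    (hA' : k * a = phiA p q r s) (hB' : k * b = phiB p q r s) (hC' : k * c = phiC p q r s)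
    (hD' : k * d = phiD p q r s) (hq : quartic r (q - s) s p = 0) :
    State r (q - s) s p := by
  have key : ∀ x, IsSquare ((phiA p q r s - phiC p q r s) * x) →
      IsSquare ((phiA p q r s + phiC p q r s) * x) → IsSquare (2 * x * (2 * r ^ 2 - q ^ 2)) := by
    intro x h1 h2
    have hL : IsSquare ((phiD p q r s - phiB p q r s - phiC p q r s) * (2 * r ^ 2 - q ^ 2)) := by
      rw [phi_L_mul, hq, mul_zero, sub_zero]; exact IsSquare.sq _
    have hM : IsSquare ((phiD p q r s + phiB p q r s + phiC p q r s) * (2 * r ^ 2 - q ^ 2)) := by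
      rw [phi_M_mul, hq, mul_zero, sub_zero]; exact IsSquare.sq _
    rw [← hA', ← hC'] at h1 h2
    rw [← hD', ← hB', ← hC'] at hL hM
    by_cases h0 : (a - c) * (d - b - c) = 0
    · have h0' : (a + c) * (d + b + c) ≠ 0 := by
        intro h3
        rcases mul_eq_zero.1 h0 with h4 | h4 <;> rcases mul_eq_zero.1 h3 with h5 | h5
        exacts [h.not_both_A h4 h5, h.not_both_M h4 h5, h.not_both_L h5 h4, h.not_both_D h4 h5]
      have h6 := isSquare_left_of_mul h.normB_ne h.isSquare_MB hB
      refine isSquare_of_mul_sq (mul_ne_zero hk h0') (isSquare_of_eq ?_ ((h2.mul hM).mul h6))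
      ring
    · have h6 := isSquare_left_of_mul h.normB_ne h.isSquare_LB hB
      refine isSquare_of_mul_sq (mul_ne_zero hk h0) (isSquare_of_eq ?_ ((h1.mul hL).mul h6))
      ring
  refine ⟨hq, ?_, ?_, fun hn => ?_⟩
  · have := key _ (isSquare_phi_sub hq).1 (isSquare_phi_add hq).1
    exact isSquare_of_eq (by simp only [normC]; ring) this
  · have := key _ (isSquare_phi_sub hq).2 (isSquare_phi_add hq).2
    exact isSquare_of_eq (by simp only [normC]; ring) this
  · apply h.nontriv
    have := hn.phi
    rw [← hA', ← hB', ← hC', ← hD'] at this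
    exact this.of_smul hk
end Kummer

namespace Kummer

variable {a b c d p q r s k : ℤ}

theorem preimage_aux {A B C : ℤ} (e : ℤ) (hA : A ^ 2 + r = 2 * A * b) (hB : r - B ^ 2 = 2 * B * a)
    (hC : C ^ 2 + 2 * r = -(2 * C * e)) (he : c = e + b) (hr : b ^ 2 + c ^ 2 - a ^ 2 = r) :
    4 * (A * B * C) * a = phiA (A * C) (-(B * C)) r (-(A * B)) ∧
    4 * (A * B * C) * b = phiB (A * C) (-(B * C)) r (-(A * B)) ∧
    4 * (A * B * C) * c = phiC (A * C) (-(B * C)) r (-(A * B)) ∧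
    quartic r (-(B * C) - -(A * B)) (-(A * B)) (A * C) = 0 := by
  subst he
  simp only [phiA, phiB, phiC]
  refine ⟨by linear_combination (-2 * A * C) * hB, by linear_combination (-2 * B * C) * hA,
    by linear_combination (-2 * B * C) * hA + (2 * A * B) * hC, ?_⟩
  have : quartic r (-(B * C) - -(A * B)) (-(A * B)) (A * C) =
      2 * B ^ 2 * C ^ 2 * (A ^ 2 + r) ^ 2 + A ^ 2 * B ^ 2 * (C ^ 2 + 2 * r) ^ 2
      - 2 * A * B ^ 2 * C * (A ^ 2 + r) * (C ^ 2 + 2 * r) - A ^ 2 * C ^ 2 * (r - B ^ 2) ^ 2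
      - 4 * A ^ 2 * B ^ 2 * C ^ 2 * r := by
    simp only [quartic]; ring
  rw [this, hA, hB, hC]
  linear_combination 4 * A ^ 2 * B ^ 2 * C ^ 2 * hr

theorem State.exists_preimage (h : State a b c d) (h1 : IsSquare (normA a c))
    (h2 : IsSquare (normB b c)) (h3 : IsSquare (normC a b c)) :
    ∃ k p q r s : ℤ, k ≠ 0 ∧ k * a = phiA p q r s ∧ k * b = phiB p q r s ∧ k * c = phiC p q r s ∧
      k * d = phiD p q r s ∧ quartic r (q - s) s p = 0 := by
  by_cases hr : disc a b c = 0
  · have h0 : 2 * a * b * d * (c - b) + (a ^ 2 - b ^ 2) * (c - b) ^ 2 + 2 * a ^ 2 * b ^ 2 = 0 := by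
      have := h.eq
      have hr' := hr
      simp only [disc] at hr'
      simp only [quartic, hr'] at this
      linarith
    simp only [disc] at hr
    have ha : a ≠ 0 := by
      rintro rfl
      obtain ⟨rfl, rfl⟩ := sq_add_sq_eq_zero (by simpa using hr)
      exact h.nontriv (by simp [IsNode])
    have hb : b ≠ 0 := by
      rintro rfl
      have : a ^ 2 * c ^ 2 = 0 := by linarith
      have hc : c = 0 := by simpa [ha] using this
      subst hc
      simp [ha] at hr
    have he : c - b ≠ 0 := by
      intro he
      rw [he] at h0
      have : a ^ 2 * b ^ 2 = 0 := by linarith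
      simp [ha, hb] at this
    obtain ⟨hA, hB, hC, hq⟩ := preimage_aux (A := 2 * b) (B := -2 * a) (C := -2 * (c - b))
      (r := 0) (a := a) (b := b) (c := c) (c - b) (by ring) (by ring) (by ring) (by ring) hr
    refine ⟨_, _, _, _, _, ?_, hA, hB, hC, ?_, hq⟩
    · simp [ha, hb, he]
    · simp only [phiD]; linear_combination 16 * h0
  · have key : ∀ n1 n2 n3 : ℤ, normA a c = n1 * n1 → normB b c = n2 * n2 → normC a b c = n3 * n3 →
        n1 * n2 * n3 = d * disc a b c + a * b * (c - b) → 
        ∃ k p q r s : ℤ, k ≠ 0 ∧ k * a = phiA p q r s ∧ k * b = phiB p q r s ∧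
          k * c = phiC p q r s ∧ k * d = phiD p q r s ∧ quartic r (q - s) s p = 0 := by
      intro n1 n2 n3 e1 e2 e3 e
      obtain ⟨x, hx⟩ : ∃ x, x = disc a b c := ⟨_, rfl⟩
      have f1 : n1 * n1 = b ^ 2 - x := by rw [hx, ← e1]; simp only [normA, disc]; ring
      have f2 : n2 * n2 = a ^ 2 + x := by rw [hx, ← e2]; simp only [normB, disc]; ring
      have f3 : n3 * n3 = (c - b) ^ 2 - 2 * x := by rw [hx, ← e3]; simp only [normC, disc]; ring
      rw [← hx] at e hr
      obtain ⟨hA, hB, hC, hq⟩ := preimage_aux (A := n1 + b) (B := n2 - a) (C := n3 - (c - b))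
        (r := x) (a := a) (b := b) (c := c) (c - b) (by linear_combination f1)
        (by linear_combination -f2) (by linear_combination f3) (by ring)
        (by rw [hx, disc])
      refine ⟨_, _, _, _, _, ?_, hA, hB, hC, ?_, hq⟩
      · refine mul_ne_zero (by norm_num) (mul_ne_zero (mul_ne_zero ?_ ?_) ?_) <;> intro h0 <;>
          apply hr
        · linear_combination f1 - (n1 - b) * h0
        · linear_combination -f2 + (n2 + a) * h0
        · have : 2 * x = 0 := by linear_combination f3 - (n3 + (c - b)) * h0
          simpa using this
      · apply mul_left_cancel₀ hr
        simp only [phiD]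
        obtain ⟨A, hA'⟩ : ∃ A, A = n1 + b := ⟨_, rfl⟩
        obtain ⟨B, hB'⟩ : ∃ B, B = n2 - a := ⟨_, rfl⟩
        obtain ⟨C, hC'⟩ : ∃ C, C = n3 - (c - b) := ⟨_, rfl⟩
        have g1 : 2 * A * n1 = A ^ 2 - x := by rw [hA']; linear_combination f1
        have g2 : 2 * B * n2 = x + B ^ 2 := by rw [hB']; linear_combination f2
        have g3 : 2 * C * n3 = C ^ 2 - 2 * x := by rw [hC']; linear_combination f3
        have g4 : 2 * A * b = A ^ 2 + x := by rw [hA']; linear_combination -f1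
        have g5 : 2 * B * a = x - B ^ 2 := by rw [hB']; linear_combination f2
        have g6 : 2 * C * (c - b) = -(C ^ 2 + 2 * x) := by rw [hC']; linear_combination f3
        rw [← hA', ← hB', ← hC']
        have e' : 2 * (4 * (A * B * C)) * (d * x) = (2 * A * n1) * (2 * B * n2) * (2 * C * n3)
            - (2 * A * b) * (2 * B * a) * (2 * C * (c - b)) := by
          linear_combination (-8 * A * B * C) * e
        rw [g1, g2, g3, g4, g5, g6] at e'
        linarith
    obtain ⟨n1, e1⟩ := h1
    obtain ⟨n2, e2⟩ := h2
    obtain ⟨n3, e3⟩ := h3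
    have e : (n1 * n2 * n3) ^ 2 = (d * disc a b c + a * b * (c - b)) ^ 2 := by
      rw [disc_mul_quartic, h.eq, e1, e2, e3]; ring
    rcases sq_eq_sq_iff_eq_or_eq_neg.1 e with e | e
    · exact key n1 n2 n3 e1 e2 e3 e
    · exact key (-n1) n2 n3 (by rw [e1]; ring) e2 e3 (by linear_combination -e)

end Kummer

namespace Kummer

variable {a b c d p q r s k : ℤ}

/-- Primitive integer vectors. -/
def Primitive (p q r s : ℤ) : Prop :=
  ∀ l : ℤ, l ∣ p → l ∣ q → l ∣ r → l ∣ s → IsUnit l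

theorem exists_primitive (h : ¬ (p = 0 ∧ q = 0 ∧ r = 0 ∧ s = 0)) :
    ∃ g p' q' r' s' : ℤ, g ≠ 0 ∧ p = g * p' ∧ q = g * q' ∧ r = g * r' ∧ s = g * s' ∧
      Primitive p' q' r' s' := by
  set g : ℤ := gcd (gcd p q) (gcd r s) with hg
  have g0 : g ≠ 0 := by
    rw [hg, Ne, gcd_eq_zero_iff, gcd_eq_zero_iff, gcd_eq_zero_iff]; tauto
  have h1 : g ∣ p := (gcd_dvd_left _ _).trans (gcd_dvd_left _ _)
  have h2 : g ∣ q := (gcd_dvd_left _ _).trans (gcd_dvd_right _ _)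
  have h3 : g ∣ r := (gcd_dvd_right _ _).trans (gcd_dvd_left _ _)
  have h4 : g ∣ s := (gcd_dvd_right _ _).trans (gcd_dvd_right _ _)
  obtain ⟨p', hp⟩ := h1
  obtain ⟨q', hq⟩ := h2
  obtain ⟨r', hr⟩ := h3
  obtain ⟨s', hs⟩ := h4
  refine ⟨g, p', q', r', s', g0, hp, hq, hr, hs, fun l l1 l2 l3 l4 => ?_⟩
  have : g * l ∣ g := by
    conv_rhs => rw [hg]
    refine dvd_gcd (dvd_gcd ?_ ?_) (dvd_gcd ?_ ?_)
    · rw [hp]; exact mul_dvd_mul_left g l1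
    · rw [hq]; exact mul_dvd_mul_left g l2
    · rw [hr]; exact mul_dvd_mul_left g l3
    · rw [hs]; exact mul_dvd_mul_left g l4
  obtain ⟨t, ht⟩ := this
  refine IsUnit.of_mul_eq_one t ?_
  apply mul_left_cancel₀ g0
  linarith

theorem Primitive.exists_smul {x : ℤ} (h : Primitive p q r s) (hk : k ≠ 0) (h1 : k * a = x * p)
    (h2 : k * b = x * q) (h3 : k * c = x * r) (h4 : k * d = x * s) :
    ∃ t, a = t * p ∧ b = t * q ∧ c = t * r ∧ d = t * s := by
  have hu : IsUnit (gcd (gcd p q) (gcd r s)) := h _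
    ((gcd_dvd_left _ _).trans (gcd_dvd_left _ _)) ((gcd_dvd_left _ _).trans (gcd_dvd_right _ _))
    ((gcd_dvd_right _ _).trans (gcd_dvd_left _ _)) ((gcd_dvd_right _ _).trans (gcd_dvd_right _ _))
  have hd : k ∣ x * gcd (gcd p q) (gcd r s) := by
    have e : ∀ y z : ℤ, k ∣ x * y → k ∣ x * z → k ∣ x * gcd y z := fun y z hy hz =>
      (dvd_gcd hy hz).trans (gcd_mul_left' x y z).dvd
    exact e _ _ (e _ _ ⟨a, h1.symm⟩ ⟨b, h2.symm⟩) (e _ _ ⟨c, h3.symm⟩ ⟨d, h4.symm⟩)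
  obtain ⟨t, rfl⟩ := (hu.dvd_mul_right).1 hd
  refine ⟨t, ?_, ?_, ?_, ?_⟩ <;> apply mul_left_cancel₀ hk <;> linarith

theorem IsCusp.smul (t : ℤ) (h : IsCusp a b c d) : IsCusp (t * a) (t * b) (t * c) (t * d) := by
  by_cases ht : t = 0
  · subst ht; simp [IsCusp]
  have hk2 : t ^ 2 ≠ 0 := pow_ne_zero 2 ht
  simp only [IsCusp, mul_pow, mul_eq_zero, ht, false_or, mul_right_inj' ht, mul_right_inj' hk2,
    neg_mul_eq_mul_neg, mul_left_comm (2 : ℤ) t] at h ⊢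
  exact h

theorem State.of_smul (hk : k ≠ 0) (h : State (k * a) (k * b) (k * c) (k * d)) :
    State a b c d where
  eq := by
    have : quartic (k * a) (k * b) (k * c) (k * d) = k ^ 4 * quartic a b c d := by
      simp only [quartic]; ring
    rw [h.eq] at this
    exact (mul_eq_zero.1 this.symm).resolve_left (pow_ne_zero 4 hk)
  sqM := isSquare_of_mul_sq (pow_ne_zero 2 hk) (isSquare_of_eq (by simp only [normC]; ring) h.sqM)
  sqL := isSquare_of_mul_sq (pow_ne_zero 2 hk) (isSquare_of_eq (by simp only [normC]; ring) h.sqL)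
  nontriv := fun hn => h.nontriv (by
    simp only [IsNode, ← mul_add, mul_eq_zero, hk, false_or] at hn ⊢
    exact hn)

/-- The height used in the descent. -/
def height (a b c d : ℤ) : ℤ := (d - a) ^ 2 + a ^ 2 + b ^ 2 + c ^ 2

theorem height_nonneg (a b c d : ℤ) : 0 ≤ height a b c d := by
  unfold height; positivity

theorem height_smul (t a b c d : ℤ) :
    height (t * a) (t * b) (t * c) (t * d) = t ^ 2 * height a b c d := by
  unfold height; ring

theorem height_sq_le_phi (p q r s : ℤ) :
    height r (q - s) s p ^ 2 ≤
      height (phiA p q r s) (phiB p q r s) (phiC p q r s) (phiD p q r s) := by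
  have : height (phiA p q r s) (phiB p q r s) (phiC p q r s) (phiD p q r s) =
      height r (q - s) s p ^ 2 + (2 * p * r + 2 * q * s) ^ 2 := by
    simp only [height, phiA, phiB, phiC, phiD]; ring
  rw [this]; linarith [sq_nonneg (2 * p * r + 2 * q * s)]

theorem odd_prime_not_dvd_phi {l : ℤ} (hl : Prime l) (hl2 : ¬ l ∣ 2) (hA : l ∣ phiA p q r s)
    (hB : l ∣ phiB p q r s) (hC : l ∣ phiC p q r s) (hD : l ∣ phiD p q r s) :
    l ∣ p ∧ l ∣ q ∧ l ∣ r ∧ l ∣ s := by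
  have hA' : l ∣ p * r - q * s := (hl.dvd_or_dvd hA).resolve_left hl2
  have hB' : l ∣ p * s + q * r := by
    have : l ∣ 2 * (p * s + q * r) := by
      rw [phiB, neg_mul, dvd_neg] at hB; exact hB
    exact (hl.dvd_or_dvd this).resolve_left hl2
  have hE' : l ∣ p * q + 2 * r * s := by
    have : l ∣ 2 * (p * q + 2 * r * s) := by
      have := hC.sub hB
      rwa [phiC, phiB, neg_mul, sub_neg_eq_add, sub_add_cancel] at this
    exact (hl.dvd_or_dvd this).resolve_left hl2
  have d1 : l ∣ p * (r ^ 2 + s ^ 2) := by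
    have := (hA'.mul_right r).add (hB'.mul_right s)
    exact this.trans (dvd_of_eq (by ring))
  have d2 : l ∣ q * (r ^ 2 + s ^ 2) := by
    have := (hB'.mul_right r).sub (hA'.mul_right s)
    exact this.trans (dvd_of_eq (by ring))
  have d3 : l ∣ r * (p ^ 2 + q ^ 2) := by
    have := (hA'.mul_right p).add (hB'.mul_right q)
    exact this.trans (dvd_of_eq (by ring))
  have d4 : l ∣ s * (p ^ 2 + q ^ 2) := by
    have := (hB'.mul_right p).sub (hA'.mul_right q)
    exact this.trans (dvd_of_eq (by ring))
  have hpq : l ∣ p → l ∣ q → l ∣ p ∧ l ∣ q ∧ l ∣ r ∧ l ∣ s := by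
    rintro hp hq
    have h1 : l ∣ r * s := by
      have : l ∣ 2 * (r * s) := by
        have := hE'.sub (hp.mul_right q)
        exact this.trans (dvd_of_eq (by ring))
      exact (hl.dvd_or_dvd this).resolve_left hl2
    have h2 : l ∣ r ^ 2 - s ^ 2 := by
      have : l ∣ 2 * (r ^ 2 - s ^ 2) := by
        have := (hD.sub (hp.mul_right p)).add (hq.mul_right q)
        exact this.trans (dvd_of_eq (by rw [phiD]; ring))
      exact (hl.dvd_or_dvd this).resolve_left hl2
    refine ⟨hp, hq, ?_⟩
    rcases hl.dvd_or_dvd h1 with h | h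
    · refine ⟨h, hl.dvd_of_dvd_pow (n := 2) ?_⟩
      have := (h.mul_right r).sub h2
      exact this.trans (dvd_of_eq (by ring))
    · refine ⟨hl.dvd_of_dvd_pow (n := 2) ?_, h⟩
      have := (h.mul_right s).add h2
      exact this.trans (dvd_of_eq (by ring))
  have hrs : l ∣ r → l ∣ s → l ∣ p ∧ l ∣ q ∧ l ∣ r ∧ l ∣ s := by
    rintro hr hs
    have h1 : l ∣ p * q := by
      have := hE'.sub (hr.mul_right (2 * s))
      exact this.trans (dvd_of_eq (by ring))
    have h2 : l ∣ p ^ 2 - q ^ 2 := by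
      have := (hD.sub (hr.mul_right (2 * r))).add (hs.mul_right (2 * s))
      exact this.trans (dvd_of_eq (by rw [phiD]; ring))
    rcases hl.dvd_or_dvd h1 with h | h
    · refine hpq h (hl.dvd_of_dvd_pow (n := 2) ?_)
      have := (h.mul_right p).sub h2
      exact this.trans (dvd_of_eq (by ring))
    · refine hpq (hl.dvd_of_dvd_pow (n := 2) ?_) h
      have := (h.mul_right q).add h2
      exact this.trans (dvd_of_eq (by ring))
  rcases hl.dvd_or_dvd d1 with hp | h1
  · rcases hl.dvd_or_dvd d2 with hq | h1
    · exact hpq hp hq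
    · have h2 : l ∣ r * s := by
        have : l ∣ 2 * (r * s) := by
          have := hE'.sub (hp.mul_right q)
          exact this.trans (dvd_of_eq (by ring))
        exact (hl.dvd_or_dvd this).resolve_left hl2
      rcases hl.dvd_or_dvd h2 with h | h
      · refine hrs h (hl.dvd_of_dvd_pow (n := 2) ?_)
        have := h1.sub (h.mul_right r)
        exact this.trans (dvd_of_eq (by ring))
      · refine hrs (hl.dvd_of_dvd_pow (n := 2) ?_) h
        have := h1.sub (h.mul_right s)
        exact this.trans (dvd_of_eq (by ring))
  · rcases hl.dvd_or_dvd d3 with hr | h2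
    · refine hrs hr (hl.dvd_of_dvd_pow (n := 2) ?_)
      have := h1.sub (hr.mul_right r)
      exact this.trans (dvd_of_eq (by ring))
    · -- now `p² = -q²`, `s² = -r²`
      have h3 : l ∣ p ^ 2 + 2 * r ^ 2 := by
        have : l ∣ 2 * (p ^ 2 + 2 * r ^ 2) := by
          have := (hD.add h2).add (h1.mul_left 2)
          exact this.trans (dvd_of_eq (by rw [phiD]; ring))
        exact (hl.dvd_or_dvd this).resolve_left hl2
      have h4 : l ∣ p * (q * r) := by
        have : l ∣ 2 * (p * (q * r)) := by
          have := ((hE'.mul_right r).sub (h3.mul_right s)).add (hB'.mul_right p)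
          exact this.trans (dvd_of_eq (by ring))
        exact (hl.dvd_or_dvd this).resolve_left hl2
      have hp : l ∣ p → l ∣ q := fun hp => hl.dvd_of_dvd_pow (n := 2) (by
        have := h2.sub (hp.mul_right p)
        exact this.trans (dvd_of_eq (by ring)))
      have hq : l ∣ q → l ∣ p := fun hp => hl.dvd_of_dvd_pow (n := 2) (by
        have := h2.sub (hp.mul_right q)
        exact this.trans (dvd_of_eq (by ring)))
      rcases hl.dvd_or_dvd h4 with h | h
      · exact hpq h (hp h)
      rcases hl.dvd_or_dvd h with h | h
      · exact hpq (hq h) h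
      · have : l ∣ p := hl.dvd_of_dvd_pow (n := 2) (by
          have := h3.sub (h.mul_right (2 * r))
          exact this.trans (dvd_of_eq (by ring)))
        exact hpq this (hp this)


theorem phi_zero_mod_four (hP : Primitive p q r s) (hB : (4 : ℤ) ∣ phiB p q r s)
    (hC : (4 : ℤ) ∣ phiC p q r s) (hD : (4 : ℤ) ∣ phiD p q r s) :
    2 ∣ p ∧ 2 ∣ q ∧ ¬ (8 ∣ phiB p q r s ∧ 8 ∣ phiC p q r s) := by
  have hE : (2 : ℤ) ∣ p * q + 2 * r * s := by
    have := hC.sub hB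
    simp only [phiB, phiC] at this
    omega
  have hpq : (2 : ℤ) ∣ p * q := by
    have := hE.sub (Dvd.intro (r * s) rfl : (2 : ℤ) ∣ 2 * (r * s))
    exact this.trans (dvd_of_eq (by ring))
  have hpq2 : (2 : ℤ) ∣ p ^ 2 - q ^ 2 := by
    simp only [phiD] at hD; omega
  have h2 : Prime (2 : ℤ) := Int.prime_two
  have hpq3 : (2 : ℤ) ∣ p ∧ 2 ∣ q := by
    rcases h2.dvd_or_dvd hpq with h | h
    · refine ⟨h, h2.dvd_of_dvd_pow (n := 2) ?_⟩
      have := (h.mul_right p).sub hpq2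
      exact this.trans (dvd_of_eq (by ring))
    · refine ⟨h2.dvd_of_dvd_pow (n := 2) ?_, h⟩
      have := (h.mul_right q).add hpq2
      exact this.trans (dvd_of_eq (by ring))
  refine ⟨hpq3.1, hpq3.2, fun ⟨h8, h8'⟩ => ?_⟩
  obtain ⟨⟨P, rfl⟩, ⟨Q, rfl⟩⟩ := hpq3
  have hrs : (2 : ℤ) ∣ r * s := by
    have := h8'.sub h8
    have e : phiC (2 * P) (2 * Q) r s - phiB (2 * P) (2 * Q) r s =
      8 * (P * Q) + 4 * (r * s) := by simp only [phiC, phiB]; ring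
    rw [e] at this
    omega
  have hrs2 : (2 : ℤ) ∣ r ^ 2 - s ^ 2 := by
    have e : phiD (2 * P) (2 * Q) r s = 4 * (P ^ 2 - Q ^ 2) + 2 * (r ^ 2 - s ^ 2) := by
      simp only [phiD]; ring
    rw [e] at hD
    omega
  have hu : IsUnit (2 : ℤ) := by
    rcases h2.dvd_or_dvd hrs with h | h
    · refine hP 2 (by simp) (by simp) h (h2.dvd_of_dvd_pow (n := 2) ?_)
      have := (h.mul_right r).sub hrs2
      exact this.trans (dvd_of_eq (by ring))
    · refine hP 2 (by simp) (by simp) (h2.dvd_of_dvd_pow (n := 2) ?_) h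
      have := (h.mul_right s).add hrs2
      exact this.trans (dvd_of_eq (by ring))
  exact h2.not_isUnit hu

theorem natAbs_le_two_of {m : ℤ} (hm : m ≠ 0) (h : ∀ l : ℤ, Prime l → l ∣ m → l ∣ 2)
    (h4 : ¬ 4 ∣ m) : m ^ 2 ≤ 4 := by
  have key : ∀ x : ℤ, x ≠ 0 → (∀ l : ℤ, Prime l → l ∣ x → l ∣ 2) → ¬ 2 ∣ x → x ^ 2 = 1 := by
    intro x hx hl h2
    by_contra hne
    have : ¬ IsUnit x := fun hu => hne (by
      rcases Int.isUnit_iff.1 hu with rfl | rfl <;> norm_num)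
    obtain ⟨l, hl1, hl2⟩ := WfDvdMonoid.exists_irreducible_factor this hx
    have h3 := hl l hl1.prime hl2
    have := (hl1.dvd_comm Int.prime_two.irreducible).1 h3
    exact h2 (this.trans hl2)
  by_cases h2 : (2 : ℤ) ∣ m
  · obtain ⟨x, rfl⟩ := h2
    have := key x (by rintro rfl; simp at hm) (fun l hl hx => h l hl (hx.mul_left 2))
      (fun hx => h4 (mul_dvd_mul_left 2 hx))
    rw [mul_pow, this]; norm_num
  · rw [key m hm h h2]; norm_num

theorem height_le_of_phi {m t x y z w : ℤ} (ht : t ≠ 0) (hm : m ^ 2 ≤ 4)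
    (h1 : phiA p q r s = m * x) (h2 : phiB p q r s = m * y) (h3 : phiC p q r s = m * z)
    (h4 : phiD p q r s = m * w) :
    height r (q - s) s p ^ 2 ≤ 4 * height (t * x) (t * y) (t * z) (t * w) := by
  have := height_sq_le_phi p q r s
  rw [h1, h2, h3, h4, height_smul] at this
  rw [height_smul]
  have h0 := height_nonneg x y z w
  have ht : 1 ≤ t ^ 2 := by have := sq_pos_of_ne_zero ht; omega
  nlinarith

theorem State.descend (h : State a b c d) (h1 : IsSquare (normA a c))
    (h2 : IsSquare (normB b c)) (h3 : IsSquare (normC a b c)) :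
    ∃ a' b' c' d' : ℤ, State a' b' c' d' ∧ height a' b' c' d' ^ 2 ≤ 4 * height a b c d ∧
      (IsCusp a' b' c' d' → IsCusp a b c d) := by
  obtain ⟨k, p, q, r, s, hk, hA, hB, hC, hD, hq⟩ := h.exists_preimage h1 h2 h3
  have hS := h.of_phi h2 hk hA hB hC hD hq
  obtain ⟨g, p, q, r, s, hg, rfl, rfl, rfl, rfl, hP⟩ := exists_primitive (p := p) (q := q) (r := r)
    (s := s) (by
      rintro ⟨rfl, rfl, rfl, rfl⟩
      exact hS.nontriv (by simp [IsNode]))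
  have hS' : State r (q - s) s p := State.of_smul hg (by rwa [mul_sub])
  have hk0 : ¬ (phiA p q r s = 0 ∧ phiB p q r s = 0 ∧ phiC p q r s = 0 ∧ phiD p q r s = 0) := by
    rintro ⟨e1, e2, e3, -⟩
    have f1 : k * a = 0 := by
      rw [hA, show phiA (g * p) (g * q) (g * r) (g * s) = g ^ 2 * phiA p q r s by
        simp only [phiA]; ring, e1, mul_zero]
    have f2 : k * b = 0 := by
      rw [hB, show phiB (g * p) (g * q) (g * r) (g * s) = g ^ 2 * phiB p q r s by
        simp only [phiB]; ring, e2, mul_zero]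
    have f3 : k * c = 0 := by
      rw [hC, show phiC (g * p) (g * q) (g * r) (g * s) = g ^ 2 * phiC p q r s by
        simp only [phiC]; ring, e3, mul_zero]
    simp only [mul_eq_zero, hk, false_or] at f1 f2 f3
    exact h.nontriv (Or.inl ⟨f1, f2, f3⟩)
  obtain ⟨m, x, y, z, w, hm, e1, e2, e3, e4, hP'⟩ := exists_primitive hk0
  obtain ⟨t, rfl, rfl, rfl, rfl⟩ := hP'.exists_smul (x := g ^ 2 * m) hk
    (by rw [hA, mul_assoc, ← e1]; simp only [phiA]; ring)
    (by rw [hB, mul_assoc, ← e2]; simp only [phiB]; ring)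
    (by rw [hC, mul_assoc, ← e3]; simp only [phiC]; ring)
    (by rw [hD, mul_assoc, ← e4]; simp only [phiD]; ring)
  have ht : t ≠ 0 := by
    rintro rfl
    exact h.nontriv (by simp [IsNode])
  have hl : ∀ l : ℤ, Prime l → l ∣ m → l ∣ 2 := by
    intro l hl hlm
    by_contra h2
    obtain ⟨l1, l2, l3, l4⟩ := odd_prime_not_dvd_phi hl h2 (e1 ▸ hlm.mul_right x)
      (e2 ▸ hlm.mul_right y) (e3 ▸ hlm.mul_right z) (e4 ▸ hlm.mul_right w)
    exact hl.not_isUnit (hP l l1 l2 l3 l4)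
  by_cases h4 : 4 ∣ m
  · obtain ⟨⟨P, rfl⟩, ⟨Q, rfl⟩, h8⟩ := phi_zero_mod_four hP (e2 ▸ h4.mul_right y)
      (e3 ▸ h4.mul_right z) (e4 ▸ h4.mul_right w)
    obtain ⟨n, rfl⟩ : 2 ∣ m := (by norm_num : (2 : ℤ) ∣ 4).trans h4
    have hn4 : ¬ 4 ∣ n := fun hn => h8 (by
      have : (8 : ℤ) ∣ 2 * n := mul_dvd_mul_left 2 hn
      exact ⟨e2 ▸ this.mul_right y, e3 ▸ this.mul_right z⟩)
    have hn : n ^ 2 ≤ 4 := natAbs_le_two_of (by rintro rfl; simp at hm)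
      (fun l hl' hx => hl l hl' (hx.mul_left 2)) hn4
    have f1 : phiA r s P Q = n * x := by
      simp only [phiA] at e1 ⊢; linarith
    have f2 : phiB r s P Q = n * y := by
      simp only [phiB] at e2 ⊢; linarith
    have f3 : phiC r s P Q = n * z := by
      simp only [phiC] at e3 ⊢; linarith
    have f4 : phiD r s P Q = n * w := by
      simp only [phiD] at e4 ⊢; linarith
    refine ⟨P, s - Q, Q, r, State.of_smul two_ne_zero ?_, height_le_of_phi ht hn f1 f2 f3 f4,
      fun hc => ?_⟩
    · have := hS'.translate_two
      convert this using 1 <;> ring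
    · have := hc.phi
      rw [f1, f2, f3, f4] at this
      exact (this.of_smul (by rintro rfl; simp at hm)).smul t
  · refine ⟨r, q - s, s, p, hS', height_le_of_phi ht (natAbs_le_two_of hm hl h4) e1 e2 e3 e4,
      fun hc => ?_⟩
    have := hc.phi
    rw [e1, e2, e3, e4] at this
    exact (this.of_smul hm).smul t

end Kummer

namespace Kummer

variable {a b c d : ℤ}

section Parity

variable {l : ℕ}

theorem dvd_of_not_even_padicValInt {x : ℤ} (h : ¬ Even (padicValInt l x)) : (l : ℤ) ∣ x := by
  by_contra h0
  exact h (by rw [padicValInt.eq_zero_of_not_dvd h0]; exact Even.zero)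

theorem padicValInt_two (h2 : ¬ (l : ℤ) ∣ 2) : padicValInt l 2 = 0 :=
  padicValInt.eq_zero_of_not_dvd h2

variable [hl : Fact l.Prime]

theorem even_padicValInt_of_isSquare {x : ℤ} (h : IsSquare x) : Even (padicValInt l x) := by
  obtain ⟨y, rfl⟩ := h
  by_cases hy : y = 0
  · simp [hy]
  · rw [padicValInt.mul hy hy]; exact ⟨_, rfl⟩

theorem even_padicValInt_mul {x y : ℤ} (hx : x ≠ 0) (hy : y ≠ 0) :
    Even (padicValInt l (x * y)) ↔ (Even (padicValInt l x) ↔ Even (padicValInt l y)) := by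
  rw [padicValInt.mul hx hy, Nat.even_add]

theorem dvd_of_isSquare (h2 : ¬ (l : ℤ) ∣ 2) {x y z : ℤ} (hy : y ≠ 0) (hz : z ≠ 0)
    (h : IsSquare (2 * x * y * z))
    (hyz : ¬ (Even (padicValInt l y) ↔ Even (padicValInt l z))) : (l : ℤ) ∣ x := by
  by_cases hx : x = 0
  · simp [hx]
  apply dvd_of_not_even_padicValInt
  have := even_padicValInt_of_isSquare (l := l) h
  have h2x : (2 : ℤ) * x ≠ 0 := mul_ne_zero two_ne_zero hx
  rw [even_padicValInt_mul (mul_ne_zero h2x hy) hz, even_padicValInt_mul h2x hy,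
    even_padicValInt_mul two_ne_zero hx, padicValInt_two h2] at this
  simp at this
  tauto

theorem parity_of_dvd_disc (h2 : ¬ (l : ℤ) ∣ 2) (hd : (l : ℤ) ∣ disc a b c)
    (hp : ¬ ((l : ℤ) ∣ a ∧ (l : ℤ) ∣ b ∧ (l : ℤ) ∣ c)) (hA : normA a c ≠ 0) (hB : normB b c ≠ 0)
    (hC : normC a b c ≠ 0) (hs : IsSquare (normA a c * normB b c * normC a b c)) :
    Even (padicValInt l (normA a c)) ∧ Even (padicValInt l (normB b c)) := by
  have hl' : Prime (l : ℤ) := Nat.prime_iff_prime_int.1 hl.out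
  have := even_padicValInt_of_isSquare (l := l) hs
  rw [even_padicValInt_mul (mul_ne_zero hA hB) hC, even_padicValInt_mul hA hB] at this
  have f1 : ¬ Even (padicValInt l (normA a c)) → (l : ℤ) ∣ b := fun h =>
    hl'.dvd_of_dvd_pow (n := 2) (((dvd_of_not_even_padicValInt h).add hd).trans
      (dvd_of_eq (by simp only [normA, disc]; ring)))
  have f2 : ¬ Even (padicValInt l (normB b c)) → (l : ℤ) ∣ a := fun h =>
    hl'.dvd_of_dvd_pow (n := 2) (((dvd_of_not_even_padicValInt h).sub hd).trans
      (dvd_of_eq (by simp only [normB, disc]; ring)))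
  have f3 : ¬ Even (padicValInt l (normC a b c)) → (l : ℤ) ∣ c - b := fun h =>
    hl'.dvd_of_dvd_pow (n := 2) (((dvd_of_not_even_padicValInt h).add (hd.mul_left 2)).trans
      (dvd_of_eq (by simp only [normC, disc]; ring)))
  by_contra hne
  apply hp
  have g1 : (l : ℤ) ∣ a → (l : ℤ) ∣ b → (l : ℤ) ∣ c := fun ha hb =>
    hl'.dvd_of_dvd_pow (n := 2) (((hd.add (ha.mul_right a)).sub (hb.mul_right b)).trans
      (dvd_of_eq (by simp only [disc]; ring)))
  by_cases e1 : Even (padicValInt l (normA a c)) <;> by_cases e2 : Even (padicValInt l (normB b c))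
  · exact absurd ⟨e1, e2⟩ hne
  · have ha := f2 e2
    have he := f3 (by tauto)
    have hb : (l : ℤ) ∣ b := by
      have : (l : ℤ) ∣ 2 * b ^ 2 :=
        ((hd.add (ha.mul_right a)).sub (he.mul_right (c + b))).trans
          (dvd_of_eq (by simp only [disc]; ring))
      exact hl'.dvd_of_dvd_pow ((hl'.dvd_or_dvd this).resolve_left h2)
    exact ⟨ha, hb, g1 ha hb⟩
  · have hb := f1 e1
    have he := f3 (by tauto)
    have hc : (l : ℤ) ∣ c := (he.add hb).trans (dvd_of_eq (by ring))
    have ha : (l : ℤ) ∣ a :=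
      hl'.dvd_of_dvd_pow (n := 2) ((((hb.mul_right b).add (hc.mul_right c)).sub hd).trans
        (dvd_of_eq (by simp only [disc]; ring)))
    exact ⟨ha, hb, hc⟩
  · exact ⟨f2 e2, f1 e1, g1 (f2 e2) (f1 e1)⟩

theorem State.symm (h : State a b c d) : State a (-b) (-c) d where
  eq := by rw [← h.eq]; simp only [quartic]; ring
  sqM := isSquare_of_eq (by simp only [normC]; ring) h.sqL
  sqL := isSquare_of_eq (by simp only [normC]; ring) h.sqM
  nontriv := by
    intro hn; apply h.nontriv
    simp only [IsNode] at *; omega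

theorem dvd_pair (h2 : ¬ (l : ℤ) ∣ 2) {x y : ℤ} (h1 : (l : ℤ) ∣ x ^ 2 + y ^ 2)
    (h3 : (l : ℤ) ∣ x ^ 2 + 2 * x * y - y ^ 2) : (l : ℤ) ∣ x ∧ (l : ℤ) ∣ y := by
  have hl' : Prime (l : ℤ) := Nat.prime_iff_prime_int.1 hl.out
  have hx : (l : ℤ) ∣ x → (l : ℤ) ∣ y := fun hx => hl'.dvd_of_dvd_pow (n := 2)
    ((h1.sub (hx.mul_right x)).trans (dvd_of_eq (by ring)))
  have hy : (l : ℤ) ∣ y → (l : ℤ) ∣ x := fun hx => hl'.dvd_of_dvd_pow (n := 2)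
    ((h1.sub (hx.mul_right y)).trans (dvd_of_eq (by ring)))
  have h4 : (l : ℤ) ∣ 2 * (x * (x + y)) := (h1.add h3).trans (dvd_of_eq (by ring))
  rcases hl'.dvd_or_dvd ((hl'.dvd_or_dvd h4).resolve_left h2) with h | h
  · exact ⟨h, hx h⟩
  · have h5 : (l : ℤ) ∣ 2 * y ^ 2 := (h1.sub (h.mul_right (x - y))).trans (dvd_of_eq (by ring))
    have h6 := hl'.dvd_of_dvd_pow ((hl'.dvd_or_dvd h5).resolve_left h2)
    exact ⟨hy h6, h6⟩

theorem State.not_odd_left (h : State a b c d) (h2 : ¬ (l : ℤ) ∣ 2)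
    (hp : ¬ ((l : ℤ) ∣ a ∧ (l : ℤ) ∣ b ∧ (l : ℤ) ∣ c)) (ha : a - c ≠ 0)
    (h1 : ¬ Even (padicValInt l (a - c)))
    (h3 : ¬ (Even (padicValInt l (normB b c)) ↔ Even (padicValInt l (normC a b c)))) : False := by
  have hl' : Prime (l : ℤ) := Nat.prime_iff_prime_int.1 hl.out
  have hac := dvd_of_not_even_padicValInt h1
  have fin : (l : ℤ) ∣ b → (l : ℤ) ∣ c → False := fun hb hc =>
    hp ⟨(hac.add hc).trans (dvd_of_eq (by ring)), hb, hc⟩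
  have cast0 : ∀ x : ℤ, (l : ℤ) ∣ x ↔ ((x : ℤ) : ZMod l) = 0 := fun x =>
    (ZMod.intCast_zmod_eq_zero_iff_dvd x l).symm
  have hq : quartic (a : ZMod l) b c d = 0 := by
    have := congrArg (fun x : ℤ => (x : ZMod l)) h.eq
    simpa [quartic] using this
  have hac' : (a : ZMod l) = c := by
    have := (cast0 _).1 hac
    push_cast at this
    exact sub_eq_zero.1 this
  by_cases hB : Even (padicValInt l (normB b c))
  · have hC : ¬ Even (padicValInt l (normC a b c)) := by tauto
    have hL : (l : ℤ) ∣ d - b - c := dvd_of_isSquare h2 ha h.normB_ne h.isSquare_LB (by tauto)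
    have hd : (d : ZMod l) = b + c := by
      have := (cast0 _).1 hL
      push_cast at this
      linear_combination this
    have h4 : (l : ℤ) ∣ c ^ 2 + b ^ 2 := by
      rw [cast0]
      push_cast
      rw [hac', hd] at hq
      have : ((c : ZMod l) ^ 2 + (b : ZMod l) ^ 2) ^ 2 = 0 := by
        rw [← hq]; simp only [quartic]; ring
      exact pow_eq_zero_iff two_ne_zero |>.1 this
    have h5 : (l : ℤ) ∣ c ^ 2 + 2 * c * (-b) - (-b) ^ 2 := by
      have := (cast0 _).1 (dvd_of_not_even_padicValInt hC)
      simp only [normC] at this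
      push_cast at this
      rw [cast0]
      push_cast
      rw [hac'] at this
      rw [← this]; ring
    have h6 := dvd_pair h2 (h4.trans (dvd_of_eq (by ring))) h5
    exact fin ((dvd_neg.1 h6.2)) h6.1
  · have hM : (l : ℤ) ∣ d + b + c := dvd_of_isSquare h2 ha h.normC_ne h.sqM (by tauto)
    have hd : (d : ZMod l) = -b - c := by
      have := (cast0 _).1 hM
      push_cast at this
      linear_combination this
    have h4 : (l : ℤ) ∣ b ^ 2 + 2 * b * c - c ^ 2 := by
      rw [cast0]
      push_cast
      rw [hac', hd] at hq
      have : ((b : ZMod l) ^ 2 + 2 * b * c - (c : ZMod l) ^ 2) ^ 2 = 0 := by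
        rw [← hq]; simp only [quartic]; ring
      exact pow_eq_zero_iff two_ne_zero |>.1 this
    have h6 := dvd_pair h2 (dvd_of_not_even_padicValInt hB) h4
    exact fin h6.1 h6.2

theorem State.parity (h : State a b c d) (h2 : ¬ (l : ℤ) ∣ 2)
    (hp : ¬ ((l : ℤ) ∣ a ∧ (l : ℤ) ∣ b ∧ (l : ℤ) ∣ c)) (hA : normA a c ≠ 0) :
    Even (padicValInt l (normA a c)) ∧ Even (padicValInt l (normB b c)) := by
  have hl' : Prime (l : ℤ) := Nat.prime_iff_prime_int.1 hl.out
  have hAe : normA a c = (a - c) * (a + c) := by simp only [normA]; ring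
  have ha : a - c ≠ 0 := fun h0 => hA (by rw [hAe, h0, zero_mul])
  have hb : a + c ≠ 0 := fun h0 => hA (by rw [hAe, h0, mul_zero])
  have := even_padicValInt_of_isSquare (l := l) h.isSquare_norms
  rw [even_padicValInt_mul (mul_ne_zero hA h.normB_ne) h.normC_ne,
    even_padicValInt_mul hA h.normB_ne] at this
  have e := even_padicValInt_mul (l := l) ha hb
  rw [← hAe] at e
  have hnA : Even (padicValInt l (normA a c)) := by
    by_contra hne
    have h3 : ¬ (Even (padicValInt l (normB b c)) ↔ Even (padicValInt l (normC a b c))) := by tauto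
    by_cases h4 : Even (padicValInt l (a - c))
    · refine h.symm.not_odd_left h2 ?_ (by rwa [sub_neg_eq_add]) (l := l) ?_ ?_
      · simpa using hp
      · rw [sub_neg_eq_add]; tauto
      · rw [show normB (-b) (-c) = normB b c by simp only [normB]; ring,
          show normC a (-b) (-c) = normC a b c by simp only [normC]; ring]
        exact h3
    · exact h.not_odd_left h2 hp ha h4 h3
  refine ⟨hnA, ?_⟩
  by_contra hB
  have hC : ¬ Even (padicValInt l (normC a b c)) := by tauto
  have hB' := dvd_of_not_even_padicValInt hB
  have hC' := dvd_of_not_even_padicValInt hC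
  have two : ∀ x : ℤ, (l : ℤ) ∣ 2 * x ^ 2 → (l : ℤ) ∣ x := fun x hx =>
    hl'.dvd_of_dvd_pow ((hl'.dvd_or_dvd hx).resolve_left h2)
  by_cases h4 : Even (padicValInt l (a - c))
  · have h5 : Even (padicValInt l (a + c)) := by tauto
    have hL : (l : ℤ) ∣ d - b - c := dvd_of_isSquare h2 ha h.normB_ne h.isSquare_LB (by tauto)
    have hM : (l : ℤ) ∣ d + b + c := dvd_of_isSquare h2 hb h.normB_ne h.isSquare_MB (by tauto)
    have hbc : (l : ℤ) ∣ b + c := by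
      have : (l : ℤ) ∣ 2 * (b + c) := (hM.sub hL).trans (dvd_of_eq (by ring))
      exact (hl'.dvd_or_dvd this).resolve_left h2
    have ha' := two a ((hC'.add (hbc.mul_right (b + c))).trans
      (dvd_of_eq (by simp only [normC]; ring)))
    have hb' := two b ((hB'.sub (hbc.mul_right (c - b))).trans
      (dvd_of_eq (by simp only [normB]; ring)))
    exact hp ⟨ha', hb', (hbc.sub hb').trans (dvd_of_eq (by ring))⟩
  · have h5 : ¬ Even (padicValInt l (a + c)) := by tauto
    have h6 := dvd_of_not_even_padicValInt h4
    have h7 := dvd_of_not_even_padicValInt h5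
    have hc : (l : ℤ) ∣ c := by
      have : (l : ℤ) ∣ 2 * c := (h7.sub h6).trans (dvd_of_eq (by ring))
      exact (hl'.dvd_or_dvd this).resolve_left h2
    have hb' : (l : ℤ) ∣ b := hl'.dvd_of_dvd_pow (n := 2)
      ((hB'.sub (hc.mul_right c)).trans (dvd_of_eq (by simp only [normB]; ring)))
    exact hp ⟨(h6.add hc).trans (dvd_of_eq (by ring)), hb', hc⟩

end Parity

theorem isSquare_or_neg_of_even {x : ℤ} (hx : x ≠ 0)
    (h : ∀ l : ℕ, ∀ _ : Fact l.Prime, Even (padicValInt l x)) : IsSquare x ∨ IsSquare (-x) := by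
  obtain ⟨m, n, hmn, hm⟩ := Nat.sq_mul_squarefree x.natAbs
  have hm1 : m = 1 := by
    by_contra hne
    obtain ⟨l, hl, hlm⟩ := Nat.exists_prime_and_dvd hne
    have : Fact l.Prime := ⟨hl⟩
    obtain ⟨t, rfl⟩ := hlm
    have hlt : ¬ l ∣ t := fun ⟨u, hu⟩ => hl.not_isUnit (hm l ⟨u, by rw [hu]; ring⟩)
    have hn : n ≠ 0 := by
      rintro rfl
      exact hx (Int.natAbs_eq_zero.1 (by rw [← hmn]; simp))
    have ht : t ≠ 0 := by rintro rfl; simp at hlt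
    have h1 := h l this
    rw [padicValInt, ← hmn, padicValNat.mul (pow_ne_zero 2 hn) (mul_ne_zero hl.ne_zero ht),
      padicValNat.mul hl.ne_zero ht, padicValNat.pow, padicValNat_self,
      padicValNat.eq_zero_of_not_dvd hlt] at h1
    rw [Nat.even_add] at h1
    simp at h1
  subst hm1
  have h2 : (x.natAbs : ℤ) = n * n := by rw [← hmn]; push_cast; ring
  rcases Int.natAbs_eq x with h3 | h3
  · left; exact ⟨n, by rw [h3, h2]⟩
  · right; exact ⟨n, by rw [h3, neg_neg, h2]⟩

/-- The form `a ^ 2 - c ^ 2` has even 2-adic valuation. -/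
theorem even_padicValInt_two_normA (hp : ¬ (2 ∣ a ∧ 2 ∣ b ∧ 2 ∣ c)) (hA : normA a c ≠ 0)
    (hB : normB b c ≠ 0) (hC : normC a b c ≠ 0)
    (hs : IsSquare (normA a c * normB b c * normC a b c)) :
    Even (padicValInt 2 (normA a c)) := by
  have := even_padicValInt_of_isSquare (l := 2) hs
  rw [even_padicValInt_mul (mul_ne_zero hA hB) hC, even_padicValInt_mul hA hB] at this
  have odd0 : ∀ x : ℤ, x % 2 = 1 → padicValInt 2 x = 0 := fun x hx =>
    padicValInt.eq_zero_of_not_dvd (by push_cast; omega)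
  have two1 : ∀ x : ℤ, x % 4 = 2 → padicValInt 2 x = 1 := by
    intro x hx
    obtain ⟨y, rfl⟩ : (2 : ℤ) ∣ x := by omega
    rw [padicValInt.mul two_ne_zero (by rintro rfl; simp at hx), odd0 y (by omega)]
    have : padicValInt 2 2 = 1 := by
      have := padicValInt.self (p := 2) (by norm_num); simpa using this
    rw [this]
  have sq0 : ∀ x : ℤ, x % 2 = 0 → x ^ 2 % 4 = 0 := by
    intro x hx
    obtain ⟨y, rfl⟩ : (2 : ℤ) ∣ x := by omega
    rw [mul_pow]; omega
  have sq1 : ∀ x : ℤ, x % 2 = 1 → x ^ 2 % 4 = 1 := by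
    intro x hx
    obtain ⟨y, rfl⟩ : ∃ y, x = 2 * y + 1 := ⟨x / 2, by omega⟩
    ring_nf; omega
  have nB : normB b c = b ^ 2 + c ^ 2 := rfl
  have nA : normA a c = a ^ 2 - c ^ 2 := rfl
  have nC : normC a b c = 2 * a ^ 2 - (b + c) ^ 2 := rfl
  rcases Int.emod_two_eq_zero_or_one a with ha | ha <;>
    rcases Int.emod_two_eq_zero_or_one c with hc | hc
  · have hb : b % 2 = 1 := by omega
    have e1 := sq0 a ha; have e2 := sq0 c hc; have e3 := sq1 b hb
    have e4 := sq1 (b + c) (by omega)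
    rw [odd0 (normB b c) (by omega), odd0 (normC a b c) (by omega)] at this
    simpa using this
  · have e1 := sq0 a ha; have e2 := sq1 c hc
    rw [odd0 (normA a c) (by omega)]; exact Even.zero
  · have e1 := sq1 a ha; have e2 := sq0 c hc
    rw [odd0 (normA a c) (by omega)]; exact Even.zero
  · have e1 := sq1 a ha; have e2 := sq1 c hc
    rcases Int.emod_two_eq_zero_or_one b with hb | hb
    · have e3 := sq0 b hb
      have e4 := sq1 (b + c) (by omega)
      rw [odd0 (normB b c) (by omega), odd0 (normC a b c) (by omega)] at this
      simpa using this
    · have e3 := sq1 b hb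
      have e4 := sq0 (b + c) (by omega)
      rw [two1 (normB b c) (by omega), two1 (normC a b c) (by omega)] at this
      simpa using this

end Kummer

namespace Kummer

variable {a b c d : ℤ}

/-- All three node forms are squares. -/
def AllSquare (a b c : ℤ) : Prop :=
  IsSquare (normA a c) ∧ IsSquare (normB b c) ∧ IsSquare (normC a b c)

theorem State.square_classes (h : State a b c d) (hA : normA a c ≠ 0) :
    (IsSquare (normA a c) ∨ IsSquare (-normA a c)) ∧
      (IsSquare (normB b c) ∨ IsSquare (2 * normB b c)) := by
  obtain ⟨k, a, b, c, d, hk, rfl, rfl, rfl, rfl, hP⟩ := exists_primitive (p := a) (q := b) (r := c)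
    (s := d) (by rintro ⟨rfl, rfl, rfl, rfl⟩; exact h.nontriv (by simp [IsNode]))
  replace h := h.of_smul hk
  obtain ⟨g, a, b, c, e, hg, rfl, rfl, rfl, he, hP'⟩ := exists_primitive (p := a) (q := b) (r := c)
    (s := 0) (by rintro ⟨rfl, rfl, rfl, -⟩; exact h.nontriv (by simp [IsNode]))
  have he0 : e = 0 := by simpa [hg, eq_comm] using he
  subst he0
  have hkg : k * g ≠ 0 := mul_ne_zero hk hg
  have eA : ∀ t : ℤ, normA (t * a) (t * c) = normA a c * t ^ 2 := fun t => by
    simp only [normA]; ring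
  have eB : ∀ t : ℤ, normB (t * b) (t * c) = normB b c * t ^ 2 := fun t => by
    simp only [normB]; ring
  have eC : ∀ t : ℤ, normC (t * a) (t * b) (t * c) = normC a b c * t ^ 2 := fun t => by
    simp only [normC]; ring
  have hA0 : normA a c ≠ 0 := fun h0 => hA (by rw [← mul_assoc, ← mul_assoc, eA, h0, zero_mul])
  have hB0 : normB b c ≠ 0 := fun h0 => h.normB_ne (by rw [eB, h0, zero_mul])
  have hC0 : normC a b c ≠ 0 := fun h0 => h.normC_ne (by rw [eC, h0, zero_mul])
  have hs : IsSquare (normA a c * normB b c * normC a b c) := by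
    have := h.isSquare_norms
    rw [eA, eB, eC] at this
    exact isSquare_of_mul_sq (pow_ne_zero 3 hg) (isSquare_of_eq (by ring) this)
  have hp : ∀ l : ℕ, l.Prime → ¬ ((l : ℤ) ∣ a ∧ (l : ℤ) ∣ b ∧ (l : ℤ) ∣ c) :=
    fun l hl ⟨h1, h2, h3⟩ => (Nat.prime_iff_prime_int.1 hl).not_isUnit (hP' l h1 h2 h3 (dvd_zero _))
  have odd : ∀ l : ℕ, ∀ _ : Fact l.Prime, l ≠ 2 →
      Even (padicValInt l (normA a c)) ∧ Even (padicValInt l (normB b c)) := by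
    intro l hl hl2
    have h2 : ¬ (l : ℤ) ∣ 2 := fun h => hl2
      ((Nat.prime_dvd_prime_iff_eq hl.out Nat.prime_two).1 (by exact_mod_cast h))
    have hl' : Prime (l : ℤ) := Nat.prime_iff_prime_int.1 hl.out
    by_cases hlg : (l : ℤ) ∣ g
    · refine parity_of_dvd_disc h2 ?_ (hp l hl.out) hA0 hB0 hC0 hs
      have hld : ¬ (l : ℤ) ∣ d := fun hd => hl'.not_isUnit
        (hP l (hlg.mul_right a) (hlg.mul_right b) (hlg.mul_right c) hd)
      have e1 : g ^ 2 * (d ^ 2 * disc a b c + g * (2 * a * b * d * (c - b) + g *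
          (disc a b c * (b ^ 2 - c ^ 2 - 2 * b * c) + (a ^ 2 - b ^ 2) * (c - b) ^ 2
            + 2 * a ^ 2 * b ^ 2))) = 0 := by
        rw [← h.eq]; simp only [quartic, disc]; ring
      have e2 := (mul_eq_zero.1 e1).resolve_left (pow_ne_zero 2 hg)
      have e3 : (l : ℤ) ∣ d ^ 2 * disc a b c := by
        rw [eq_neg_of_add_eq_zero_left e2, dvd_neg]
        exact hlg.mul_right _
      exact (hl'.dvd_or_dvd e3).resolve_left fun h => hld (hl'.dvd_of_dvd_pow h)
    · have hlp : ¬ ((l : ℤ) ∣ g * a ∧ (l : ℤ) ∣ g * b ∧ (l : ℤ) ∣ g * c) := fun ⟨h1, h2, h3⟩ =>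
        hp l hl.out ⟨(hl'.dvd_or_dvd h1).resolve_left hlg, (hl'.dvd_or_dvd h2).resolve_left hlg,
          (hl'.dvd_or_dvd h3).resolve_left hlg⟩
      have := h.parity h2 hlp (by rw [eA]; exact mul_ne_zero hA0 (pow_ne_zero 2 hg))
      rw [eA, eB, even_padicValInt_mul hA0 (pow_ne_zero 2 hg),
        even_padicValInt_mul hB0 (pow_ne_zero 2 hg)] at this
      have e := even_padicValInt_of_isSquare (l := l) (IsSquare.sq g)
      exact ⟨this.1.2 e, this.2.2 e⟩
  have hA1 : IsSquare (normA a c) ∨ IsSquare (-normA a c) := by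
    refine isSquare_or_neg_of_even hA0 fun l hl => ?_
    by_cases hl2 : l = 2
    · subst hl2
      exact even_padicValInt_two_normA (hp 2 Nat.prime_two) hA0 hB0 hC0 hs
    · exact (odd l hl hl2).1
  have hBn : 0 ≤ normB b c := by simp only [normB]; positivity
  have hB1 : IsSquare (normB b c) ∨ IsSquare (2 * normB b c) := by
    have : Fact (Nat.Prime 2) := ⟨Nat.prime_two⟩
    have nonneg : ∀ x : ℤ, 0 ≤ x → IsSquare x ∨ IsSquare (-x) → IsSquare x := by
      intro x hx h
      rcases h with h | h
      · exact h
      · obtain ⟨y, hy⟩ := h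
        have : x = 0 := by nlinarith [mul_self_nonneg y]
        subst this; exact IsSquare.zero
    by_cases h2 : Even (padicValInt 2 (normB b c))
    · left
      refine nonneg _ hBn (isSquare_or_neg_of_even hB0 fun l hl => ?_)
      by_cases hl2 : l = 2
      · subst hl2; exact h2
      · exact (odd l hl hl2).2
    · right
      refine nonneg _ (by positivity) (isSquare_or_neg_of_even (mul_ne_zero two_ne_zero hB0)
        fun l hl => ?_)
      rw [even_padicValInt_mul two_ne_zero hB0]
      by_cases hl2 : l = 2
      · subst hl2
        have : padicValInt 2 2 = 1 := by
          have := padicValInt.self (p := 2) (by norm_num); simpa using this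
        rw [this]; simpa using h2
      · have h2 : ¬ (l : ℤ) ∣ 2 := fun h => hl2
          ((Nat.prime_dvd_prime_iff_eq hl.out Nat.prime_two).1 (by exact_mod_cast h))
        rw [padicValInt_two h2]
        simpa using (odd l hl hl2).2
  rw [← mul_assoc, ← mul_assoc, ← mul_assoc, eA, eB]
  have sq := IsSquare.sq (k * g)
  refine ⟨hA1.imp (fun h => h.mul sq) (fun h => isSquare_of_eq (by ring) (h.mul sq)),
    hB1.imp (fun h => h.mul sq) (fun h => isSquare_of_eq (by ring) (h.mul sq))⟩

theorem State.allSquare_one (h : State a b c d) (h1 : IsSquare (-normA a c))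
    (h2 : IsSquare (normB b c)) (h3 : IsSquare (-normC a b c)) : AllSquare c (a - d) (-a) := by
  refine ⟨isSquare_of_eq (by simp only [normA]; ring) h1, ?_, ?_⟩
  · refine isSquare_left_of_mul h.normB_ne (isSquare_of_eq ?_ h.isSquare_dualB) h2
    simp only [normB]; ring
  · refine isSquare_left_of_mul (neg_ne_zero.2 h.normC_ne) (isSquare_of_eq ?_ h.isSquare_dualC) h3
    simp only [normC]; ring

theorem State.allSquare_orbit_aux (h : State a b c d) (hA : normA a c ≠ 0) :
    AllSquare a b c ∨ AllSquare c (a - d) (-a) ∨ AllSquare d (c - b) (c + b) ∨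
      AllSquare (c + b) (d - 2 * a) (-d) := by
  have hN := h.isSquare_norms
  have hL := h.isSquare_linear
  obtain ⟨h1 | h1, h2 | h2⟩ := h.square_classes hA
  · exact Or.inl ⟨h1, h2, isSquare_left_of_mul (mul_ne_zero hA h.normB_ne)
      (isSquare_of_eq (by ring) hN) (h1.mul h2)⟩
  · have h3 : IsSquare (2 * normC a b c) := isSquare_left_of_mul
      (mul_ne_zero hA (mul_ne_zero two_ne_zero h.normB_ne))
      (isSquare_of_eq (by ring) (hN.mul (IsSquare.sq (2 : ℤ)))) (h1.mul h2)
    refine Or.inr (Or.inr (Or.inl ⟨?_, isSquare_of_eq (by simp only [normB]; ring) h2, ?_⟩))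
    · exact isSquare_left_of_mul hA (isSquare_of_eq (by simp only [normA]; ring) hL) h1
    · exact isSquare_left_of_mul (mul_ne_zero two_ne_zero h.normC_ne) (isSquare_of_eq
        (by simp only [normC]; ring) (h.isSquare_dualC.mul (IsSquare.sq (2 : ℤ)))) h3
  · have h3 : IsSquare (-normC a b c) := isSquare_left_of_mul
      (mul_ne_zero (neg_ne_zero.2 hA) h.normB_ne)
      (isSquare_of_eq (by ring) hN) (h1.mul h2)
    exact Or.inr (Or.inl (h.allSquare_one h1 h2 h3))
  · have h3 : IsSquare (2 * -normC a b c) := isSquare_left_of_mul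
      (mul_ne_zero (neg_ne_zero.2 hA) (mul_ne_zero two_ne_zero h.normB_ne))
      (isSquare_of_eq (by ring) (hN.mul (IsSquare.sq (2 : ℤ)))) (h1.mul h2)
    refine Or.inr (Or.inr (Or.inr (h.translate_two.allSquare_one ?_
      (isSquare_of_eq (by simp only [normB]; ring) h2) ?_)))
    · exact isSquare_left_of_mul (neg_ne_zero.2 hA)
        (isSquare_of_eq (by simp only [normA]; ring) hL) h1
    · exact isSquare_left_of_mul (mul_ne_zero two_ne_zero (neg_ne_zero.2 h.normC_ne))
        (isSquare_of_eq (by simp only [normC]; ring) (h.isSquare_dualC.mul (IsSquare.sq (2 : ℤ)))) h3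

theorem AllSquare.of_two_mul (h : AllSquare (2 * a) (2 * b) (2 * c)) : AllSquare a b c := by
  obtain ⟨h1, h2, h3⟩ := h
  refine ⟨isSquare_of_mul_sq two_ne_zero (isSquare_of_eq ?_ h1),
    isSquare_of_mul_sq two_ne_zero (isSquare_of_eq ?_ h2),
    isSquare_of_mul_sq two_ne_zero (isSquare_of_eq ?_ h3)⟩
  · simp only [normA]; ring
  · simp only [normB]; ring
  · simp only [normC]; ring

theorem State.allSquare_orbit (h : State a b c d) :
    AllSquare a b c ∨ AllSquare c (a - d) (-a) ∨ AllSquare d (c - b) (c + b) ∨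
      AllSquare (c + b) (d - 2 * a) (-d) := by
  by_cases hA : normA a c = 0
  · have hA' : (a - c) * (a + c) = 0 := by rw [← hA]; simp only [normA]; ring
    have h0 : normA d (c + b) ≠ 0 := by
      intro h0
      have h0' : (d - b - c) * (d + b + c) = 0 := by rw [← h0]; simp only [normA]; ring
      rcases mul_eq_zero.1 hA' with h1 | h1 <;> rcases mul_eq_zero.1 h0' with h2 | h2
      exacts [h.not_both_L' h1 h2, h.not_both_M h1 h2, h.not_both_L h1 h2, h.not_both_M' h1 h2]
    rcases h.translate_two.allSquare_orbit_aux h0 with h1 | h1 | h1 | h1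
    · exact Or.inr (Or.inr (Or.inl h1))
    · exact Or.inr (Or.inr (Or.inr h1))
    · refine Or.inl (AllSquare.of_two_mul ?_)
      convert h1 using 1 <;> ring
    · refine Or.inr (Or.inl (AllSquare.of_two_mul ?_))
      convert h1 using 1 <;> ring
  · exact h.allSquare_orbit_aux hA

theorem State.exists_descent (h : State a b c d) :
    ∃ a' b' c' d' : ℤ, State a' b' c' d' ∧ height a' b' c' d' ^ 2 ≤ 8 * height a b c d ∧
      (IsCusp a' b' c' d' → IsCusp a b c d) := by
  have h0 := height_nonneg a b c d
  have e1 : height c (a - d) (-a) (b + c) = height a b c d := by simp only [height]; ring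
  have e2 : height d (c - b) (c + b) (2 * a) = 2 * height a b c d := by simp only [height]; ring
  have e3 : height (c + b) (d - 2 * a) (-d) (c - b + (c + b)) = 2 * height a b c d := by
    simp only [height]; ring
  rcases h.allSquare_orbit with ⟨s1, s2, s3⟩ | ⟨s1, s2, s3⟩ | ⟨s1, s2, s3⟩ | ⟨s1, s2, s3⟩
  · obtain ⟨a', b', c', d', hs, hh, hc⟩ := h.descend s1 s2 s3
    exact ⟨a', b', c', d', hs, by linarith, hc⟩
  · obtain ⟨a', b', c', d', hs, hh, hc⟩ := h.translate_one.descend s1 s2 s3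
    exact ⟨a', b', c', d', hs, by linarith, fun h => (hc h).of_translate_one⟩
  · obtain ⟨a', b', c', d', hs, hh, hc⟩ := h.translate_two.descend s1 s2 s3
    exact ⟨a', b', c', d', hs, by linarith, fun h => (hc h).of_translate_two⟩
  · obtain ⟨a', b', c', d', hs, hh, hc⟩ := h.translate_two.translate_one.descend s1 s2 s3
    exact ⟨a', b', c', d', hs, by linarith, fun h => (hc h).of_translate_one.of_translate_two⟩

theorem small_points : ∀ a ∈ Finset.Icc (-2 : ℤ) 2, ∀ b ∈ Finset.Icc (-2 : ℤ) 2,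
    ∀ c ∈ Finset.Icc (-2 : ℤ) 2, ∀ e ∈ Finset.Icc (-2 : ℤ) 2,
    quartic a b c (a + e) = 0 → IsNode a b c (a + e) ∨ IsCusp a b c (a + e) := by
  unfold quartic IsNode IsCusp
  decide +kernel

/-- Every state is a cusp. -/
theorem State.isCusp (h : State a b c d) : IsCusp a b c d := by
  obtain ⟨n, hn⟩ : ∃ n : ℕ, (height a b c d).toNat = n := ⟨_, rfl⟩
  induction n using Nat.strong_induction_on generalizing a b c d with
  | _ n ih =>
    have h0 := height_nonneg a b c d
    by_cases hs : height a b c d ≤ 8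
    · have bd : ∀ x : ℤ, x ^ 2 ≤ 8 → x ∈ Finset.Icc (-2 : ℤ) 2 := fun x hx =>
        Finset.mem_Icc.2 ⟨by nlinarith, by nlinarith⟩
      simp only [height] at hs
      have := small_points a (bd a (by nlinarith)) b (bd b (by nlinarith)) c (bd c (by nlinarith))
        (d - a) (bd (d - a) (by nlinarith))
      rw [add_sub_cancel] at this
      exact (this h.eq).resolve_left h.nontriv
    · obtain ⟨a', b', c', d', hs', hh, hc⟩ := h.exists_descent
      have h1 := height_nonneg a' b' c' d'
      have : height a' b' c' d' < height a b c d := by nlinarith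
      exact hc (ih _ (by omega) hs' rfl)

section Start

variable {t n u v d : ℚ}

/-- The relations satisfied by `t, n, u, v` when `u + v s` is a square root of
`(s ^ 2 - 1) (s ^ 2 + 1) (s ^ 2 + 2 s - 1)` and `s ^ 2 = t s - n`. -/
structure Start (t n u v : ℚ) : Prop where
  const : u ^ 2 - v ^ 2 * n =
    -n * ((t ^ 4 - 3 * t ^ 2 * n + n ^ 2) + 2 * (t ^ 3 - 2 * t * n) - (t ^ 2 - n) - 1) + 1
  lin : 2 * u * v + v ^ 2 * t =
    (t ^ 5 - 4 * t ^ 3 * n + 3 * t * n ^ 2) + 2 * (t ^ 4 - 3 * t ^ 2 * n + n ^ 2)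
      - (t ^ 3 - 2 * t * n) - t - 2

theorem Start.norm (h : Start t n u v) : (u ^ 2 + u * v * t + v ^ 2 * n) ^ 2 =
    normA (1 + n) t * normB (1 - n) t * normC (1 + n) (1 - n) t := by
  have : (u ^ 2 + u * v * t + v ^ 2 * n) ^ 2 = (u ^ 2 - v ^ 2 * n) ^ 2
      + (u ^ 2 - v ^ 2 * n) * (2 * u * v + v ^ 2 * t) * t + (2 * u * v + v ^ 2 * t) ^ 2 * n := by
    ring
  rw [this, h.const, h.lin]
  simp only [normA, normB, normC]; ring

theorem Start.quartic_eq (h : Start t n u v) (hd : disc (1 + n) (1 - n) t ≠ 0)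
    (hw : d * disc (1 + n) (1 - n) t =
      -(u ^ 2 + u * v * t + v ^ 2 * n) - (1 + n) * (1 - n) * (t - (1 - n))) :
    quartic (1 + n) (1 - n) t d = 0 := by
  have h1 : (d * disc (1 + n) (1 - n) t + (1 + n) * (1 - n) * (t - (1 - n))) ^ 2 =
      normA (1 + n) t * normB (1 - n) t * normC (1 + n) (1 - n) t
        + disc (1 + n) (1 - n) t * quartic (1 + n) (1 - n) t d := by
    simp only [disc, normA, normB, normC, quartic]; ring
  rw [hw, ← h.norm] at h1
  have : disc (1 + n) (1 - n) t * quartic (1 + n) (1 - n) t d = 0 := by linarith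
  exact (mul_eq_zero.1 this).resolve_left hd

theorem Start.sqL (h : Start t n u v) (hd : disc (1 + n) (1 - n) t ≠ 0)
    (hw : d * disc (1 + n) (1 - n) t =
      -(u ^ 2 + u * v * t + v ^ 2 * n) - (1 + n) * (1 - n) * (t - (1 - n))) :
    2 * (d - (1 - n) - t) * ((1 + n) + t) * normC (1 + n) (1 - n) t =
      ((-t * n - 3 * n - 1) * v - (t ^ 2 - n + 3 * t + 1) * u) ^ 2 := by
  have h0 := h.const
  have h1 := h.lin
  apply mul_left_cancel₀ hd
  have h2 : disc (1 + n) (1 - n) t * (d - (1 - n) - t) =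
    d * disc (1 + n) (1 - n) t - disc (1 + n) (1 - n) t * ((1 - n) + t) := by ring
  rw [hw] at h2
  have h3 : disc (1 + n) (1 - n) t = t ^ 2 - 4 * n := by simp only [disc]; ring
  rw [h3] at h2 ⊢
  simp only [normC]
  linear_combination (2 * ((1 + n) + t) * (2 * (1 + n) ^ 2 - ((1 - n) + t) ^ 2)) * h2
    + ((-2) * ((1 + n) + t) * (2 * (1 + n) ^ 2 - ((1 - n) + t) ^ 2) -
      (t ^ 2 - 4 * n) * (t ^ 2 - n + 3 * t + 1) ^ 2) * h0
    + (- t * ((1 + n) + t) * (2 * (1 + n) ^ 2 - ((1 - n) + t) ^ 2) +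
      (t ^ 2 - 4 * n) * (t ^ 2 - n + 3 * t + 1) * (-t * n - 3 * n - 1)) * h1

theorem Start.sqM (h : Start t n u v) (hd : disc (1 + n) (1 - n) t ≠ 0)
    (hw : d * disc (1 + n) (1 - n) t =
      -(u ^ 2 + u * v * t + v ^ 2 * n) - (1 + n) * (1 - n) * (t - (1 - n))) :
    2 * (d + (1 - n) + t) * ((1 + n) - t) * normC (1 + n) (1 - n) t =
      ((-t * n - n + 1) * v - (t ^ 2 - n + t - 3) * u) ^ 2 := by
  have h0 := h.const
  have h1 := h.lin
  apply mul_left_cancel₀ hd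
  have h2 : disc (1 + n) (1 - n) t * (d + (1 - n) + t) =
    d * disc (1 + n) (1 - n) t + disc (1 + n) (1 - n) t * ((1 - n) + t) := by ring
  rw [hw] at h2
  have h3 : disc (1 + n) (1 - n) t = t ^ 2 - 4 * n := by simp only [disc]; ring
  rw [h3] at h2 ⊢
  simp only [normC]
  linear_combination (2 * ((1 + n) - t) * (2 * (1 + n) ^ 2 - ((1 - n) + t) ^ 2)) * h2
    + ((-2) * ((1 + n) - t) * (2 * (1 + n) ^ 2 - ((1 - n) + t) ^ 2) -
      (t ^ 2 - 4 * n) * (t ^ 2 - n + t - 3) ^ 2) * h0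
    + (- t * ((1 + n) - t) * (2 * (1 + n) ^ 2 - ((1 - n) + t) ^ 2) +
      (t ^ 2 - 4 * n) * (t ^ 2 - n + t - 3) * (-t * n - n + 1)) * h1

theorem isSquare_of_cast_eq_sq {x : ℤ} {r : ℚ} (h : (x : ℚ) = r ^ 2) : IsSquare x := by
  rw [← Rat.isSquare_intCast_iff]
  exact ⟨r, by rw [h, pow_two]⟩

/-- A start that is not a node comes from a cusp. -/
theorem Start.eq_cusp (h : Start t n u v) (hd : t ^ 2 - 4 * n ≠ 0)
    (h1 : ¬ (n = 1 ∧ t = 0)) (h2 : ¬ (n = -1 ∧ t = 0)) (h3 : ¬ (n = -1 ∧ t = -2)) :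
    n = 0 ∧ (t = 0 ∨ t = 1 ∨ t = -1) := by
  have hdd : disc (1 + n) (1 - n) t = t ^ 2 - 4 * n := by simp only [disc]; ring
  obtain ⟨d, hw⟩ : ∃ d, d * disc (1 + n) (1 - n) t =
      -(u ^ 2 + u * v * t + v ^ 2 * n) - (1 + n) * (1 - n) * (t - (1 - n)) :=
    ⟨_, div_mul_cancel₀ _ (hdd ▸ hd)⟩
  obtain ⟨k, hk, N, T, E, hN, hT, hE⟩ : ∃ k : ℤ, k ≠ 0 ∧ ∃ N T E : ℤ,
      (N : ℚ) = k * n ∧ (T : ℚ) = k * t ∧ (E : ℚ) = k * d := by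
    refine ⟨n.den * t.den * d.den, by simp, n.num * t.den * d.den, t.num * n.den * d.den,
      d.num * n.den * t.den, ?_, ?_, ?_⟩
    · push_cast; linear_combination (-t.den * d.den : ℚ) * Rat.mul_den_eq_num n
    · push_cast; linear_combination (-n.den * d.den : ℚ) * Rat.mul_den_eq_num t
    · push_cast; linear_combination (-n.den * t.den : ℚ) * Rat.mul_den_eq_num d
  have hkq : (k : ℚ) ≠ 0 := by exact_mod_cast hk
  have hA : ∀ {x : ℤ} {y : ℚ}, (x : ℚ) = k * y → x = 0 → y = 0 := by
    intro x y hxy hx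
    rw [hx, Int.cast_zero] at hxy
    exact (mul_eq_zero.1 hxy.symm).resolve_left hkq
  have hst : State (k + N) (k - N) T E := by
    refine ⟨?_, ?_, ?_, ?_⟩
    · have := h.quartic_eq (hdd ▸ hd) hw
      have h5 : ((quartic (k + N) (k - N) T E : ℤ) : ℚ) = k ^ 4 * quartic (1 + n) (1 - n) t d := by
        simp only [quartic]; push_cast; rw [hN, hT, hE]; ring
      rw [this, mul_zero] at h5
      exact_mod_cast h5
    · apply isSquare_of_cast_eq_sq
        (r := k ^ 2 * ((-t * n - n + 1) * v - (t ^ 2 - n + t - 3) * u))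
      rw [mul_pow, ← h.sqM (hdd ▸ hd) hw]
      simp only [normC]; push_cast; rw [hN, hT, hE]; ring
    · apply isSquare_of_cast_eq_sq
        (r := k ^ 2 * ((-t * n - 3 * n - 1) * v - (t ^ 2 - n + 3 * t + 1) * u))
      rw [mul_pow, ← h.sqL (hdd ▸ hd) hw]
      simp only [normC]; push_cast; rw [hN, hT, hE]; ring
    · have e1 : k + N = 0 → 1 + n = 0 := hA (by push_cast; rw [hN]; ring)
      have e2 : k - N = 0 → 1 - n = 0 := hA (by push_cast; rw [hN]; ring)
      have e3 : T = 0 → t = 0 := hA (by rw [hT])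
      have e4 : k - N + T = 0 → 1 - n + t = 0 := hA (by push_cast; rw [hN, hT]; ring)
      rintro (⟨ha, hb, -⟩ | ⟨hb, hc, -⟩ | ⟨ha, hc, -⟩ | ⟨ha, hb, -⟩)
      · linarith [e1 ha, e2 hb]
      · exact h1 ⟨by linarith [e2 hb], e3 hc⟩
      · exact h2 ⟨by linarith [e1 ha], e3 hc⟩
      · exact h3 ⟨by linarith [e1 ha], by linarith [e1 ha, e4 hb]⟩
  have hn : (k - N) ^ 2 = (k + N) ^ 2 → n = 0 := fun h5 =>
    hA hN ((mul_eq_zero.1 (by linarith : k * N = 0)).resolve_left hk)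
  rcases hst.isCusp with ⟨ha, hb, -⟩ | ⟨hc, -, hab⟩ | ⟨-, hc, hab⟩ | ⟨hc, -, hab⟩
  · omega
  · exact ⟨hn hab, Or.inl (hA hT hc)⟩
  · have h0 := hn hab.symm
    have h5 := hA (x := T - (k - N)) (y := t - (1 - n)) (by push_cast; rw [hN, hT]; ring)
      (by omega)
    exact ⟨h0, Or.inr (Or.inl (by linarith))⟩
  · have h0 := hn hab
    have h5 := hA (x := T + (k - N)) (y := t + (1 - n)) (by push_cast; rw [hN, hT]; ring)
      (by omega)
    exact ⟨h0, Or.inr (Or.inr (by linarith))⟩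

end Start

open Module in
/-- Quadratic points on `y ^ 2 = (x ^ 2 - 1) (x ^ 2 + 1) (x ^ 2 + 2 x - 1)` with `y ≠ 0`
have rational `x`-coordinate. -/
theorem rational_of_quadratic_point {K : Type*} [Field K] [NumberField K]
    (hK : finrank ℚ K = 2) {s y : K} (hy : y ≠ 0)
    (h : y ^ 2 = (s ^ 2 - 1) * (s ^ 2 + 1) * (s ^ 2 + 2 * s - 1)) : ∃ q : ℚ, (q : K) = s := by
  by_contra hs
  push Not at hs
  have hli : LinearIndependent ℚ ![(1 : K), s] := by
    rw [LinearIndependent.pair_iff]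
    intro x z hxz
    simp only [Algebra.smul_def, eq_ratCast, mul_one] at hxz
    have hz : z = 0 := by
      by_contra hz
      have : (z : K) ≠ 0 := by exact_mod_cast hz
      apply hs (-x / z)
      push_cast
      field_simp
      linear_combination -hxz
    subst hz
    simpa using hxz
  have hspan : ∀ w : K, ∃ p q : ℚ, w = p + q * s := by
    intro w
    have htop := hli.span_eq_top_of_card_eq_finrank (by simp [hK])
    have : w ∈ Submodule.span ℚ (Set.range ![(1 : K), s]) := htop ▸ Submodule.mem_top
    rw [Matrix.range_cons, Matrix.range_cons, Matrix.range_empty, Set.union_empty] at this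
    obtain ⟨p, q, hpq⟩ := Submodule.mem_span_pair.1 this
    exact ⟨p, q, by rw [← hpq]; simp [Algebra.smul_def]⟩
  have huniq : ∀ p q : ℚ, (p : K) + q * s = 0 → p = 0 ∧ q = 0 := by
    intro p q hpq
    exact (LinearIndependent.pair_iff.1 hli) p q (by simpa [Algebra.smul_def] using hpq)
  obtain ⟨n', t, hs2⟩ := hspan (s ^ 2)
  obtain ⟨n, rfl⟩ : ∃ n, n' = -n := ⟨-n', by simp⟩
  obtain ⟨u, v, huv⟩ := hspan y
  push_cast at hs2
  have hstart : Start t n u v := by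
    have key : ((u ^ 2 - v ^ 2 * n - (-n * ((t ^ 4 - 3 * t ^ 2 * n + n ^ 2)
        + 2 * (t ^ 3 - 2 * t * n) - (t ^ 2 - n) - 1) + 1) : ℚ) : K)
        + ((2 * u * v + v ^ 2 * t - ((t ^ 5 - 4 * t ^ 3 * n + 3 * t * n ^ 2)
        + 2 * (t ^ 4 - 3 * t ^ 2 * n + n ^ 2) - (t ^ 3 - 2 * t * n) - t - 2) : ℚ) : K) * s = 0 := by
      push_cast
      have e3 : s ^ 3 = (t ^ 2 - n) * s - n * t := by linear_combination (s + t) * hs2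
      have e4 : s ^ 4 = (t ^ 3 - 2 * t * n) * s - n * (t ^ 2 - n) := by
        linear_combination s * e3 + (t ^ 2 - n) * hs2
      have e5 : s ^ 5 = (t ^ 4 - 3 * t ^ 2 * n + n ^ 2) * s - n * (t ^ 3 - 2 * t * n) := by
        linear_combination s * e4 + (t ^ 3 - 2 * t * n) * hs2
      have e6 : s ^ 6 = (t ^ 5 - 4 * t ^ 3 * n + 3 * t * n ^ 2) * s
          - n * (t ^ 4 - 3 * t ^ 2 * n + n ^ 2) := by
        linear_combination s * e5 + (t ^ 4 - 3 * t ^ 2 * n + n ^ 2) * hs2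
      rw [huv] at h
      linear_combination h + e6 + 2 * e5 - e4 - hs2 - v ^ 2 * hs2
    obtain ⟨k1, k2⟩ := huniq _ _ key
    exact ⟨by linarith, by linarith⟩
  have hds : (2 * s - t) ^ 2 = ((t ^ 2 - 4 * n : ℚ) : K) := by
    push_cast; linear_combination 4 * hs2
  have hy2 : y ^ 2 ≠ 0 := pow_ne_zero 2 hy
  have hd : t ^ 2 - 4 * n ≠ 0 := by
    intro h0
    rw [h0, Rat.cast_zero] at hds
    have := pow_eq_zero_iff (two_ne_zero) |>.1 hds
    exact hs (t / 2) (by push_cast; linear_combination -this / 2)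
  obtain ⟨hn0, -⟩ := hstart.eq_cusp hd
    (by
      rintro ⟨rfl, rfl⟩
      apply hy2; rw [h]
      push_cast at hs2
      linear_combination ((s ^ 2 - 1) * (s ^ 2 + 2 * s - 1)) * hs2)
    (by
      rintro ⟨rfl, rfl⟩
      apply hy2; rw [h]
      push_cast at hs2
      linear_combination ((s ^ 2 + 1) * (s ^ 2 + 2 * s - 1)) * hs2)
    (by
      rintro ⟨rfl, rfl⟩
      apply hy2; rw [h]
      push_cast at hs2
      linear_combination ((s ^ 2 + 1) * (s ^ 2 - 1)) * hs2)
  rw [hn0] at hs2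
  have : s * (s - t) = 0 := by
    linear_combination hs2 + (Rat.cast_zero : ((0 : ℚ) : K) = 0)
  rcases mul_eq_zero.1 this with h' | h'
  · exact hs 0 (by rw [h', Rat.cast_zero])
  · exact hs t (sub_eq_zero.1 h').symm

/-- The curve `y ^ 2 = (x ^ 2 - 1) (x ^ 2 + 1) (x ^ 2 + 2 x - 1)` has no rational points with
`x ≠ 0` and `y ≠ 0`. -/
theorem no_rational_point {s y : ℚ} (hs : s ≠ 0) (hy : y ≠ 0) :
    y ^ 2 ≠ (s ^ 2 - 1) * (s ^ 2 + 1) * (s ^ 2 + 2 * s - 1) := by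
  intro h
  have hy2 : y ^ 2 ≠ 0 := pow_ne_zero 2 hy
  have hst : Start s 0 1 ((y - 1) / s) := by
    refine ⟨by ring, ?_⟩
    field_simp
    linear_combination h
  obtain ⟨-, h0 | rfl | rfl⟩ := hst.eq_cusp (by simpa using hs) (by simp) (by simp) (by simp)
  · exact hs h0
  · exact hy2 (by rw [h]; norm_num)
  · exact hy2 (by rw [h]; norm_num)

end Kummer

/-- The ring `R[p] / (p ^ 3 - 2 p ^ 2 - 2)`, with coordinates in the basis `1, p, p ^ 2`. -/
@[ext]
structure Cub (R : Type*) where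
  /-- constant coordinate -/
  x : R
  /-- coordinate of `p` -/
  y : R
  /-- coordinate of `p ^ 2` -/
  z : R

namespace Cub

section Ring

variable {R : Type*} [CommRing R]

instance : Zero (Cub R) := ⟨⟨0, 0, 0⟩⟩
instance : One (Cub R) := ⟨⟨1, 0, 0⟩⟩
instance : Add (Cub R) := ⟨fun a b => ⟨a.x + b.x, a.y + b.y, a.z + b.z⟩⟩
instance : Neg (Cub R) := ⟨fun a => ⟨-a.x, -a.y, -a.z⟩⟩
instance : Mul (Cub R) := ⟨fun a b =>
  ⟨a.x * b.x + 2 * (a.y * b.z + a.z * b.y) + 4 * (a.z * b.z),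
    a.x * b.y + a.y * b.x + 2 * (a.z * b.z),
    a.x * b.z + a.y * b.y + a.z * b.x + 2 * (a.y * b.z + a.z * b.y) + 4 * (a.z * b.z)⟩⟩

@[simp] theorem zero_x : (0 : Cub R).x = 0 := rfl
@[simp] theorem zero_y : (0 : Cub R).y = 0 := rfl
@[simp] theorem zero_z : (0 : Cub R).z = 0 := rfl
@[simp] theorem one_x : (1 : Cub R).x = 1 := rfl
@[simp] theorem one_y : (1 : Cub R).y = 0 := rfl
@[simp] theorem one_z : (1 : Cub R).z = 0 := rfl
@[simp] theorem add_x (a b : Cub R) : (a + b).x = a.x + b.x := rfl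
@[simp] theorem add_y (a b : Cub R) : (a + b).y = a.y + b.y := rfl
@[simp] theorem add_z (a b : Cub R) : (a + b).z = a.z + b.z := rfl
@[simp] theorem neg_x (a : Cub R) : (-a).x = -a.x := rfl
@[simp] theorem neg_y (a : Cub R) : (-a).y = -a.y := rfl
@[simp] theorem neg_z (a : Cub R) : (-a).z = -a.z := rfl
@[simp] theorem mul_x (a b : Cub R) :
    (a * b).x = a.x * b.x + 2 * (a.y * b.z + a.z * b.y) + 4 * (a.z * b.z) := rfl
@[simp] theorem mul_y (a b : Cub R) :
    (a * b).y = a.x * b.y + a.y * b.x + 2 * (a.z * b.z) := rfl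
@[simp] theorem mul_z (a b : Cub R) :
    (a * b).z = a.x * b.z + a.y * b.y + a.z * b.x + 2 * (a.y * b.z + a.z * b.y)
      + 4 * (a.z * b.z) := rfl

instance : CommRing (Cub R) where
  add_assoc a b c := by ext <;> simp [add_assoc]
  zero_add a := by ext <;> simp
  add_zero a := by ext <;> simp
  add_comm a b := by ext <;> simp [add_comm]
  neg_add_cancel a := by ext <;> simp
  left_distrib a b c := by ext <;> simp <;> ring
  right_distrib a b c := by ext <;> simp <;> ring
  zero_mul a := by ext <;> simp
  mul_zero a := by ext <;> simp
  mul_assoc a b c := by ext <;> simp <;> ring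
  one_mul a := by ext <;> simp
  mul_one a := by ext <;> simp
  mul_comm a b := by ext <;> simp <;> ring
  nsmul := nsmulRec
  zsmul := zsmulRec

@[simp] theorem sub_x (a b : Cub R) : (a - b).x = a.x - b.x := by
  rw [sub_eq_add_neg, sub_eq_add_neg]; rfl
@[simp] theorem sub_y (a b : Cub R) : (a - b).y = a.y - b.y := by
  rw [sub_eq_add_neg, sub_eq_add_neg]; rfl
@[simp] theorem sub_z (a b : Cub R) : (a - b).z = a.z - b.z := by
  rw [sub_eq_add_neg, sub_eq_add_neg]; rfl

theorem natCast_coord (n : ℕ) : ((n : Cub R)) = ⟨n, 0, 0⟩ := by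
  induction n with
  | zero => ext <;> simp
  | succ k ih => rw [Nat.cast_succ, ih]; ext <;> simp

theorem intCast_coord (n : ℤ) : (n : Cub R) = ⟨n, 0, 0⟩ := by
  cases n with
  | ofNat k => simp [natCast_coord]
  | negSucc k => rw [Int.cast_negSucc, natCast_coord, Int.cast_negSucc]; ext <;> simp

@[simp] theorem intCast_x (n : ℤ) : (n : Cub R).x = n := by rw [intCast_coord]
@[simp] theorem intCast_y (n : ℤ) : (n : Cub R).y = 0 := by rw [intCast_coord]
@[simp] theorem intCast_z (n : ℤ) : (n : Cub R).z = 0 := by rw [intCast_coord]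

theorem ofNat_coord (n : ℕ) [n.AtLeastTwo] : (ofNat(n) : Cub R) = ⟨ofNat(n), 0, 0⟩ :=
  natCast_coord n

@[simp] theorem ofNat_x (n : ℕ) [n.AtLeastTwo] : (ofNat(n) : Cub R).x = ofNat(n) := by
  rw [ofNat_coord]
@[simp] theorem ofNat_y (n : ℕ) [n.AtLeastTwo] : (ofNat(n) : Cub R).y = 0 := by
  rw [ofNat_coord]
@[simp] theorem ofNat_z (n : ℕ) [n.AtLeastTwo] : (ofNat(n) : Cub R).z = 0 := by
  rw [ofNat_coord]

/-- Evaluation at a root of `p ^ 3 - 2 p ^ 2 - 2`. -/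
def eval {S : Type*} [CommRing S] (f : R →+* S) (r : S) (hr : r ^ 3 = 2 * r ^ 2 + 2) :
    Cub R →+* S where
  toFun a := f a.x + f a.y * r + f a.z * r ^ 2
  map_one' := by simp
  map_mul' a b := by
    simp only [mul_x, mul_y, mul_z, map_add, map_mul, map_ofNat]
    linear_combination (-(f a.y * f b.z + f a.z * f b.y) - f a.z * f b.z * (r + 2)) * hr
  map_zero' := by simp
  map_add' a b := by simp only [add_x, add_y, add_z, map_add]; ring

/-- The norm form. -/
def nrm (x y z : R) : R :=
  x ^ 3 + 2 * y ^ 3 + 4 * z ^ 3 + 2 * x ^ 2 * y + 4 * x ^ 2 * z - 8 * x * z ^ 2 + 4 * y ^ 2 * z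
    - 6 * x * y * z

/-- The norm. -/
def norm (a : Cub R) : R := nrm a.x a.y a.z

/-- The product of the other two conjugates. -/
def cof (a : Cub R) : Cub R :=
  ⟨a.x ^ 2 + 2 * a.x * a.y + 4 * a.x * a.z - 2 * a.y * a.z - 4 * a.z ^ 2,
    -(a.x * a.y) - 2 * a.y ^ 2 - 4 * a.y * a.z + 2 * a.z ^ 2,
    a.y ^ 2 - a.x * a.z + 2 * a.y * a.z⟩

theorem mul_cof (a : Cub R) : a * cof a = ⟨norm a, 0, 0⟩ := by
  ext <;> simp only [cof, norm, nrm, mul_x, mul_y, mul_z] <;> ring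

theorem norm_mul (a b : Cub R) : norm (a * b) = norm a * norm b := by
  simp only [norm, nrm, mul_x, mul_y, mul_z]; ring

theorem cof_mul (a b : Cub R) : cof (a * b) = cof a * cof b := by
  ext <;> simp only [cof, mul_x, mul_y, mul_z] <;> ring

end Ring

theorem even_of_nrm_eq_zero {x y z : ℤ} (h : nrm x y z = 0) : 2 ∣ x ∧ 2 ∣ y ∧ 2 ∣ z := by
  simp only [nrm] at h
  have hx : (2 : ℤ) ∣ x := Int.prime_two.dvd_of_dvd_pow (n := 3)
    ⟨-(y ^ 3 + 2 * z ^ 3 + x ^ 2 * y + 2 * x ^ 2 * z - 4 * x * z ^ 2 + 2 * y ^ 2 * z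
      - 3 * x * y * z), by linear_combination h⟩
  obtain ⟨x, rfl⟩ := hx
  have hy : (2 : ℤ) ∣ y := Int.prime_two.dvd_of_dvd_pow (n := 3)
    ⟨-(2 * x ^ 3 + z ^ 3 + 2 * x ^ 2 * y + 4 * x ^ 2 * z - 4 * x * z ^ 2 + y ^ 2 * z
      - 3 * x * y * z), by linarith⟩
  obtain ⟨y, rfl⟩ := hy
  have hz : (2 : ℤ) ∣ z := Int.prime_two.dvd_of_dvd_pow (n := 3)
    ⟨-(x ^ 3 + 2 * y ^ 3 + 2 * x ^ 2 * y + 2 * x ^ 2 * z - 2 * x * z ^ 2 + 2 * y ^ 2 * z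
      - 3 * x * y * z), by linarith⟩
  exact ⟨dvd_mul_right _ _, dvd_mul_right _ _, hz⟩

theorem eq_zero_of_nrm_eq_zero {x y z : ℤ} (h : nrm x y z = 0) : x = 0 ∧ y = 0 ∧ z = 0 := by
  have key : ∀ k : ℕ, (2 : ℤ) ^ k ∣ x ∧ (2 : ℤ) ^ k ∣ y ∧ (2 : ℤ) ^ k ∣ z := by
    intro k
    induction k with
    | zero => simp
    | succ k ih =>
      obtain ⟨⟨a, ha⟩, ⟨b, hb⟩, ⟨c, hc⟩⟩ := ih
      have h0 : nrm a b c = 0 := by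
        have : ((2 : ℤ) ^ k) ^ 3 * nrm a b c = 0 := by
          rw [← h, ha, hb, hc]; simp only [nrm]; ring
        exact (mul_eq_zero.1 this).resolve_left (by positivity)
      obtain ⟨h1, h2, h3⟩ := even_of_nrm_eq_zero h0
      rw [ha, hb, hc, pow_succ]
      exact ⟨mul_dvd_mul_left _ h1, mul_dvd_mul_left _ h2, mul_dvd_mul_left _ h3⟩
  have fin : ∀ w : ℤ, (∀ k : ℕ, (2 : ℤ) ^ k ∣ w) → w = 0 := fun w hw =>
    Int.eq_zero_of_abs_lt_dvd (hw w.natAbs) (by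
      rw [Int.abs_eq_natAbs]; exact_mod_cast Nat.lt_two_pow_self)
  exact ⟨fin x fun k => (key k).1, fin y fun k => (key k).2.1, fin z fun k => (key k).2.2⟩

theorem norm_eq_zero {a : Cub ℤ} : norm a = 0 ↔ a = 0 := by
  constructor
  · intro h
    obtain ⟨h1, h2, h3⟩ := eq_zero_of_nrm_eq_zero h
    exact Cub.ext h1 h2 h3
  · rintro rfl; simp [norm, nrm]

instance : Nontrivial (Cub ℤ) := ⟨⟨0, 1, fun h => by simpa using congrArg Cub.x h⟩⟩

instance : IsDomain (Cub ℤ) :=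
  have : NoZeroDivisors (Cub ℤ) := ⟨fun {a b} h => by
    rw [← norm_eq_zero, norm_mul, mul_eq_zero, norm_eq_zero, norm_eq_zero] at h
    exact h⟩
  NoZeroDivisors.to_isDomain _

theorem norm_cof {a : Cub ℤ} (ha : a ≠ 0) : norm (cof a) = norm a ^ 2 := by
  have h : norm a * norm (cof a) = norm a * norm a ^ 2 := by
    rw [← norm_mul, mul_cof]; simp only [norm, nrm]; ring
  exact mul_left_cancel₀ (mt norm_eq_zero.1 ha) h

section Euclid

variable {R : Type*} [CommRing R] [LinearOrder R]

/-- An upper bound for the norm form on a box with centre `(u, v, w)` and half sides `24, 20, 15`. -/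
def boxBound (u v w : R) : R :=
  |nrm u v w| + |3 * u ^ 2 + 4 * u * v + 8 * u * w - 8 * w ^ 2 - 6 * v * w| * 24
    + |6 * v ^ 2 + 2 * u ^ 2 + 8 * v * w - 6 * u * w| * 20
    + |12 * w ^ 2 + 4 * u ^ 2 - 16 * u * w + 4 * v ^ 2 - 6 * u * v| * 15
    + |3 * u + 2 * v + 4 * w| * 576 + |6 * v + 4 * w| * 400 + |12 * w - 8 * u| * 225
    + |4 * u - 6 * w| * 480 + |8 * u - 16 * w - 6 * v| * 360 + |8 * v - 6 * u| * 300 + 211324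

theorem abs_nrm_le [IsStrictOrderedRing R] {u v w a b c : R} (ha : |a| ≤ 24) (hb : |b| ≤ 20)
    (hc : |c| ≤ 15) : |nrm (u + a) (v + b) (w + c)| ≤ boxBound u v w := by
  have m2 : ∀ {s t S T : R}, |s| ≤ S → |t| ≤ T → |s * t| ≤ S * T := fun hs ht => by
    rw [abs_mul]; exact mul_le_mul hs ht (abs_nonneg _) ((abs_nonneg _).trans hs)
  have haa := m2 ha ha
  have hbb := m2 hb hb
  have hcc := m2 hc hc
  have hab := m2 ha hb
  have hac := m2 ha hc
  have hbc := m2 hb hc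
  have h3 : |nrm a b c| ≤ 211324 := by
    have e : nrm a b c = a * a * a + 2 * (b * b * b) + 4 * (c * c * c) + 2 * (a * a * b)
      + 4 * (a * a * c) + (-8) * (a * (c * c)) + 4 * (b * b * c) + (-6) * (a * b * c) := by
      simp only [nrm]; ring
    rw [e]
    have k1 := m2 haa ha
    have k2 := m2 hbb hb
    have k3 := m2 hcc hc
    have k4 := m2 haa hb
    have k5 := m2 haa hc
    have k6 := m2 ha hcc
    have k7 := m2 hbb hc
    have k8 := m2 hab hc
    rw [abs_le] at *
    constructor <;> linarith
  have e : nrm (u + a) (v + b) (w + c) = nrm u v w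
      + (3 * u ^ 2 + 4 * u * v + 8 * u * w - 8 * w ^ 2 - 6 * v * w) * a
      + (6 * v ^ 2 + 2 * u ^ 2 + 8 * v * w - 6 * u * w) * b
      + (12 * w ^ 2 + 4 * u ^ 2 - 16 * u * w + 4 * v ^ 2 - 6 * u * v) * c
      + (3 * u + 2 * v + 4 * w) * (a * a) + (6 * v + 4 * w) * (b * b) + (12 * w - 8 * u) * (c * c)
      + (4 * u - 6 * w) * (a * b) + (8 * u - 16 * w - 6 * v) * (a * c) + (8 * v - 6 * u) * (b * c)
      + nrm a b c := by
    simp only [nrm]; ring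
  rw [e, boxBound]
  have ml : ∀ {s t T T' : R}, |t| ≤ T → T = T' → |s * t| ≤ |s| * T' := fun ht hT =>
    m2 le_rfl (hT ▸ ht)
  refine (abs_add_le _ _).trans (add_le_add ?_ h3)
  refine (abs_add_le _ _).trans (add_le_add ?_ (ml hbc (by norm_num)))
  refine (abs_add_le _ _).trans (add_le_add ?_ (ml hac (by norm_num)))
  refine (abs_add_le _ _).trans (add_le_add ?_ (ml hab (by norm_num)))
  refine (abs_add_le _ _).trans (add_le_add ?_ (ml hcc (by norm_num)))
  refine (abs_add_le _ _).trans (add_le_add ?_ (ml hbb (by norm_num)))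
  refine (abs_add_le _ _).trans (add_le_add ?_ (ml haa (by norm_num)))
  refine (abs_add_le _ _).trans (add_le_add ?_ (ml hc rfl))
  refine (abs_add_le _ _).trans (add_le_add ?_ (ml hb rfl))
  exact (abs_add_le _ _).trans (add_le_add le_rfl (ml ha rfl))

theorem boxBound_cast (u v w : ℤ) : ((boxBound u v w : ℤ) : ℚ) = boxBound (u : ℚ) v w := by
  simp only [boxBound, nrm]; push_cast; rfl

/-- Translates that suffice to bring a point of the unit cube into the region of norm `< 1`. -/
def offsets : List (ℤ × ℤ × ℤ) :=
  [(0, 0, 0), (1, 1, 1), (0, 0, 1), (1, 1, 0), (0, 1, 0), (1, 0, 1), (0, 1, 1), (1, 0, 0),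
    (-1, 0, -1), (2, 1, 2)]

theorem boxes_covered : ∀ i < 5, ∀ j < 6, ∀ k < 8, ∃ o ∈ offsets,
    boxBound (24 * (2 * (i : ℕ) + 1) - 240 * o.1 : ℤ) (20 * (2 * (j : ℕ) + 1) - 240 * o.2.1)
      (15 * (2 * (k : ℕ) + 1) - 240 * o.2.2) < 13824000 := by
  decide +kernel

theorem exists_box (x : ℚ) {n : ℕ} (hn : 0 < n) :
    ∃ i < n, ∃ a : ℤ, |2 * n * (x - a) - (2 * i + 1)| ≤ 1 := by
  have h0 := Int.fract_nonneg x
  have h1 := Int.fract_lt_one x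
  have hn' : (0 : ℚ) < n := by exact_mod_cast hn
  refine ⟨⌊n * Int.fract x⌋₊, ?_, ⌊x⌋, ?_⟩
  · rw [Nat.floor_lt (by positivity)]; nlinarith
  · rw [show x - ⌊x⌋ = Int.fract x from rfl, abs_le]
    have k1 := Nat.floor_le (by positivity : 0 ≤ n * Int.fract x)
    have k2 := Nat.lt_floor_add_one (n * Int.fract x)
    constructor <;> linarith

theorem exists_abs_nrm_lt (x y z : ℚ) : ∃ a b c : ℤ, |nrm (x - a) (y - b) (z - c)| < 1 := by
  obtain ⟨i, hi, a, ha⟩ := exists_box x (n := 5) (by norm_num)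
  obtain ⟨j, hj, b, hb⟩ := exists_box y (n := 6) (by norm_num)
  obtain ⟨k, hk, c, hc⟩ := exists_box z (n := 8) (by norm_num)
  obtain ⟨o, -, ho⟩ := boxes_covered i hi j hj k hk
  refine ⟨a + o.1, b + o.2.1, c + o.2.2, ?_⟩
  have h1 : |240 * (x - a) - 24 * (2 * i + 1)| ≤ 24 := by
    rw [abs_le] at *; push_cast at ha; constructor <;> linarith
  have h2 : |240 * (y - b) - 20 * (2 * j + 1)| ≤ 20 := by
    rw [abs_le] at *; push_cast at hb; constructor <;> linarith
  have h3 : |240 * (z - c) - 15 * (2 * k + 1)| ≤ 15 := by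
    rw [abs_le] at *; push_cast at hc; constructor <;> linarith
  have h4 := abs_nrm_le (u := ((24 * (2 * (i : ℕ) + 1) - 240 * o.1 : ℤ) : ℚ))
    (v := ((20 * (2 * (j : ℕ) + 1) - 240 * o.2.1 : ℤ) : ℚ))
    (w := ((15 * (2 * (k : ℕ) + 1) - 240 * o.2.2 : ℤ) : ℚ)) h1 h2 h3
  rw [← boxBound_cast] at h4
  have h5 := h4.trans_lt (Int.cast_lt.2 ho)
  have h6 : nrm (((24 * (2 * (i : ℕ) + 1) - 240 * o.1 : ℤ) : ℚ) + (240 * (x - a) - 24 * (2 * i + 1)))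
      (((20 * (2 * (j : ℕ) + 1) - 240 * o.2.1 : ℤ) : ℚ) + (240 * (y - b) - 20 * (2 * j + 1)))
      (((15 * (2 * (k : ℕ) + 1) - 240 * o.2.2 : ℤ) : ℚ) + (240 * (z - c) - 15 * (2 * k + 1)))
      = 13824000 * nrm (x - (a + o.1 : ℤ)) (y - (b + o.2.1 : ℤ)) (z - (c + o.2.2 : ℤ)) := by
    simp only [nrm]; push_cast; ring
  rw [h6, abs_mul] at h5
  norm_num at h5 ⊢
  linarith

theorem exists_norm_sub_lt (a b : Cub ℤ) (hb : b ≠ 0) : ∃ q, |norm (a - q * b)| < |norm b| := by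
  have hn : norm b ≠ 0 := mt norm_eq_zero.1 hb
  have hnq : ((norm b : ℤ) : ℚ) ≠ 0 := by exact_mod_cast hn
  obtain ⟨k, l, m, h⟩ := exists_abs_nrm_lt ((a * cof b).x / norm b) ((a * cof b).y / norm b)
    ((a * cof b).z / norm b)
  refine ⟨⟨k, l, m⟩, ?_⟩
  have h1 : norm (a - ⟨k, l, m⟩ * b) * norm b ^ 2 =
      norm (a * cof b - ⟨k, l, m⟩ * ⟨norm b, 0, 0⟩) := by
    rw [← norm_cof hb, ← norm_mul, sub_mul, mul_assoc _ b, mul_cof]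
  have h2 : ((norm (a * cof b - ⟨k, l, m⟩ * ⟨norm b, 0, 0⟩) : ℤ) : ℚ) = norm b ^ 3 *
      nrm ((a * cof b).x / norm b - k : ℚ) ((a * cof b).y / norm b - l)
        ((a * cof b).z / norm b - m) := by
    generalize a * cof b = g
    simp only [norm, sub_x, sub_y, sub_z, mul_x, mul_y, mul_z]
    have e : ∀ r s t : ℚ, norm b ^ 3 * nrm r s t = nrm (norm b * r) (norm b * s) (norm b * t) := by
      intro r s t; simp only [nrm]; ring
    have hnq' : ((nrm b.x b.y b.z : ℤ) : ℚ) ≠ 0 := hnq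
    rw [show ((norm b : ℤ) : ℚ) = ((nrm b.x b.y b.z : ℤ) : ℚ) from rfl] at e
    rw [e, mul_sub, mul_sub, mul_sub, mul_div_cancel₀ _ hnq', mul_div_cancel₀ _ hnq',
      mul_div_cancel₀ _ hnq']
    generalize nrm b.x b.y b.z = n
    simp only [nrm]; push_cast; ring
  have h3 : |((norm (a - ⟨k, l, m⟩ * b) : ℤ) : ℚ)| * |((norm b : ℤ) : ℚ)| ^ 2 < |((norm b : ℤ) : ℚ)| ^ 3 := by
    rw [← abs_pow, ← abs_mul]
    have : ((norm (a - ⟨k, l, m⟩ * b) * norm b ^ 2 : ℤ) : ℚ) = _ := (congrArg _ h1).trans h2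
    push_cast at this
    rw [this, abs_mul, abs_pow]
    have hp : 0 < |((norm b : ℤ) : ℚ)| ^ 3 := by positivity
    nlinarith
  have h4 : |((norm (a - ⟨k, l, m⟩ * b) : ℤ) : ℚ)| < |((norm b : ℤ) : ℚ)| := by
    have hp : 0 < |((norm b : ℤ) : ℚ)| ^ 2 := by positivity
    nlinarith
  exact_mod_cast h4

instance : IsPrincipalIdealRing (Cub ℤ) where
  principal I := by
    by_cases hI : I = ⊥
    · exact hI ▸ bot_isPrincipal
    obtain ⟨b₀, hb₀, hb₀'⟩ := (Submodule.ne_bot_iff I).1 hI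
    let S : Set ℕ := {n | ∃ b ∈ I, b ≠ 0 ∧ (norm b).natAbs = n}
    have hS : S.Nonempty := ⟨_, b₀, hb₀, hb₀', rfl⟩
    obtain ⟨b, hbI, hb, hbn⟩ := Nat.sInf_mem hS
    refine ⟨b, le_antisymm (fun a ha => ?_) ((Ideal.span_singleton_le_iff_mem I).2 hbI)⟩
    obtain ⟨q, hq⟩ := exists_norm_sub_lt a b hb
    have hmem : a - q * b ∈ I := I.sub_mem ha (I.mul_mem_left q hbI)
    have h0 : a - q * b = 0 := by
      by_contra h0
      have : sInf S ≤ (norm (a - q * b)).natAbs := Nat.sInf_le ⟨_, hmem, h0, rfl⟩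
      rw [← hbn] at this
      rw [Int.abs_eq_natAbs, Int.abs_eq_natAbs] at hq
      omega
    exact Ideal.mem_span_singleton.2 ⟨q, by rw [mul_comm]; exact sub_eq_zero.1 h0⟩

end Euclid

/-- The generator. -/
def p : Cub ℤ := ⟨0, 1, 0⟩

theorem p_cube : p ^ 3 = 2 * p ^ 2 + 2 := by
  ext <;> simp [p, pow_succ]

/-- The fundamental unit `1 + p ^ 2`. -/
def fundUnit : (Cub ℤ)ˣ where
  val := ⟨1, 0, 1⟩
  inv := ⟨1, 2, -1⟩
  val_inv := by ext <;> simp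
  inv_val := by ext <;> simp

theorem fundUnit_val : (fundUnit : Cub ℤ) = 1 + p ^ 2 := by
  ext <;> simp [p, pow_two, fundUnit]

theorem norm_one : norm (1 : Cub ℤ) = 1 := by simp [norm, nrm]

theorem isUnit_norm {u : Cub ℤ} (hu : IsUnit u) : norm u = 1 ∨ norm u = -1 := by
  obtain ⟨v, hv⟩ := hu.exists_right_inv
  have : norm u * norm v = 1 := by rw [← norm_mul, hv, norm_one]
  exact Int.isUnit_iff.1 (IsUnit.of_mul_eq_one _ this)

section Real

theorem exists_real_root : ∃ r : ℝ, r ^ 3 = 2 * r ^ 2 + 2 ∧ 2.359 < r ∧ r < 2.3594 := by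
  have hc : ContinuousOn (fun r : ℝ => r ^ 3 - 2 * r ^ 2 - 2) (Set.Icc 2.359 2.3594) := by fun_prop
  obtain ⟨r, hr, h0⟩ := intermediate_value_Ioo (by norm_num) hc
    (show (0 : ℝ) ∈ Set.Ioo _ _ by constructor <;> norm_num)
  exact ⟨r, by simp only at h0; linarith, hr.1, hr.2⟩

variable {r : ℝ} (hr : r ^ 3 = 2 * r ^ 2 + 2)

/-- The real embedding. -/
noncomputable abbrev emb : Cub ℤ →+* ℝ := eval (Int.castRingHom ℝ) r hr

theorem emb_apply (a : Cub ℤ) : emb hr a = a.x + a.y * r + a.z * r ^ 2 := rfl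

theorem emb_cof (a : Cub ℤ) : emb hr (cof a) =
    (a.x + (1 - r / 2) * a.y + (2 - r ^ 2 / 2) * a.z) ^ 2
      + (3 / 4 * r ^ 2 - r - 1) * (a.y + (2 - r) * a.z) ^ 2 := by
  rw [emb_apply]
  simp only [cof]
  push_cast
  linear_combination (-(a.z ^ 2 * r) + 2 * a.z ^ 2 + a.y * a.z : ℝ) * hr

theorem emb_mul_emb_cof (a : Cub ℤ) : emb hr a * emb hr (cof a) = norm a := by
  rw [← map_mul, mul_cof, emb_apply]; simp

set_option maxHeartbeats 1000000 in
theorem eq_one_of_emb_mem (h1 : 2.359 < r) (h2 : r < 2.3594) {a : Cub ℤ} (ha : norm a = 1)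
    (hl : 1 ≤ emb hr a) (hu : emb hr a < 1 + r ^ 2) : a = 1 := by
  have hm := emb_mul_emb_cof hr a
  rw [ha, Int.cast_one] at hm
  have hQ : emb hr (cof a) ≤ 1 := by
    by_contra h
    push Not at h
    nlinarith
  rw [emb_cof] at hQ
  rw [emb_apply] at hl hu
  obtain ⟨x, y, z⟩ := a
  simp only at hQ hl hu
  have hk : 0.81 < 3 / 4 * r ^ 2 - r - 1 := by nlinarith
  have hU := sq_nonneg (y + (2 - r) * z : ℝ)
  have hV := sq_nonneg (x + (1 - r / 2) * y + (2 - r ^ 2 / 2) * z : ℝ)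
  obtain ⟨U, hUd⟩ : ∃ U : ℝ, U = y + (2 - r) * z := ⟨_, rfl⟩
  obtain ⟨V, hVd⟩ : ∃ V : ℝ, V = x + (1 - r / 2) * y + (2 - r ^ 2 / 2) * z := ⟨_, rfl⟩
  rw [← hUd, ← hVd] at hQ
  rw [← hUd] at hU
  rw [← hVd] at hV
  have hV1 : V ^ 2 ≤ 1 := by nlinarith
  have hU1 : U ^ 2 ≤ 1.112 ^ 2 := by nlinarith
  obtain ⟨u1, u2⟩ := abs_le.1 (abs_le_of_sq_le_sq hU1 (by norm_num))
  obtain ⟨v1, v2⟩ := abs_le.1 (abs_le_of_sq_le_sq (by rwa [one_pow] : V ^ 2 ≤ 1 ^ 2) (by norm_num))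
  have hr2 : r ^ 2 < 5.567 := by nlinarith
  have hr2' : 5.564 < r ^ 2 := by nlinarith
  have hX : x + y * r + z * r ^ 2 - V = (3 * r / 2 - 1) * U + (3 * r ^ 2 - 4 * r) * z := by
    rw [hVd, hUd]; linear_combination (0 : ℝ) * hr
  have hb1 : (3 * r / 2 - 1) * U ≤ 2.83 := by nlinarith
  have hb2 : -2.83 ≤ (3 * r / 2 - 1) * U := by nlinarith
  have hc : 7.2 < 3 * r ^ 2 - 4 * r := by nlinarith
  have hz1 : z < 2 := by
    by_contra h
    have : (2 : ℝ) ≤ z := by exact_mod_cast not_lt.1 h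
    nlinarith
  have hz0 : -1 < z := by
    by_contra h
    have : (z : ℝ) ≤ -1 := by exact_mod_cast not_lt.1 h
    nlinarith
  have hz : z = 0 ∨ z = 1 := by omega
  have hy : y = 0 ∨ y = 1 := by
    have hy1 : y < 2 := by
      by_contra h
      have : (2 : ℝ) ≤ y := by exact_mod_cast not_lt.1 h
      rcases hz with rfl | rfl <;> push_cast at hUd <;> linarith
    have hy0 : -1 < y := by
      by_contra h
      have : (y : ℝ) ≤ -1 := by exact_mod_cast not_lt.1 h
      rcases hz with rfl | rfl
      · push_cast at hUd hX hl
        have h3 : (3 * r / 2 - 1) * U ≤ (3 * r / 2 - 1) * (-1) :=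
          mul_le_mul_of_nonneg_left (by linarith) (by linarith)
        linarith
      · push_cast at hUd
        linarith
    omega
  have hx1 : x < 2 := by
    by_contra h
    have : (2 : ℝ) ≤ x := by exact_mod_cast not_lt.1 h
    rcases hz with rfl | rfl <;> rcases hy with rfl | rfl <;> push_cast at hVd <;> linarith
  have hx0 : -1 < x := by
    by_contra h
    have : (x : ℝ) ≤ -1 := by exact_mod_cast not_lt.1 h
    rcases hz with rfl | rfl <;> rcases hy with rfl | rfl <;> push_cast at hVd hl <;> linarith
  have hx : x = 0 ∨ x = 1 := by omega
  simp only [norm, nrm] at ha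
  rcases hz with rfl | rfl <;> rcases hy with rfl | rfl <;> rcases hx with rfl | rfl <;>
    first
    | rfl
    | (exfalso; norm_num at ha; done)
    | (exfalso; push_cast at hu; linarith)

end Real

/-- Units modulo squares. -/
theorem exists_eq_mul_sq (u : (Cub ℤ)ˣ) :
    ∃ d ∈ ([1, -1, fundUnit, -fundUnit] : List (Cub ℤ)ˣ), ∃ w : (Cub ℤ)ˣ, u = d * w ^ 2 := by
  obtain ⟨r, hr, h1, h2⟩ := exists_real_root
  have hE : emb hr fundUnit = 1 + r ^ 2 := by rw [emb_apply]; simp [fundUnit]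
  have key : ∀ u : (Cub ℤ)ˣ, 0 < emb hr u → ∃ n : ℤ, u = fundUnit ^ n := by
    intro u hu
    obtain ⟨n, hn1, hn2⟩ := exists_mem_Ico_zpow hu (y := 1 + r ^ 2) (by nlinarith)
    refine ⟨n, ?_⟩
    have hpos : 0 < (1 + r ^ 2) ^ n := by positivity
    have hv : emb hr ((u * fundUnit ^ (-n) : (Cub ℤ)ˣ) : Cub ℤ) = emb hr u / (1 + r ^ 2) ^ n := by
      have : ((1 + r ^ 2) ^ n : ℝ) = emb hr ((fundUnit ^ n : (Cub ℤ)ˣ) : Cub ℤ) := by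
        rw [← hE]
        have h := congrArg Units.val (map_zpow (Units.map (emb hr : Cub ℤ →* ℝ)) fundUnit n)
        rw [Units.val_zpow_eq_zpow_val] at h
        exact h.symm
      rw [eq_div_iff hpos.ne', this, ← map_mul]
      congr 1
      rw [← Units.val_mul, mul_assoc, ← zpow_add]; simp
    have h3 : norm ((u * fundUnit ^ (-n) : (Cub ℤ)ˣ) : Cub ℤ) = 1 := by
      refine (isUnit_norm (Units.isUnit _)).resolve_right fun h => ?_
      have hm := emb_mul_emb_cof hr ((u * fundUnit ^ (-n) : (Cub ℤ)ˣ) : Cub ℤ)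
      rw [h, hv, emb_cof] at hm
      have hk : 0 < 3 / 4 * r ^ 2 - r - 1 := by nlinarith
      have : (0 : ℝ) ≤ ((-1 : ℤ) : ℝ) := hm ▸ by positivity
      norm_num at this
    have h4 := eq_one_of_emb_mem hr h1 h2 h3 (by rw [hv, le_div_iff₀ hpos]; linarith)
      (by
        rw [hv, div_lt_iff₀ hpos]
        rwa [zpow_add_one₀ (by positivity), mul_comm] at hn2)
    rw [← Units.val_one] at h4
    have h5 := Units.ext h4
    rw [zpow_neg, mul_inv_eq_one] at h5
    exact h5
  have par : ∀ n : ℤ, ∃ d ∈ ([1, fundUnit] : List (Cub ℤ)ˣ), ∃ w : (Cub ℤ)ˣ,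
      fundUnit ^ n = d * w ^ 2 := by
    intro n
    rcases Int.even_or_odd' n with ⟨k, rfl | rfl⟩
    · exact ⟨1, by simp, fundUnit ^ k, by rw [one_mul, mul_comm, zpow_mul]; rfl⟩
    · exact ⟨fundUnit, by simp, fundUnit ^ k, by
        rw [add_comm, zpow_add, zpow_one, mul_comm 2 k, zpow_mul]; rfl⟩
  have hne : emb hr u ≠ 0 := ((Units.isUnit u).map (emb hr)).ne_zero
  rcases lt_or_gt_of_ne hne with h | h
  · obtain ⟨n, hn⟩ := key (-u) (by rw [Units.val_neg, map_neg]; linarith)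
    obtain ⟨d, hd, w, hw⟩ := par n
    refine ⟨-d, ?_, w, by rw [neg_mul, ← hw, ← hn, neg_neg]⟩
    simp only [List.mem_cons, List.not_mem_nil, or_false] at hd ⊢
    rcases hd with rfl | rfl <;> simp
  · obtain ⟨n, hn⟩ := key u h
    obtain ⟨d, hd, w, hw⟩ := par n
    refine ⟨d, ?_, w, by rw [← hw, ← hn]⟩
    simp only [List.mem_cons, List.not_mem_nil, or_false] at hd ⊢
    rcases hd with rfl | rfl <;> simp

theorem p_dvd_iff {a : Cub ℤ} : p ∣ a ↔ 2 ∣ a.x := by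
  constructor
  · rintro ⟨b, rfl⟩
    exact ⟨b.z, by simp [p]⟩
  · rintro ⟨k, hk⟩
    exact ⟨⟨a.y, a.z - a.x, k⟩, by ext <;> simp [p, hk]⟩

theorem prime_p : Prime p := by
  refine ⟨fun h => by simpa [p] using congrArg Cub.y h, fun h => ?_, fun a b h => ?_⟩
  · have := isUnit_norm h
    simp [norm, nrm, p] at this
  · rw [p_dvd_iff, mul_x] at h
    rw [p_dvd_iff, p_dvd_iff]
    exact Int.prime_two.dvd_or_dvd (by omega)

theorem p_pow_three : p ^ 3 = 2 * (fundUnit : Cub ℤ) := by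
  rw [fundUnit_val, p_cube]; ring

theorem two_eq : (2 : Cub ℤ) = p ^ 3 * ((fundUnit⁻¹ : (Cub ℤ)ˣ) : Cub ℤ) := by
  rw [p_pow_three, mul_assoc, Units.mul_inv, mul_one]

theorem p_dvd_two : p ∣ 2 := (dvd_pow_self p three_ne_zero).trans ⟨_, two_eq⟩

theorem isCoprime_p {a : Cub ℤ} (h : ¬ p ∣ a) : IsCoprime a p :=
  ((prime_p.irreducible.coprime_iff_not_dvd).2 h).symm

theorem isCoprime_of_dvd_pow {a b : Cub ℤ} {n : ℕ} (h : ¬ p ∣ a) (hb : b ∣ p ^ n) :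
    IsCoprime a b :=
  ((isCoprime_p h).pow_right (n := n)).of_isCoprime_of_dvd_right hb

theorem two_dvd_p_pow_three : (2 : Cub ℤ) ∣ p ^ 3 := ⟨_, p_pow_three⟩

theorem isCoprime_two {a : Cub ℤ} (h : ¬ p ∣ a) : IsCoprime a 2 :=
  isCoprime_of_dvd_pow h two_dvd_p_pow_three

theorem not_p_dvd_unit (u : (Cub ℤ)ˣ) : ¬ p ∣ (u : Cub ℤ) := fun h =>
  prime_p.not_isUnit (isUnit_of_dvd_unit h u.isUnit)

theorem not_p_dvd_mul {a b : Cub ℤ} (ha : ¬ p ∣ a) (hb : ¬ p ∣ b) : ¬ p ∣ a * b :=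
  fun h => (prime_p.dvd_or_dvd h).elim ha hb

theorem not_p_dvd_pow {a : Cub ℤ} (ha : ¬ p ∣ a) (n : ℕ) : ¬ p ∣ a ^ n :=
  fun h => ha (prime_p.dvd_of_dvd_pow h)

theorem p_dvd_add {a b : Cub ℤ} (ha : ¬ p ∣ a) (hb : ¬ p ∣ b) : p ∣ a + b := by
  rw [p_dvd_iff] at *; rw [add_x]; omega

theorem natCast_dvd_iff {n : ℤ} {a : Cub ℤ} : (n : Cub ℤ) ∣ a ↔ n ∣ a.x ∧ n ∣ a.y ∧ n ∣ a.z := by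
  constructor
  · rintro ⟨b, rfl⟩
    exact ⟨⟨b.x, by simp⟩, ⟨b.y, by simp⟩, ⟨b.z, by simp⟩⟩
  · rintro ⟨⟨i, hi⟩, ⟨j, hj⟩, ⟨k, hk⟩⟩
    exact ⟨⟨i, j, k⟩, by ext <;> simp [hi, hj, hk]⟩

theorem four_dvd_iff {a : Cub ℤ} : 4 ∣ a ↔ 4 ∣ a.x ∧ 4 ∣ a.y ∧ 4 ∣ a.z := by
  simpa using natCast_dvd_iff (n := 4) (a := a)

theorem eight_dvd_iff {a : Cub ℤ} : 8 ∣ a ↔ 8 ∣ a.x ∧ 8 ∣ a.y ∧ 8 ∣ a.z := by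
  simpa using natCast_dvd_iff (n := 8) (a := a)

instance (a : Cub ℤ) : Decidable (4 ∣ a) := decidable_of_iff _ four_dvd_iff.symm

instance (a : Cub ℤ) : Decidable (8 ∣ a) := decidable_of_iff _ eight_dvd_iff.symm

theorem two_dvd_sub_of_sq {x y : Cub ℤ} (h : 4 ∣ x ^ 2 - y ^ 2) : 2 ∣ x - y := by
  have key : ∀ n ≤ 3, p ^ n ∣ x - y := by
    intro n hn
    induction n with
    | zero => simp
    | succ n ih =>
      obtain ⟨d, hd⟩ := ih (by omega)
      obtain ⟨w, hw⟩ := h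
      obtain ⟨k, hk⟩ : ∃ k, 2 * n + 1 + k = 6 ∧ n < 3 := ⟨5 - 2 * n, by omega, by omega⟩
      have h2 : p ^ (n + 1) ∣ 2 :=
        (pow_dvd_pow p (show n + 1 ≤ 3 by omega)).trans ⟨_, two_eq⟩
      obtain ⟨v, hv⟩ := h2
      have e : p ^ (2 * n) * (d ^ 2 + p * (v * y * d)) = p ^ (2 * n) * (p * (p ^ k * ((fundUnit⁻¹ : (Cub ℤ)ˣ) : Cub ℤ) ^ 2 * w)) := by
        have h4 : (4 : Cub ℤ) = p ^ (2 * n + 1 + k) * ((fundUnit⁻¹ : (Cub ℤ)ˣ) : Cub ℤ) ^ 2 := by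
          rw [hk.1]; linear_combination (2 + p ^ 3 * ((fundUnit⁻¹ : (Cub ℤ)ˣ) : Cub ℤ)) * two_eq
        calc _ = (x - y) ^ 2 + 2 * y * (x - y) := by rw [hd, hv]; ring
          _ = 4 * w := by rw [← hw]; ring
          _ = _ := by rw [h4]; ring
      have e' := mul_left_cancel₀ (pow_ne_zero _ prime_p.ne_zero) e
      have : p ∣ d ^ 2 := (dvd_add_left (Dvd.intro _ rfl)).1 (Dvd.intro _ e'.symm)
      obtain ⟨c, hc⟩ := prime_p.dvd_of_dvd_pow this
      exact ⟨c, by rw [hd, hc]; ring⟩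
  exact two_dvd_p_pow_three.trans (key 3 le_rfl)

/-- Representatives of the odd squares modulo `4`. -/
def oddSquares : List (Cub ℤ) := [⟨1, 0, 0⟩, ⟨1, 2, 1⟩, ⟨1, 2, 2⟩, ⟨1, 0, 3⟩]

theorem exists_oddSquares {a : Cub ℤ} (ha : ¬ p ∣ a) : ∃ b ∈ oddSquares, ∃ w, a ^ 2 = b + 4 * w := by
  obtain ⟨x, y, z⟩ := a
  rw [p_dvd_iff] at ha
  obtain ⟨i, rfl⟩ : ∃ i, x = 2 * i + 1 := ⟨x / 2, by simp only at ha; omega⟩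
  obtain ⟨j, rfl | rfl⟩ := Int.even_or_odd' y <;> obtain ⟨k, rfl | rfl⟩ := Int.even_or_odd' z
  · refine ⟨⟨1, 0, 0⟩, by simp [oddSquares], ⟨i ^ 2 + i + 4 * j * k + 4 * k ^ 2,
      (2 * i + 1) * j + 2 * k ^ 2, (2 * i + 1) * k + j ^ 2 + 4 * j * k + 4 * k ^ 2⟩, ?_⟩
    ext <;> simp [pow_two] <;> ring
  · refine ⟨⟨1, 2, 2⟩, by simp [oddSquares], ⟨i ^ 2 + i + (2 * j + 2 * k + 1) * (2 * k + 1),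
      (2 * i + 1) * j + 2 * k ^ 2 + 2 * k,
      2 * i * k + i + k + j ^ 2 + (2 * j + 2 * k + 1) * (2 * k + 1)⟩, ?_⟩
    ext <;> simp [pow_two] <;> ring
  · refine ⟨⟨1, 2, 1⟩, by simp [oddSquares], ⟨i ^ 2 + i + (2 * j + 1 + 2 * k) * (2 * k),
      2 * i * j + i + j + 2 * k ^ 2,
      (2 * i + 1) * k + j ^ 2 + j + (2 * j + 1 + 2 * k) * (2 * k)⟩, ?_⟩
    ext <;> simp [pow_two] <;> ring
  · refine ⟨⟨1, 0, 3⟩, by simp [oddSquares], ⟨i ^ 2 + i + (2 * j + 2 * k + 2) * (2 * k + 1),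
      2 * i * j + i + j + 1 + 2 * k ^ 2 + 2 * k,
      2 * i * k + i + k + j ^ 2 + j + (2 * j + 2 * k + 2) * (2 * k + 1)⟩, ?_⟩
    ext <;> simp [pow_two] <;> ring

theorem p_dvd_four_mul (w : Cub ℤ) : p ∣ 4 * w :=
  (p_dvd_two.mul_right (2 * w)).trans (dvd_of_eq (by ring))

/-- A unit congruent to a quotient of odd squares modulo `4` is a square. -/
theorem unit_sq {u : (Cub ℤ)ˣ} {r s w : Cub ℤ} (hr : ¬ p ∣ r) (h : u * r ^ 2 = s ^ 2 + 4 * w) :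
    ∃ τ : (Cub ℤ)ˣ, u = τ ^ 2 := by
  have hs : ¬ p ∣ s := fun hs => not_p_dvd_mul (not_p_dvd_unit u) (not_p_dvd_pow hr 2)
    (h ▸ dvd_add (dvd_pow hs two_ne_zero) (p_dvd_four_mul w))
  obtain ⟨d, hd, v, rfl⟩ := exists_eq_mul_sq u
  obtain ⟨b, hb, w1, h1⟩ := exists_oddSquares (not_p_dvd_mul (not_p_dvd_unit v) hr)
  obtain ⟨t, ht, w2, h2⟩ := exists_oddSquares hs
  have key : (4 : Cub ℤ) ∣ d * b - t := ⟨w2 + w - d * w1, by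
    push_cast at h
    linear_combination h - (d : Cub ℤ) * h1 + h2⟩
  have check : ∀ d ∈ ([-1, fundUnit, -fundUnit] : List (Cub ℤ)ˣ), ∀ b ∈ oddSquares,
      ∀ t ∈ oddSquares, ¬ (4 : Cub ℤ) ∣ d * b - t := by decide +kernel
  simp only [List.mem_cons, List.not_mem_nil, or_false] at hd
  rcases hd with rfl | rfl | rfl | rfl
  · exact ⟨v, one_mul _⟩
  all_goals exact (check _ (by simp) b hb t ht key).elim

end Cub

/-- Coprime factors of `l * g ^ n` are, up to units, an `n`-th power and `l` times one. -/
theorem exists_eq_unit_mul_pow {R : Type*} [CommRing R] [IsDomain R] [IsPrincipalIdealRing R]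
    {a b l g : R} {n : ℕ} (hn : n ≠ 0) (hab : IsCoprime a b) (hal : IsCoprime a l) (ha : a ≠ 0)
    (hl : l ≠ 0) (h : a * b = l * g ^ n) :
    ∃ (u : Rˣ) (r s : R), g = r * s ∧ a = u * r ^ n ∧ b = l * (↑u⁻¹ * s ^ n) := by
  obtain ⟨b', rfl⟩ : l ∣ b := hal.symm.dvd_of_dvd_mul_left ⟨g ^ n, h⟩
  have h' : a * b' = g ^ n := mul_left_cancel₀ hl (by rw [← h]; ring)
  obtain ⟨r, u, hu⟩ := exists_associated_pow_of_mul_eq_pow' (hab.of_mul_right_right) h'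
  have hr : r ≠ 0 := by
    rintro rfl
    rw [zero_pow hn, zero_mul] at hu
    exact ha hu.symm
  obtain ⟨s, rfl⟩ : r ∣ g := by
    rw [← UniqueFactorizationMonoid.pow_dvd_pow_iff_dvd hn]
    exact ⟨u * b', by rw [← h', ← hu]; ring⟩
  refine ⟨u, r, s, rfl, by rw [← hu, mul_comm], ?_⟩
  congr 1
  apply mul_left_cancel₀ (mul_ne_zero u.ne_zero (pow_ne_zero n hr))
  rw [← hu, mul_pow] at h'
  rw [mul_comm (u : R), h']
  linear_combination (-(r ^ n * s ^ n)) * u.mul_inv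

theorem IsCoprime.of_add_mul {R : Type*} [CommRing R] {a b : R} (h : IsCoprime (a + b) (a * b)) :
    IsCoprime a b := by
  obtain ⟨x, y, e⟩ := h
  exact ⟨x + y * b, x, by rw [← e]; ring⟩

namespace Cub

/-- Odd primitive points of `h ^ 2 = f ^ 4 + 4 a f ^ 2 g ^ 2 + 4 b g ^ 4` with `g` exactly divisible
by `2 ^ j`. -/
def HasPoint (a b : Cub ℤ) (j : ℕ) : Prop :=
  ∃ f g h : Cub ℤ, ¬ p ∣ f ∧ ¬ p ∣ g ∧ IsCoprime f (2 ^ j * g) ∧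
    h ^ 2 = f ^ 4 + 4 * a * f ^ 2 * (2 ^ j * g) ^ 2 + 4 * b * (2 ^ j * g) ^ 4

theorem exists_factorization {a b f g h : Cub ℤ} {n : ℕ} (hf : ¬ p ∣ f) (hfg : IsCoprime f g)
    (hl : a ^ 2 - b ∣ p ^ n)
    (e : h ^ 2 = f ^ 4 + 4 * a * f ^ 2 * g ^ 2 + 4 * b * g ^ 4) :
    ∃ (u : (Cub ℤ)ˣ) (r s : Cub ℤ), ¬ p ∣ r ∧ g = r * s ∧
      u * r ^ 4 + (a ^ 2 - b) * (↑u⁻¹ * s ^ 4) = f ^ 2 + 2 * a * r ^ 2 * s ^ 2 := by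
  have hl0 : a ^ 2 - b ≠ 0 := fun h0 => pow_ne_zero n prime_p.ne_zero (zero_dvd_iff.1 (h0 ▸ hl))
  obtain ⟨α, hα⟩ : 2 ∣ h - f ^ 2 := two_dvd_sub_of_sq
    ⟨a * f ^ 2 * g ^ 2 + b * g ^ 4, by rw [e]; ring⟩
  have hodd : ¬ p ∣ f ^ 2 + 2 * a * g ^ 2 := fun hd => not_p_dvd_pow hf 2
    ((dvd_add_left ((p_dvd_two.mul_right (a * g ^ 2)).trans (dvd_of_eq (by ring)))).1 hd)
  have hcop : IsCoprime (f ^ 2 + 2 * a * g ^ 2) ((a ^ 2 - b) * g ^ 4) := by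
    refine (isCoprime_of_dvd_pow hodd hl).mul_right (IsCoprime.pow_right ?_)
    have := (hfg.pow_left (m := 2)).add_mul_right_left (2 * a * g)
    rwa [mul_assoc (2 * a), ← pow_two] at this
  have main : ∀ A B : Cub ℤ, A + B = f ^ 2 + 2 * a * g ^ 2 → A * B = (a ^ 2 - b) * g ^ 4 →
      ¬ p ∣ A → ∃ (u : (Cub ℤ)ˣ) (r s : Cub ℤ), ¬ p ∣ r ∧ g = r * s ∧
      u * r ^ 4 + (a ^ 2 - b) * (↑u⁻¹ * s ^ 4) = f ^ 2 + 2 * a * r ^ 2 * s ^ 2 := by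
    intro A B hs hm hA
    obtain ⟨u, r, s, rfl, h1, h2⟩ := exists_eq_unit_mul_pow four_ne_zero
      (IsCoprime.of_add_mul (by rwa [hs, hm])) (isCoprime_of_dvd_pow hA hl)
      (by rintro rfl; exact hA (dvd_zero _)) hl0 hm
    refine ⟨u, r, s, fun hr => hA ?_, rfl, by rw [← h1, ← h2, hs]; ring⟩
    rw [h1]
    exact (dvd_pow hr four_ne_zero).mul_left _
  have hsum : (f ^ 2 + a * g ^ 2 + α) + (a * g ^ 2 - α) = f ^ 2 + 2 * a * g ^ 2 := by ring
  have hprod : (f ^ 2 + a * g ^ 2 + α) * (a * g ^ 2 - α) = (a ^ 2 - b) * g ^ 4 := by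
    apply mul_left_cancel₀ (show (4 : Cub ℤ) ≠ 0 by
      intro h0; simpa using congrArg Cub.x h0)
    have : h = f ^ 2 + 2 * α := by linear_combination hα
    rw [this] at e
    linear_combination -e
  by_cases hA : p ∣ f ^ 2 + a * g ^ 2 + α
  · refine main _ _ ((add_comm _ _).trans hsum) ((mul_comm _ _).trans hprod) fun hB => hodd ?_
    rw [← hsum]
    exact dvd_add hA hB
  · exact main _ _ hsum hprod hA

theorem two_ne_zero' : (2 : Cub ℤ) ≠ 0 := fun h => by simpa using congrArg Cub.x h

theorem isCoprime_unit (a : Cub ℤ) (u : (Cub ℤ)ˣ) : IsCoprime a u :=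
  (isCoprime_one_right (x := a)).of_isCoprime_of_dvd_right u.isUnit.dvd

theorem exists_second_factorization {a b f r s : Cub ℤ} {m : ℕ} (hb : b ∣ p ^ m) (hf : ¬ p ∣ f)
    (hr : ¬ p ∣ r) (hfs : IsCoprime f s) (τ : (Cub ℤ)ˣ) {σ : Cub ℤ}
    (h1 : f - (τ * r ^ 2 - 4 * a * (↑τ⁻¹ * s ^ 2)) = 2 * σ) (hσ : ¬ p ∣ f - σ)
    (h2 : f ^ 2 = (τ * r ^ 2 - 4 * a * (↑τ⁻¹ * s ^ 2)) ^ 2 - 16 * b * (↑τ⁻¹ ^ 2 * s ^ 4)) :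
    ∃ (κ : (Cub ℤ)ˣ) (F H h : Cub ℤ), s = F * H ∧ ¬ p ∣ F ∧ IsCoprime F (H * κ) ∧
      h ^ 2 = F ^ 4 + 4 * a * F ^ 2 * (H * κ) ^ 2 + 4 * b * (H * κ) ^ 4 := by
  have hb0 : b ≠ 0 := fun h0 => pow_ne_zero m prime_p.ne_zero (zero_dvd_iff.1 (h0 ▸ hb))
  have hτ := τ.mul_inv
  obtain ⟨t', ht'⟩ : ∃ t', t' = ((τ⁻¹ : (Cub ℤ)ˣ) : Cub ℤ) := ⟨_, rfl⟩
  have hco : ∀ x : Cub ℤ, ¬ p ∣ x → IsCoprime x (-(2 * 2 * b * t' ^ 2)) := fun x hx =>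
    ((((isCoprime_two hx).mul_right (isCoprime_two hx)).mul_right
      (isCoprime_of_dvd_pow hx hb)).mul_right (ht' ▸ (isCoprime_unit x _).pow_right)).neg_right
  rw [← ht'] at h1 h2 hτ
  have hprod : (f - σ) * σ = -(2 * 2 * b * t' ^ 2) * s ^ 4 := by
    apply mul_left_cancel₀ (mul_ne_zero two_ne_zero' two_ne_zero')
    linear_combination h2 + (2 * σ - f - τ * r ^ 2 + 4 * a * (t' * s ^ 2)) * h1
  have hl0 : -(2 * 2 * b * t' ^ 2) ≠ 0 := by
    rw [ht']
    simp [two_ne_zero', hb0]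
  have hc : IsCoprime (f - σ) σ := IsCoprime.of_add_mul (by
    rw [hprod, sub_add_cancel]; exact (hco f hf).mul_right hfs.pow_right)
  obtain ⟨d, F, H, rfl, h3, h4⟩ := exists_eq_unit_mul_pow four_ne_zero hc (hco _ hσ) (by intro h0; exact hσ (h0 ▸ dvd_zero _)) hl0 hprod
  have hF : ¬ p ∣ F := fun hF => hσ (h3 ▸ (dvd_pow hF four_ne_zero).mul_left _)
  obtain ⟨d', hd'⟩ : ∃ d', d' = ((d⁻¹ : (Cub ℤ)ˣ) : Cub ℤ) := ⟨_, rfl⟩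
  have hd := d.mul_inv
  rw [← hd'] at h4 hd
  have e : τ * r ^ 2 * d' = F ^ 4 + 4 * a * F ^ 2 * H ^ 2 * (t' * d')
      + 4 * b * H ^ 4 * (t' * d') ^ 2 := by
    linear_combination (-d') * h1 + d' * h3 - d' * h4 + F ^ 4 * hd
  obtain ⟨κ, hκ⟩ := unit_sq (u := τ * d) (r := r * d') (s := F ^ 2)
    (w := a * F ^ 2 * H ^ 2 * (t' * d') + b * H ^ 4 * (t' * d') ^ 2)
    (not_p_dvd_mul hr (hd' ▸ not_p_dvd_unit _)) (by
      push_cast; linear_combination e + τ * r ^ 2 * d' * hd)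
  have hκ' : ((κ⁻¹ : (Cub ℤ)ˣ) : Cub ℤ) ^ 2 = t' * d' := by
    rw [ht', hd', ← Units.val_mul, ← Units.val_pow_eq_pow_val, inv_pow, ← hκ, mul_inv]
  have hκ2 : (κ : Cub ℤ) ^ 2 = τ * d := by
    rw [← Units.val_pow_eq_pow_val, ← hκ, Units.val_mul]
  refine ⟨κ⁻¹, F, H, κ * r * d', rfl, hF, ?_, ?_⟩
  · rw [h3, h4] at hc
    exact (IsCoprime.of_isCoprime_of_dvd_left hc
      ((dvd_pow_self F four_ne_zero).mul_left _)).of_isCoprime_of_dvd_right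
      (((dvd_pow_self H four_ne_zero).mul_left _).mul_left _) |>.mul_right (isCoprime_unit _ _)
  · linear_combination e + r ^ 2 * d' ^ 2 * hκ2 + τ * r ^ 2 * d' * hd
      - 4 * a * F ^ 2 * H ^ 2 * hκ' - 4 * b * H ^ 4 * (t' * d' + (κ⁻¹ : (Cub ℤ)ˣ) ^ 2) * hκ'

theorem HasPoint.descent {a b : Cub ℤ} {n m j : ℕ} (hl : a ^ 2 - b ∣ p ^ n) (hb : b ∣ p ^ m)
    (h : HasPoint a b (j + 1)) : HasPoint a b j := by
  obtain ⟨f, g, h, hf, hg, hfg, e⟩ := h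
  obtain ⟨u, r, s, hr, hrs, e1⟩ := exists_factorization hf hfg hl e
  obtain ⟨s, rfl⟩ : 2 ∣ s := (isCoprime_two hr).symm.dvd_of_dvd_mul_left
    ⟨2 ^ j * g, by rw [← hrs]; ring⟩
  obtain ⟨τ, rfl⟩ := unit_sq (u := u) (r := r ^ 2) (s := f)
    (w := 2 * a * r ^ 2 * s ^ 2 - 4 * (a ^ 2 - b) * (↑u⁻¹ * s ^ 4)) (not_p_dvd_pow hr 2)
    (by linear_combination e1)
  have hτ := τ.mul_inv
  have hfs : IsCoprime f s := by
    rw [hrs] at hfg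
    exact hfg.of_mul_right_right.of_mul_right_right
  have key : ∃ τ : (Cub ℤ)ˣ, ∃ σ : Cub ℤ, f - (τ * r ^ 2 - 4 * a * (↑τ⁻¹ * s ^ 2)) = 2 * σ ∧
      ¬ p ∣ f - σ ∧
      f ^ 2 = (τ * r ^ 2 - 4 * a * (↑τ⁻¹ * s ^ 2)) ^ 2 - 16 * b * (↑τ⁻¹ ^ 2 * s ^ 4) := by
    have h2 : f ^ 2 = (τ * r ^ 2 - 4 * a * (↑τ⁻¹ * s ^ 2)) ^ 2 - 16 * b * (↑τ⁻¹ ^ 2 * s ^ 4) := by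
      rw [← inv_pow] at e1
      push_cast at e1
      linear_combination (-1 : Cub ℤ) * e1 + 8 * a * r ^ 2 * s ^ 2 * hτ
    obtain ⟨σ, hσ⟩ : 2 ∣ f - (τ * r ^ 2 - 4 * a * (↑τ⁻¹ * s ^ 2)) := two_dvd_sub_of_sq
      ⟨-(4 * b * (↑τ⁻¹ ^ 2 * s ^ 4)), by rw [h2]; ring⟩
    by_cases hd : p ∣ f - σ
    · refine ⟨-τ, f - σ, ?_, fun h3 => hf ?_, ?_⟩
      · rw [inv_neg, Units.val_neg, Units.val_neg]
        linear_combination -hσ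
      · convert dvd_add hd h3 using 1; ring
      · rw [inv_neg, Units.val_neg, Units.val_neg]
        linear_combination h2
    · exact ⟨τ, σ, hσ, hd, h2⟩
  obtain ⟨τ, σ, h1, hd, h2⟩ := key
  obtain ⟨κ, F, H, h', rfl, hF, hFH, e'⟩ := exists_second_factorization hb hf hr hfs τ h1 hd h2
  have hj : 2 ^ j * g = (r * F) * H := by
    apply mul_left_cancel₀ two_ne_zero'
    linear_combination hrs
  obtain ⟨H, rfl⟩ : 2 ^ j ∣ H := ((isCoprime_two (not_p_dvd_mul hr hF)).pow_right).symm.dvd_of_dvd_mul_left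
    ⟨g, hj.symm⟩
  have hg' : g = r * F * H := mul_left_cancel₀ (pow_ne_zero j two_ne_zero') (by rw [hj]; ring)
  rw [mul_assoc (2 ^ j)] at hFH e'
  refine ⟨F, H * κ, h', hF, not_p_dvd_mul (fun hH => hg ?_) (not_p_dvd_unit κ), hFH, e'⟩
  rw [hg']
  exact hH.mul_left _

theorem HasPoint.zero {a b : Cub ℤ} {n m j : ℕ} (hl : a ^ 2 - b ∣ p ^ n) (hb : b ∣ p ^ m)
    (h : HasPoint a b j) : HasPoint a b 0 := by
  induction j with
  | zero => exact h
  | succ j ih => exact ih (h.descent hl hb)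

theorem not_hasPoint_zero_of_four {a b : Cub ℤ} {n : ℕ} (v : (Cub ℤ)ˣ) (ha : ∃ a', a = 2 * a')
    (hb : b = 4 * v) (hl : a ^ 2 - b ∣ p ^ n) : ¬ HasPoint a b 0 := by
  rintro ⟨f, g, h, hf, hg, hfg, e⟩
  obtain ⟨a, rfl⟩ := ha
  obtain ⟨u, r, s, hr, hrs, e1⟩ := exists_factorization hf hfg hl e
  rw [pow_zero, one_mul] at hrs
  have hs : ¬ p ∣ s := fun hs => hg (hrs ▸ hs.mul_left _)
  subst hb
  obtain ⟨τ, rfl⟩ := unit_sq (u := u) (r := r ^ 2) (s := f)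
    (w := a * r ^ 2 * s ^ 2 - (a ^ 2 - v) * (↑u⁻¹ * s ^ 4)) (not_p_dvd_pow hr 2)
    (by linear_combination e1)
  have hτ := τ.mul_inv
  have h2 : f ^ 2 = (τ * r ^ 2 - 2 * a * (↑τ⁻¹ * s ^ 2)) ^ 2 - 4 * (v * (↑τ⁻¹ ^ 2 * s ^ 4)) := by
    rw [← inv_pow] at e1
    push_cast at e1
    linear_combination (-1 : Cub ℤ) * e1 + 4 * a * r ^ 2 * s ^ 2 * hτ
  obtain ⟨σ, hσ⟩ : 2 ∣ f - (τ * r ^ 2 - 2 * a * (↑τ⁻¹ * s ^ 2)) := two_dvd_sub_of_sq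
    ⟨-(v * (↑τ⁻¹ ^ 2 * s ^ 4)), by rw [h2]; ring⟩
  have hprod : (f - σ) * σ = -(v * (↑τ⁻¹ ^ 2 * s ^ 4)) := by
    apply mul_left_cancel₀ (mul_ne_zero two_ne_zero' two_ne_zero')
    linear_combination h2 + (2 * σ - f - τ * r ^ 2 + 2 * a * (↑τ⁻¹ * s ^ 2)) * hσ
  have hodd : ¬ p ∣ (f - σ) * σ := by
    rw [hprod, dvd_neg]
    exact not_p_dvd_mul (not_p_dvd_unit _) (not_p_dvd_mul (not_p_dvd_pow (not_p_dvd_unit _) 2)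
      (not_p_dvd_pow hs 4))
  refine hf ?_
  have := p_dvd_add (fun h => hodd (h.mul_right _)) (fun h => hodd (h.mul_left _))
  rwa [sub_add_cancel] at this

theorem exists_eq_add_four_mul (c : Cub ℤ) : ∃ x ∈ ([0, 1, 2, 3] : List ℤ), ∃ y ∈ ([0, 1, 2, 3] : List ℤ),
    ∃ z ∈ ([0, 1, 2, 3] : List ℤ), ∃ w, c = ⟨x, y, z⟩ + 4 * w := by
  have key : ∀ n : ℤ, n % 4 ∈ ([0, 1, 2, 3] : List ℤ) := fun n => by
    have h1 := Int.emod_nonneg n (show (4 : ℤ) ≠ 0 by norm_num)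
    have h2 := Int.emod_lt_of_pos n (show (0 : ℤ) < 4 by norm_num)
    simp only [List.mem_cons, List.not_mem_nil, or_false]
    omega
  refine ⟨_, key c.x, _, key c.y, _, key c.z, ⟨c.x / 4, c.y / 4, c.z / 4⟩, ?_⟩
  ext <;> simp [Int.emod_add_mul_ediv]

theorem not_hasPoint_zero_of_check {a b : Cub ℤ} {n : ℕ} (ha : ∃ a', a = 2 * a')
    (hl : a ^ 2 - b ∣ p ^ n)
    (h4 : ∀ d ∈ ([1, -1, -fundUnit] : List (Cub ℤ)ˣ), ∀ b1 ∈ oddSquares, ∀ b2 ∈ oddSquares,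
      ∀ b3 ∈ oddSquares, ¬ (4 : Cub ℤ) ∣ d * b1 + (a * a - b) * (d⁻¹ : (Cub ℤ)ˣ) * b2 - b3)
    (h8 : ∀ x ∈ ([0, 1, 2, 3] : List ℤ), ∀ y ∈ ([0, 1, 2, 3] : List ℤ),
      ∀ z ∈ ([0, 1, 2, 3] : List ℤ), ∀ b1 ∈ oddSquares, ∀ b2 ∈ oddSquares,
      ¬ (8 : Cub ℤ) ∣ fundUnit * (b1 * b1) + (a * a - b) * (fundUnit⁻¹ : (Cub ℤ)ˣ) * (b2 * b2)
        - 2 * a * b1 * b2 - (⟨x, y, z⟩ * ⟨x, y, z⟩ : Cub ℤ)) : ¬ HasPoint a b 0 := by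
  rintro ⟨f, g, h, hf, hg, hfg, e⟩
  obtain ⟨a', ha'⟩ := ha
  obtain ⟨u, r, s, hr, hrs, e1⟩ := exists_factorization hf hfg hl e
  rw [pow_zero, one_mul] at hrs
  have hs : ¬ p ∣ s := fun hs => hg (hrs ▸ hs.mul_left _)
  obtain ⟨d, hd, v, rfl⟩ := exists_eq_mul_sq u
  have hv := v.mul_inv
  rw [mul_inv, ← inv_pow] at e1
  push_cast at e1
  have e2 : d * (v * r ^ 2) ^ 2 + (a ^ 2 - b) * (d⁻¹ : (Cub ℤ)ˣ) * ((v⁻¹ : (Cub ℤ)ˣ) * s ^ 2) ^ 2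
      = f ^ 2 + 4 * (a' * r ^ 2 * s ^ 2) := by
    linear_combination e1 + 2 * r ^ 2 * s ^ 2 * ha'
  obtain ⟨b1, hb1, w1, hw1⟩ := exists_oddSquares
    (not_p_dvd_mul (not_p_dvd_unit v) (not_p_dvd_pow hr 2))
  obtain ⟨b2, hb2, w2, hw2⟩ := exists_oddSquares
    (not_p_dvd_mul (not_p_dvd_unit v⁻¹) (not_p_dvd_pow hs 2))
  obtain ⟨b3, hb3, w3, hw3⟩ := exists_oddSquares hf
  have c4 : (4 : Cub ℤ) ∣ d * b1 + (a * a - b) * (d⁻¹ : (Cub ℤ)ˣ) * b2 - b3 :=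
    ⟨w3 + a' * r ^ 2 * s ^ 2 - d * w1 - (a * a - b) * (d⁻¹ : (Cub ℤ)ˣ) * w2, by
      linear_combination e2 - (d : Cub ℤ) * hw1 - (a * a - b) * (d⁻¹ : (Cub ℤ)ˣ) * hw2 + hw3⟩
  have hde : d = fundUnit := by
    by_contra hne
    refine h4 d ?_ b1 hb1 b2 hb2 b3 hb3 c4
    simp only [List.mem_cons, List.not_mem_nil, or_false] at hd ⊢
    tauto
  subst hde
  obtain ⟨b1, hb1, w1, hw1⟩ := exists_oddSquares (not_p_dvd_mul (not_p_dvd_unit v) hr)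
  obtain ⟨b2, hb2, w2, hw2⟩ := exists_oddSquares hs
  obtain ⟨x, hx, y, hy, z, hz, w, hw⟩ := exists_eq_add_four_mul (f * v)
  obtain ⟨C, hC⟩ : ∃ C : Cub ℤ, C = ⟨x, y, z⟩ := ⟨_, rfl⟩
  refine h8 x hx y hy z hz b1 hb1 b2 hb2 ?_
  rw [← hC] at hw ⊢
  obtain ⟨ε', hε'⟩ : ∃ ε', ε' = ((fundUnit⁻¹ : (Cub ℤ)ˣ) : Cub ℤ) := ⟨_, rfl⟩
  rw [← hε'] at e1 ⊢
  have e3 : fundUnit * ((v * r) ^ 2) ^ 2 + (a * a - b) * ε' * (s ^ 2) ^ 2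
      = (f * v) ^ 2 + 2 * a * (v * r) ^ 2 * s ^ 2 := by
    linear_combination (v : Cub ℤ) ^ 2 * e1 - (a ^ 2 - b) * ε' * s ^ 4 * (v * (v⁻¹ : (Cub ℤ)ˣ) + 1) * hv
  rw [hw1, hw2, hw] at e3
  refine ⟨C * w + 2 * w ^ 2 + 2 * a' * (b1 * w2 + b2 * w1 + 4 * w1 * w2) - fundUnit * (b1 * w1 + 2 * w1 ^ 2)
    - (a * a - b) * ε' * (b2 * w2 + 2 * w2 ^ 2), ?_⟩
  linear_combination e3 + 8 * (b1 * w2 + b2 * w1 + 4 * w1 * w2) * ha'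

/-- `(p ^ 2 - 2 p) ^ 2 + 4`. -/
def mu : Cub ℤ := (p * p - 2 * p) * (p * p - 2 * p) + 4

theorem mu_mul : mu * fundUnit = p ^ 4 := by
  simp only [pow_succ, pow_zero, one_mul]; ext <;> decide +kernel

theorem not_hasPoint_D1 (j : ℕ) : ¬ HasPoint (2 * p) (-4) j := fun h => by
  have hl : (2 * p) ^ 2 - (-4) ∣ p ^ 6 := ⟨fundUnit, by
    linear_combination (p ^ 3 + 2 * fundUnit) * p_pow_three + 4 * (fundUnit : Cub ℤ) * fundUnit_val⟩
  have hb : (-4 : Cub ℤ) ∣ p ^ 6 := ⟨-fundUnit ^ 2, by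
    linear_combination (p ^ 3 + 2 * fundUnit) * p_pow_three⟩
  exact not_hasPoint_zero_of_four (-1) ⟨p, rfl⟩ (by simp) hl (h.zero hl hb)

theorem not_hasPoint_F1 (j : ℕ) : ¬ HasPoint 0 (-(4 * fundUnit)) j := fun h => by
  have hl : (0 : Cub ℤ) ^ 2 - (-(4 * fundUnit)) ∣ p ^ 6 := ⟨fundUnit, by
    linear_combination (p ^ 3 + 2 * fundUnit) * p_pow_three⟩
  have hb : -(4 * (fundUnit : Cub ℤ)) ∣ p ^ 6 := ⟨-fundUnit, by
    linear_combination (p ^ 3 + 2 * fundUnit) * p_pow_three⟩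
  exact not_hasPoint_zero_of_four (-fundUnit) ⟨0, by simp⟩ (by simp) hl (h.zero hl hb)

theorem not_hasPoint_D2 (j : ℕ) : ¬ HasPoint (-2) mu j := fun h => by
  have hl : (-2 : Cub ℤ) ^ 2 - mu ∣ p ^ 4 := ⟨-fundUnit ^ 2, by
    simp only [pow_succ, pow_zero, one_mul]; ext <;> decide +kernel⟩
  exact not_hasPoint_zero_of_check ⟨-1, by ring⟩ hl (by decide +kernel) (by decide +kernel)
    (h.zero hl ⟨_, mu_mul.symm⟩)

theorem not_hasPoint_F2 (j : ℕ) : ¬ HasPoint 0 (-mu) j := fun h => by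
  have hl : (0 : Cub ℤ) ^ 2 - -mu ∣ p ^ 4 := ⟨fundUnit, by linear_combination -mu_mul⟩
  have hb : -mu ∣ p ^ 4 := ⟨-fundUnit, by linear_combination -mu_mul⟩
  exact not_hasPoint_zero_of_check ⟨0, by ring⟩ hl (by decide +kernel) (by decide +kernel)
    (h.zero hl hb)

end Cub

/-- The four-number lemma. -/
theorem exists_four_number {R : Type*} [CommRing R] [IsDomain R] [IsPrincipalIdealRing R]
    {a b c d : R} (hc : c ≠ 0) (h : a * b = c * d) :
    ∃ i j k l : R, a = i * j ∧ b = k * l ∧ c = i * k ∧ d = j * l := by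
  obtain ⟨i, hi⟩ := IsBezout.span_pair_isPrincipal a c |>.principal
  obtain ⟨j, hj⟩ : i ∣ a := by
    rw [← Ideal.mem_span_singleton, ← Ideal.submodule_span_eq, ← hi]
    exact Ideal.subset_span (by simp)
  obtain ⟨k, hk⟩ : i ∣ c := by
    rw [← Ideal.mem_span_singleton, ← Ideal.submodule_span_eq, ← hi]
    exact Ideal.subset_span (by simp)
  obtain ⟨x, y, hxy⟩ : ∃ x y, x * a + y * c = i := by
    rw [← Ideal.mem_span_pair, hi, Ideal.submodule_span_eq]
    exact Ideal.mem_span_singleton_self i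
  have hi0 : i ≠ 0 := by rintro rfl; exact hc (by rw [hk, zero_mul])
  have hk0 : k ≠ 0 := by rintro rfl; exact hc (by rw [hk, mul_zero])
  have e : x * j + y * k = 1 := mul_left_cancel₀ hi0 (by
    rw [hj, hk] at hxy; linear_combination hxy)
  have e2 : j * b = k * d := mul_left_cancel₀ hi0 (by rw [hj, hk] at h; linear_combination h)
  refine ⟨i, j, k, x * d + y * b, hj, ?_, hk, ?_⟩
  · linear_combination (-b) * e + x * e2
  · apply mul_left_cancel₀ hk0
    linear_combination (-k * d) * e - k * y * e2

namespace Cub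

theorem intCast_isCoprime {m n : ℤ} (h : IsCoprime m n) : IsCoprime (m : Cub ℤ) n := by
  simpa using h.map (Int.castRingHom (Cub ℤ))

theorem p_dvd_intCast {n : ℤ} : p ∣ (n : Cub ℤ) ↔ 2 ∣ n := by
  rw [p_dvd_iff, intCast_x, Int.cast_id]

theorem sq_ne_of_not_hasPoint {a b : Cub ℤ} (hn : ∀ j, ¬ HasPoint a b j) {f k l h : Cub ℤ} {m : ℤ}
    (hm : m ≠ 0) (hf : ¬ p ∣ f) (hk : ¬ p ∣ k) (hkl : (m : Cub ℤ) = k * l) (hfl : IsCoprime f l) :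
    h ^ 2 ≠ f ^ 4 + 4 * a * f ^ 2 * l ^ 2 + 4 * b * l ^ 4 := by
  intro e
  obtain ⟨j, m', hm', rfl⟩ := (Int.finiteMultiplicity_iff.2 ⟨by norm_num, hm⟩ :
    FiniteMultiplicity (2 : ℤ) m).exists_eq_pow_mul_and_not_dvd |> fun ⟨c, h1, h2⟩ =>
      (⟨_, c, h2, h1⟩ : ∃ j c, ¬ (2 : ℤ) ∣ c ∧ m = 2 ^ j * c)
  push_cast at hkl
  obtain ⟨g, rfl⟩ : 2 ^ j ∣ l := ((isCoprime_two hk).pow_right).symm.dvd_of_dvd_mul_left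
    ⟨m', hkl.symm⟩
  have hg : (m' : Cub ℤ) = k * g := mul_left_cancel₀ (pow_ne_zero j two_ne_zero') (by
    rw [hkl]; ring)
  exact hn j ⟨f, g, h, hf, fun h => hm' (p_dvd_intCast.1 (hg ▸ h.mul_left _)), hfl, e⟩

theorem sq_ne_of_start {θ μ η : Cub ℤ} {n : ℕ} (hμ : μ = θ ^ 2 + 4) (hμn : μ ∣ p ^ n) (hη : IsUnit η)
    (hn : ∀ j, ¬ HasPoint (η - 1) (-(η * μ)) j) {A B : ℤ} (hA : ¬ 2 ∣ A) (hB : B ≠ 0)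
    (hAB : IsCoprime A B)
    (hsq : ∀ (u : (Cub ℤ)ˣ) (q q' : Cub ℤ), ¬ p ∣ q → (A * B : Cub ℤ) = q * q' →
      u * q ^ 2 + μ * (↑u⁻¹ * q' ^ 2) = A ^ 2 - 4 * η * B ^ 2 - 2 * θ * A * B →
        ∃ τ : (Cub ℤ)ˣ, u = τ ^ 2) {s : Cub ℤ} :
    s ^ 2 ≠ (A ^ 2 - 4 * η * B ^ 2 - 2 * θ * A * B) ^ 2 - 4 * μ * (A * B) ^ 2 := by
  intro e
  have hμ0 : μ ≠ 0 := fun h0 => pow_ne_zero n prime_p.ne_zero (zero_dvd_iff.1 (h0 ▸ hμn))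
  obtain ⟨T, hT⟩ : ∃ T : Cub ℤ, T = A ^ 2 - 4 * η * B ^ 2 - 2 * θ * A * B := ⟨_, rfl⟩
  have hAp : ¬ p ∣ (A : Cub ℤ) := fun h => hA (p_dvd_intCast.1 h)
  have hABc := intCast_isCoprime hAB
  rw [← hT] at e hsq
  have hTp : ¬ p ∣ T := fun h => not_p_dvd_pow hAp 2 (by
    have : p ∣ 2 * (2 * η * B ^ 2 + θ * A * B) := p_dvd_two.mul_right _
    convert dvd_add h this using 1
    rw [hT]; ring)
  have hTA : IsCoprime T A := by
    have h4 : IsCoprime (A : Cub ℤ) (-(2 * 2 * η * B ^ 2)) :=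
      ((((isCoprime_two hAp).mul_right (isCoprime_two hAp)).mul_right
        (isCoprime_one_right.of_isCoprime_of_dvd_right hη.dvd)).mul_right
        hABc.pow_right).neg_right
    have := h4.symm.add_mul_right_left (A - 2 * θ * B)
    convert this using 1
    rw [hT]; ring
  have hTB : IsCoprime T B := by
    have := (hABc.pow_left (m := 2)).add_mul_right_left (-(4 * η * B + 2 * θ * A))
    convert this using 1
    rw [hT]; ring
  have hTc : IsCoprime T (μ * (A * B) ^ 2) :=
    (isCoprime_of_dvd_pow hTp hμn).mul_right (hTA.mul_right hTB).pow_right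
  have main : ∀ P Q : Cub ℤ, P + Q = T → P * Q = μ * (A * B) ^ 2 → ¬ p ∣ P → False := by
    intro P Q hs hm hP
    obtain ⟨u, q, q', hqq, h1, h2⟩ := exists_eq_unit_mul_pow two_ne_zero
      (IsCoprime.of_add_mul (by rwa [hs, hm])) (isCoprime_of_dvd_pow hP hμn)
      (by rintro rfl; exact hP (dvd_zero _)) hμ0 hm
    have hq : ¬ p ∣ q := fun hq => hP (h1 ▸ (dvd_pow hq two_ne_zero).mul_left _)
    obtain ⟨τ, rfl⟩ := hsq u q q' hq hqq (by rw [← h1, ← h2, hs])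
    have hτ := τ.mul_inv
    obtain ⟨i, j, k, l, h3, h4, h5, h6⟩ := exists_four_number (a := (A : Cub ℤ)) (b := B)
      (c := τ * q) (d := ↑τ⁻¹ * q') (mul_ne_zero τ.ne_zero (by
        rintro rfl; exact hq (dvd_zero _))) (by rw [hqq]; linear_combination (-q * q') * hτ)
    have hi : ¬ p ∣ i := fun h => hAp (h3 ▸ h.mul_right _)
    have hk : ¬ p ∣ k := fun h => not_p_dvd_mul (not_p_dvd_unit τ) hq (h5 ▸ h.mul_left _)
    have hk0 : k ≠ 0 := by rintro rfl; exact hk (dvd_zero _)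
    have eT : (i * k) ^ 2 + μ * (j * l) ^ 2 = T := by
      rw [← h5, ← h6, ← hs, h1, h2, ← inv_pow]; push_cast; ring
    rw [hT, h3, h4] at eT
    have eW : (j * (i ^ 2 - μ * l ^ 2) - θ * i * l * k) ^ 2
        = k ^ 2 * (i ^ 4 + 4 * (η - 1) * i ^ 2 * l ^ 2 + 4 * (-(η * μ)) * l ^ 4) := by
      linear_combination (-(i ^ 2 - μ * l ^ 2)) * eT - i ^ 2 * l ^ 2 * k ^ 2 * hμ
    obtain ⟨W, hW⟩ : k ∣ j * (i ^ 2 - μ * l ^ 2) - θ * i * l * k :=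
      (UniqueFactorizationMonoid.pow_dvd_pow_iff_dvd two_ne_zero).1 ⟨_, eW⟩
    refine sq_ne_of_not_hasPoint hn hB hi hk h4 ?_ (h := W) ?_
    · rw [h3, h4] at hABc
      exact hABc.of_mul_left_left.of_mul_right_right
    · apply mul_left_cancel₀ (pow_ne_zero 2 hk0)
      rw [← eW, hW]; ring
  obtain ⟨P, hP⟩ : 2 ∣ s - T := two_dvd_sub_of_sq ⟨-(μ * (A * B) ^ 2), by rw [e]; ring⟩
  have hprod : (T + P) * (-P) = μ * (A * B) ^ 2 := by
    apply mul_left_cancel₀ (mul_ne_zero two_ne_zero' two_ne_zero')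
    linear_combination (-1 : Cub ℤ) * e + (s + T + 2 * P) * hP
  by_cases h : p ∣ T + P
  · exact main (-P) (T + P) (by ring) (by rw [← hprod]; ring) fun h' => hTp (by
      convert dvd_add h h' using 1; ring)
  · exact main _ _ (by ring) hprod h

theorem sq_ne_F1 {A B : ℤ} (hA : ¬ 2 ∣ A) (hB : B ≠ 0) (hAB : IsCoprime A B) (s : Cub ℤ) :
    s ^ 2 ≠ (A ^ 2 - 4 * B ^ 2 + 4 * p * A * B) ^ 2 - 16 * fundUnit * (A * B) ^ 2 := by
  have hμn : 4 * (fundUnit : Cub ℤ) ∣ p ^ 6 := ⟨fundUnit, by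
    linear_combination (p ^ 3 + 2 * fundUnit) * p_pow_three⟩
  have := sq_ne_of_start (θ := -2 * p) (μ := 4 * fundUnit) (η := 1) (s := s)
    (by rw [fundUnit_val]; ring) hμn isUnit_one
    (by simpa using not_hasPoint_F1) hA hB hAB (by
      intro u q q' hq hqq e
      exact unit_sq hq (s := A) (w := -B ^ 2 + p * A * B - fundUnit * (↑u⁻¹ * q' ^ 2))
        (by linear_combination e))
  intro e
  exact this (by linear_combination e)

theorem unit_sq_of_start {η : Cub ℤ} {A B : ℤ} (hA : ¬ 2 ∣ A) (u : (Cub ℤ)ˣ) (q q' : Cub ℤ)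
    (hq : ¬ p ∣ q) (hqq : (A * B : Cub ℤ) = q * q')
    (e : u * q ^ 2 + mu * (↑u⁻¹ * q' ^ 2)
      = A ^ 2 - 4 * η * B ^ 2 - 2 * (p * p - 2 * p) * A * B) : ∃ τ : (Cub ℤ)ˣ, u = τ ^ 2 := by
  have hAp : ¬ p ∣ (A : Cub ℤ) := fun h => hA (p_dvd_intCast.1 h)
  obtain ⟨k, rfl | rfl⟩ := Int.even_or_odd' B
  · obtain ⟨q', rfl⟩ : 2 ∣ q' := (isCoprime_two hq).symm.dvd_of_dvd_mul_left
      ⟨A * k, by rw [← hqq]; push_cast; ring⟩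
    push_cast at e
    exact unit_sq hq (s := A) (w := -4 * η * k ^ 2 - (p * p - 2 * p) * A * k - mu * (↑u⁻¹ * q' ^ 2))
      (by linear_combination e)
  · have hq' : ¬ p ∣ q' := fun h => by
      have : p ∣ ((A * (2 * k + 1) : ℤ) : Cub ℤ) := by
        push_cast at hqq ⊢
        rw [hqq]; exact h.mul_left _
      rcases Int.prime_two.dvd_or_dvd (p_dvd_intCast.1 this) with h | h
      · exact hA h
      · omega
    obtain ⟨m, rfl⟩ : ∃ m, A = 2 * m + 1 := ⟨A / 2, by omega⟩
    obtain ⟨d, hd, v, rfl⟩ := exists_eq_mul_sq u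
    obtain ⟨b1, hb1, w1, hw1⟩ := exists_oddSquares (not_p_dvd_mul (not_p_dvd_unit v) hq)
    obtain ⟨b2, hb2, w2, hw2⟩ := exists_oddSquares (not_p_dvd_mul (not_p_dvd_unit v⁻¹) hq')
    rw [mul_inv, ← inv_pow] at e
    push_cast at e
    have c4 : (4 : Cub ℤ) ∣ d * b1 + mu * (d⁻¹ : (Cub ℤ)ˣ) * b2 - (1 - 2 * (p * p)) :=
      ⟨m ^ 2 + m - η * (2 * k + 1) ^ 2 + p * (2 * m + 1) * (2 * k + 1)
        - p * p * (2 * m * k + m + k) - d * w1 - mu * (d⁻¹ : (Cub ℤ)ˣ) * w2, by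
        linear_combination e - (d : Cub ℤ) * hw1 - mu * (d⁻¹ : (Cub ℤ)ˣ) * hw2⟩
    have check : ∀ d ∈ ([-1, fundUnit, -fundUnit] : List (Cub ℤ)ˣ), ∀ b1 ∈ oddSquares,
      ∀ b2 ∈ oddSquares,
      ¬ (4 : Cub ℤ) ∣ d * b1 + mu * (d⁻¹ : (Cub ℤ)ˣ) * b2 - (1 - 2 * (p * p)) := by decide +kernel
    simp only [List.mem_cons, List.not_mem_nil, or_false] at hd
    rcases hd with rfl | rfl | rfl | rfl
    · exact ⟨v, one_mul _⟩
    all_goals exact (check _ (by simp) b1 hb1 b2 hb2 c4).elim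

theorem sq_ne_D2 {A B : ℤ} (hA : ¬ 2 ∣ A) (hB : B ≠ 0) (hAB : IsCoprime A B) (s : Cub ℤ) :
    s ^ 2 ≠ (A ^ 2 + 4 * B ^ 2 - 2 * (p * p - 2 * p) * A * B) ^ 2 - 4 * mu * (A * B) ^ 2 := by
  have := sq_ne_of_start (θ := p * p - 2 * p) (μ := mu) (η := -1) (s := s)
    (by rw [mu]; ring) ⟨_, mu_mul.symm⟩ isUnit_one.neg
    (by intro j h; exact not_hasPoint_D2 j (by convert h using 1 <;> ring)) hA hB hAB
    (unit_sq_of_start hA)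
  intro e
  exact this (by linear_combination e)

theorem sq_ne_F2 {A B : ℤ} (hA : ¬ 2 ∣ A) (hB : B ≠ 0) (hAB : IsCoprime A B) (s : Cub ℤ) :
    s ^ 2 ≠ (A ^ 2 - 4 * B ^ 2 - 2 * (p * p - 2 * p) * A * B) ^ 2 - 4 * mu * (A * B) ^ 2 := by
  have := sq_ne_of_start (θ := p * p - 2 * p) (μ := mu) (η := 1) (s := s)
    (by rw [mu]; ring) ⟨_, mu_mul.symm⟩ isUnit_one
    (by simpa using not_hasPoint_F2) hA hB hAB (unit_sq_of_start hA)
  intro e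
  exact this (by linear_combination e)

theorem sq_ne_D1 {a b : ℤ} (hb : ¬ 2 ∣ b) (ha : a ≠ 0) (hab : IsCoprime b a) (s : Cub ℤ) :
    s ^ 2 ≠ b ^ 4 + 8 * p * b ^ 2 * a ^ 2 - 16 * a ^ 4 := by
  have := sq_ne_of_not_hasPoint not_hasPoint_D1 (f := (b : Cub ℤ)) (k := 1) (l := a) (h := s) ha
    (fun h => hb (p_dvd_intCast.1 h)) (fun h => prime_p.not_isUnit (isUnit_of_dvd_one h))
    (one_mul _).symm (intCast_isCoprime hab)
  intro e
  exact this (by linear_combination e)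

theorem mul_cof_intCast (a : Cub ℤ) : a * cof a = ((norm a : ℤ) : Cub ℤ) := by
  rw [mul_cof, intCast_coord, Int.cast_id]

theorem isUnit_of_norm {a : Cub ℤ} (h : IsUnit (norm a)) : IsUnit a :=
  isUnit_of_mul_isUnit_left (y := cof a) (by
    rw [mul_cof_intCast]; exact h.map (Int.castRingHom (Cub ℤ)))

/-- A prime above `43`. -/
def ram : Cub ℤ := ⟨3, 4, -2⟩

theorem prime_ram : Prime ram := by
  rw [← irreducible_iff_prime]
  have hn : (norm ram).natAbs = 43 := by simp [norm, nrm, ram]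
  refine ⟨fun h => ?_, fun a b h => ?_⟩
  · rcases isUnit_norm h with h | h <;> rw [h] at hn <;> simp at hn
  · rw [h, norm_mul, Int.natAbs_mul] at hn
    have hp : Nat.Prime 43 := by norm_num
    rcases (Nat.prime_mul_iff.1 (hn ▸ hp)) with h | h
    · exact Or.inr (isUnit_of_norm (Int.isUnit_iff_natAbs_eq.2 h.2))
    · exact Or.inl (isUnit_of_norm (Int.isUnit_iff_natAbs_eq.2 h.2))

theorem dvd_of_ram_dvd {a b : ℤ} (h : ram ∣ (a : Cub ℤ) + b * p) : 43 ∣ a + 30 * b := by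
  obtain ⟨w, hw⟩ := h
  have hr : (30 : ZMod 43) ^ 3 = 2 * 30 ^ 2 + 2 := by decide
  have e := congrArg (eval (Int.castRingHom (ZMod 43)) 30 hr) hw
  rw [map_mul, map_add, map_mul, map_intCast, map_intCast] at e
  have h1 : eval (Int.castRingHom (ZMod 43)) 30 hr ram = 0 := by clear e hw w; decide +kernel +revert
  have h2 : eval (Int.castRingHom (ZMod 43)) 30 hr p = 30 := by clear e hw w h1; decide +kernel +revert
  rw [h1, h2, zero_mul] at e
  refine (ZMod.intCast_zmod_eq_zero_iff_dvd _ 43).1 ?_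
  push_cast
  linear_combination e

theorem ne_of_dvd_43 {a b c e : ℤ} (hab : IsCoprime a b) (he : ¬ 43 ∣ e) (h : 43 ∣ a + 30 * b) :
    a ^ 3 + 2 * a ^ 2 * b + 2 * b ^ 3 ≠ e * c ^ 2 := by
  intro hc
  have hp : Prime (43 : ℤ) := by norm_num
  obtain ⟨t, ht⟩ := h
  obtain rfl : a = 43 * t - 30 * b := by linarith
  obtain ⟨c, rfl⟩ : 43 ∣ c := by
    have : 43 ∣ e * c ^ 2 := ⟨(43 ^ 2 * t ^ 3 - 88 * 43 * b * t ^ 2 + 2580 * b ^ 2 * t) - 586 * b ^ 3, by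
      rw [← hc]; ring⟩
    exact hp.dvd_of_dvd_pow ((hp.dvd_or_dvd this).resolve_left he)
  have hb : 43 ∣ b := by
    have : 43 ∣ 586 * b ^ 3 := ⟨43 * t ^ 3 - 88 * b * t ^ 2 + 60 * b ^ 2 * t - e * c ^ 2, by
      linarith⟩
    refine hp.dvd_of_dvd_pow ((hp.dvd_or_dvd this).resolve_left (by norm_num))
  exact hp.not_isUnit (hab.isUnit_of_dvd' (dvd_sub (Dvd.intro _ rfl) (hb.mul_left _)) hb)

theorem isCoprime_cof {a b c e : ℤ} {α κ : Cub ℤ} (hab : IsCoprime a b) (hα : ¬ p ∣ α)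
    (hκ : κ * α = a + b * p) (he : ¬ 43 ∣ e)
    (h : a ^ 3 + 2 * a ^ 2 * b + 2 * b ^ 3 = e * c ^ 2) : IsCoprime α (cof α) := by
  refine isCoprime_of_prime_dvd (fun h0 => hα (h0.1 ▸ dvd_zero _)) fun π hπ h1 h2 => ?_
  have h3 : π ∣ (a : Cub ℤ) + b * p := hκ ▸ h1.mul_left _
  have h4 : π ∣ cof ((a : Cub ℤ) + (b : Cub ℤ) * p) := by
    rw [← hκ, cof_mul]
    exact h2.mul_left _
  have id : cof ((a : Cub ℤ) + (b : Cub ℤ) * p) = (b : Cub ℤ) ^ 2 * (p ^ 2 * ram)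
      + ((a : Cub ℤ) + (b : Cub ℤ) * p) * ((a : Cub ℤ) + 2 * b - 2 * b * p) := by
    ext <;> simp [cof, p, ram, pow_two] <;> ring
  rw [id, dvd_add_left (h3.mul_right _)] at h4
  rcases hπ.dvd_or_dvd h4 with h5 | h5
  · have hb := hπ.dvd_of_dvd_pow h5
    exact hπ.not_isUnit ((intCast_isCoprime hab).isUnit_of_dvd'
      ((dvd_add_left (hb.mul_right _)).1 h3) hb)
  rcases hπ.dvd_or_dvd h5 with h6 | h6
  · exact hα ((((hπ.dvd_prime_iff_associated prime_p).1 (hπ.dvd_of_dvd_pow h6)).symm.dvd).trans h1)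
  · exact ne_of_dvd_43 hab he (dvd_of_ram_dvd
      (((hπ.dvd_prime_iff_associated prime_ram).1 h6).symm.dvd.trans h3)) h

theorem exists_eq_sq {a b c e k : ℤ} {α κ N : Cub ℤ} (hab : IsCoprime a b) (hα : ¬ p ∣ α)
    (hκ : κ * α = a + b * p) (he : ¬ 43 ∣ e)
    (h : a ^ 3 + 2 * a ^ 2 * b + 2 * b ^ 3 = e * c ^ 2) (hn : norm α = k ^ 2)
    (h4 : 4 ∣ α - N ^ 2) : ∃ s, s ^ 2 = α := by
  obtain ⟨u, r, s, -, h1, -⟩ := exists_eq_unit_mul_pow (l := 1) (g := (k : Cub ℤ)) two_ne_zero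
    (isCoprime_cof hab hα hκ he h) isCoprime_one_right (fun h0 => hα (h0 ▸ dvd_zero _))
    one_ne_zero (by rw [mul_cof_intCast, hn]; push_cast; ring)
  obtain ⟨w, hw⟩ := h4
  obtain ⟨τ, rfl⟩ := unit_sq (u := u) (r := r) (s := N) (w := w)
    (fun hr => hα (h1 ▸ (dvd_pow hr two_ne_zero).mul_left _)) (by rw [← h1]; linear_combination hw)
  exact ⟨τ * r, by rw [h1]; push_cast; ring⟩

theorem isCoprime_sq_sub {M N : ℤ} (h : IsCoprime M N) : IsCoprime (M * N) (N ^ 2 - M ^ 2) := by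
  refine IsCoprime.mul_left ?_ ?_
  · rw [show N ^ 2 - M ^ 2 = N ^ 2 + M * (-M) by ring]
    exact h.pow_right.add_mul_left_right _
  · rw [show N ^ 2 - M ^ 2 = -M ^ 2 + N * N by ring]
    exact h.symm.pow_right.neg_right.add_mul_left_right _

theorem exists_sq_of_even {M N c : ℤ} (h : IsCoprime M N) (hM : 4 ∣ M) (hN : ¬ 2 ∣ N)
    (hG : -(M ^ 2 - N ^ 2) ^ 3 + 4 * M * N * (M ^ 2 - N ^ 2) ^ 2 + 16 * M ^ 3 * N ^ 3 = c ^ 2) :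
    ∃ s : Cub ℤ, s ^ 2 = N ^ 2 + 2 * p * M * N - M ^ 2 := by
  obtain ⟨M, rfl⟩ := hM
  have hodd : ¬ 2 ∣ N ^ 2 - (4 * M) ^ 2 := fun hd => hN (Int.prime_two.dvd_of_dvd_pow
    ((dvd_sub_left (⟨8 * M ^ 2, by ring⟩)).1 hd))
  refine exists_eq_sq (a := N ^ 2 - (4 * M) ^ 2) (b := 2 * (4 * M) * N) (κ := 1) (e := 1) (c := c)
    (k := c) (N := N) ?_ ?_ ?_ (by norm_num) ?_ ?_ ?_
  · rw [mul_assoc]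
    refine IsCoprime.mul_right ?_ (isCoprime_sq_sub h).symm
    exact ((Int.prime_two.coprime_iff_not_dvd).2 hodd).symm
  · rw [p_dvd_iff]; simpa [p, pow_two] using hodd
  · push_cast; ring
  · rw [← hG]; ring
  · rw [← hG]; simp [norm, nrm, p, pow_two]; ring
  · exact ⟨2 * p * M * N - 4 * M ^ 2, by push_cast; ring⟩

theorem exists_sq_of_odd {M N c : ℤ} (h : IsCoprime M N) (hM : 4 ∣ M) (hN : ¬ 2 ∣ N)
    (hG : -((N + M) ^ 2 - (N - M) ^ 2) ^ 3 + 4 * (N + M) * (N - M) *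
      ((N + M) ^ 2 - (N - M) ^ 2) ^ 2 + 16 * (N + M) ^ 3 * (N - M) ^ 3 = 16 * c ^ 2) :
    ∃ s : Cub ℤ, s ^ 2 = N ^ 2 - (p * p - 2 * p) * M * N - M ^ 2 := by
  obtain ⟨M, rfl⟩ := hM
  have hodd : ¬ 2 ∣ N ^ 2 - (4 * M) ^ 2 := fun hd => hN (Int.prime_two.dvd_of_dvd_pow
    ((dvd_sub_left (⟨8 * M ^ 2, by ring⟩)).1 hd))
  refine exists_eq_sq (a := -(2 * (4 * M * N))) (b := N ^ 2 - (4 * M) ^ 2) (κ := p) (e := 2) (c := c)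
    (k := c) (N := N) ?_ ?_ ?_ (by norm_num) ?_ ?_ ?_
  · refine IsCoprime.neg_left (IsCoprime.mul_left ?_ (isCoprime_sq_sub h))
    exact ((Int.prime_two.coprime_iff_not_dvd).2 hodd)
  · rw [p_dvd_iff]; simpa [p, pow_two] using hodd
  · push_cast; linear_combination (-4 * M * N) * p_cube
  · linarith
  · have hc : (N : Cub ℤ) ^ 2 - (p * p - 2 * p) * ((4 * M : ℤ) : Cub ℤ) * N
      - ((4 * M : ℤ) : Cub ℤ) ^ 2 = ⟨N ^ 2 - 16 * M ^ 2, 8 * M * N, -(4 * M * N)⟩ := by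
      ext <;> simp only [p, pow_two, sub_x, sub_y, sub_z, mul_x, mul_y, mul_z, intCast_x, intCast_y,
        intCast_z, ofNat_x, ofNat_y, ofNat_z, Int.cast_id] <;> ring
    rw [hc]
    simp only [norm, nrm]
    linarith
  · exact ⟨-(p * p - 2 * p) * M * N - 4 * M ^ 2, by push_cast; ring⟩

end Cub

/-- The numerator of `1 - 4 c` along the curve of points of period `4`. -/
def sextic {R : Type*} [CommRing R] (m n : R) : R :=
  -(m ^ 2 - n ^ 2) ^ 3 + 4 * m * n * (m ^ 2 - n ^ 2) ^ 2 + 16 * m ^ 3 * n ^ 3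

namespace Sextic

open Cub

theorem sextic_neg_neg (m n : ℤ) : sextic (-m) (-n) = sextic m n := by simp only [sextic]; ring

theorem swap_neg (m n : ℤ) : sextic n (-m) = -sextic m n := by simp only [sextic]; ring

theorem ne_sq_of_sq_even {a b c : ℤ} (hab : IsCoprime a b) (ha : a ≠ 0) (h2 : 2 ∣ a) :
    sextic (a ^ 2) (b ^ 2) ≠ c ^ 2 := by
  intro h
  obtain ⟨a, rfl⟩ := h2
  have hb : ¬ 2 ∣ b := fun hb => Int.prime_two.not_isUnit
    (hab.isUnit_of_dvd' (Dvd.intro _ rfl) hb)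
  obtain ⟨s, hs⟩ := exists_sq_of_even (M := (2 * a) ^ 2) (N := b ^ 2) (hab.pow) ⟨a ^ 2, by ring⟩
    (fun h => hb (Int.prime_two.dvd_of_dvd_pow h)) h
  refine sq_ne_D1 hb (a := a) (by rintro rfl; simp at ha) hab.of_mul_left_right.symm s ?_
  rw [hs]; push_cast; ring

theorem isCoprime_sq_add_unit_mul_sq {A B e : ℤ} (h : IsCoprime A (2 * B)) (he : IsUnit e) :
    IsCoprime (2 * A * (2 * B)) (A ^ 2 + e * (2 * B) ^ 2) := by
  have hB : IsCoprime (2 * B) (A ^ 2 + e * (2 * B) ^ 2) := by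
    rw [show A ^ 2 + e * (2 * B) ^ 2 = A ^ 2 + (2 * B) * (e * (2 * B)) by ring]
    exact h.symm.pow_right.add_mul_left_right _
  have hA : IsCoprime A (A ^ 2 + e * (2 * B) ^ 2) := by
    rw [show A ^ 2 + e * (2 * B) ^ 2 = e * (2 * B) ^ 2 + A * A by ring]
    exact ((isCoprime_mul_unit_left_right he _ _).2 h.pow_right).add_mul_left_right _
  exact (hB.of_mul_left_left.mul_left hA).mul_left hB

theorem ne_sq_of_add_sub {A B c : ℤ} (hAB : IsCoprime A B) (hA : ¬ 2 ∣ A) (hB : B ≠ 0)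
    (h2 : 2 ∣ B) : sextic ((A + B) ^ 2) ((A - B) ^ 2) ≠ 16 * c ^ 2 := by
  intro h
  obtain ⟨B, rfl⟩ := h2
  have hc : IsCoprime (2 * A * (2 * B)) (A ^ 2 + (2 * B) ^ 2) := by
    simpa using isCoprime_sq_add_unit_mul_sq hAB isUnit_one
  obtain ⟨s, hs⟩ := exists_sq_of_odd (M := 2 * A * (2 * B)) (N := A ^ 2 + (2 * B) ^ 2) (c := c)
    hc ⟨A * B, by ring⟩ (fun h => hA (Int.prime_two.dvd_of_dvd_pow
      ((dvd_add_left ⟨2 * B ^ 2, by ring⟩).1 h))) (by rw [← h, sextic]; ring)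
  refine sq_ne_D2 hA (B := B) (by rintro rfl; simp at hB) hAB.of_mul_right_right s ?_
  rw [hs, mu]; push_cast; ring

theorem ne_sq_of_pythagorean_even {A B c : ℤ} (hAB : IsCoprime A B) (hA : ¬ 2 ∣ A) (hB : B ≠ 0)
    (h2 : 2 ∣ B) : sextic (2 * A * B) (A ^ 2 - B ^ 2) ≠ c ^ 2 := by
  intro h
  obtain ⟨B, rfl⟩ := h2
  have hc : IsCoprime (2 * A * (2 * B)) (A ^ 2 - (2 * B) ^ 2) := by
    simpa [sub_eq_add_neg] using isCoprime_sq_add_unit_mul_sq hAB isUnit_one.neg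
  obtain ⟨s, hs⟩ := exists_sq_of_even (M := 2 * A * (2 * B)) (N := A ^ 2 - (2 * B) ^ 2) (c := c)
    hc ⟨A * B, by ring⟩ (fun h => hA (Int.prime_two.dvd_of_dvd_pow
      ((dvd_sub_left ⟨2 * B ^ 2, by ring⟩).1 h))) (by rw [← h, sextic])
  refine sq_ne_F1 hA (B := B) (by rintro rfl; simp at hB) hAB.of_mul_right_right s ?_
  rw [hs, fundUnit_val]; push_cast; ring

theorem ne_sq_of_pythagorean_odd {A B c : ℤ} (hAB : IsCoprime A B) (hA : ¬ 2 ∣ A) (hB : B ≠ 0)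
    (h2 : 2 ∣ B) :
    sextic (A ^ 2 - B ^ 2 + 2 * A * B) (A ^ 2 - B ^ 2 - 2 * A * B) ≠ 16 * c ^ 2 := by
  intro h
  obtain ⟨B, rfl⟩ := h2
  have hc : IsCoprime (2 * A * (2 * B)) (A ^ 2 - (2 * B) ^ 2) := by
    simpa [sub_eq_add_neg] using isCoprime_sq_add_unit_mul_sq hAB isUnit_one.neg
  obtain ⟨s, hs⟩ := exists_sq_of_odd (M := 2 * A * (2 * B)) (N := A ^ 2 - (2 * B) ^ 2) (c := c)
    hc ⟨A * B, by ring⟩ (fun h => hA (Int.prime_two.dvd_of_dvd_pow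
      ((dvd_sub_left ⟨2 * B ^ 2, by ring⟩).1 h))) (by rw [← h, sextic])
  refine sq_ne_F2 hA (B := B) (by rintro rfl; simp at hB) hAB.of_mul_right_right s ?_
  rw [hs, mu]; push_cast; ring

theorem exists_sq_of_sq_mul {x G c : ℤ} (hx : x ≠ 0) (h : x ^ 2 * G = c ^ 2) :
    ∃ d, G = d ^ 2 := by
  obtain ⟨d, rfl⟩ := (Int.pow_dvd_pow_iff two_ne_zero).1 ⟨G, h.symm⟩
  exact ⟨d, mul_left_cancel₀ (pow_ne_zero 2 hx) (by rw [h]; ring)⟩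

theorem ne_sq_of_even_right {m n : ℤ} (hm : ¬ 2 ∣ m) (hn : 2 ∣ n) (c : ℤ) :
    sextic m n ≠ c ^ 2 := by
  obtain ⟨j, rfl⟩ := hn
  obtain ⟨i, rfl⟩ : ∃ i, m = 2 * i + 1 := ⟨m / 2, by omega⟩
  intro h
  have h4 : ∃ u, sextic (2 * i + 1) (2 * j) = 4 * u - 1 := by
    obtain ⟨v, hv⟩ : ∃ v, (2 * i + 1) ^ 2 - (2 * j) ^ 2 = 4 * v + 1 := ⟨i ^ 2 + i - j ^ 2, by ring⟩
    refine ⟨-16 * v ^ 3 - 12 * v ^ 2 - 3 * v + (2 * i + 1) * (2 * j) * (4 * v + 1) ^ 2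
      + 4 * (2 * i + 1) ^ 3 * (2 * j) ^ 3, ?_⟩
    rw [sextic, hv]; ring
  obtain ⟨u, hu⟩ := h4
  rcases Int.even_or_odd' c with ⟨k, rfl | rfl⟩ <;> ring_nf at h hu <;> omega

theorem exists_sq_sub_sq_eq {m n : ℤ} (hm : ¬ 2 ∣ m) (hn : ¬ 2 ∣ n) :
    ∃ k, m ^ 2 - n ^ 2 = 8 * k := by
  obtain ⟨i, rfl⟩ : ∃ i, m = 2 * i + 1 := ⟨m / 2, by omega⟩
  obtain ⟨j, rfl⟩ : ∃ j, n = 2 * j + 1 := ⟨n / 2, by omega⟩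
  obtain ⟨u, hu⟩ := Int.even_mul_succ_self i
  obtain ⟨v, hv⟩ := Int.even_mul_succ_self j
  exact ⟨u - v, by linear_combination 4 * hu - 4 * hv⟩

theorem eq_of_sq_sub_sq_eq {m n k : ℤ} (hk : m ^ 2 - n ^ 2 = 8 * k) :
    sextic m n = 16 * (2 * (-16 * k ^ 3 + 8 * (m * n) * k ^ 2) + (m * n) ^ 3) := by
  rw [sextic, hk]; ring

theorem sextic_sq_sq_ne_sq {a b : ℤ} (hab : IsCoprime a b) (ha : a ≠ 0) (hne : a ^ 2 ≠ b ^ 2)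
    (c : ℤ) : sextic (a ^ 2) (b ^ 2) ≠ c ^ 2 := by
  by_cases h2a : 2 ∣ a
  · exact ne_sq_of_sq_even hab ha h2a
  have ha2 : ¬ 2 ∣ a ^ 2 := fun h => h2a (Int.prime_two.dvd_of_dvd_pow h)
  by_cases h2b : 2 ∣ b
  · exact ne_sq_of_even_right ha2 (dvd_pow h2b two_ne_zero) c
  have hb2 : ¬ 2 ∣ b ^ 2 := fun h => h2b (Int.prime_two.dvd_of_dvd_pow h)
  intro h
  obtain ⟨k, hk⟩ := exists_sq_sub_sq_eq ha2 hb2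
  obtain ⟨d, rfl⟩ : 4 ∣ c := (Int.pow_dvd_pow_iff two_ne_zero).1
    ⟨_, by rw [← h, eq_of_sq_sub_sq_eq hk]; rfl⟩
  obtain ⟨X, Y, rfl, rfl⟩ : ∃ X Y, a = X + Y ∧ b = X - Y := ⟨(a + b) / 2, (a - b) / 2, by omega, by omega⟩
  have hXY : IsCoprime X Y := by
    obtain ⟨u, v, huv⟩ := hab
    exact ⟨u + v, u - v, by linear_combination huv⟩
  have hX : X ≠ 0 := by rintro rfl; apply hne; ring
  have hY : Y ≠ 0 := by rintro rfl; apply hne; ring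
  by_cases h2 : 2 ∣ Y
  · exact ne_sq_of_add_sub (c := d) hXY (by omega) hY h2 (by rw [h]; ring)
  · exact ne_sq_of_add_sub (c := d) hXY.symm h2 hX (by omega)
      (by rw [add_comm Y, ← neg_sub X Y, neg_sq, h]; ring)

theorem isCoprime_mul {m n : ℤ} (h : IsCoprime m n) : IsCoprime (m * n) (sextic m n) := by
  refine IsCoprime.mul_left ?_ ?_
  · rw [show sextic m n = n ^ 6 + m * (-m ^ 5 + 3 * m ^ 3 * n ^ 2 - 3 * m * n ^ 4
      + 4 * n * (m ^ 2 - n ^ 2) ^ 2 + 16 * m ^ 2 * n ^ 3) by rw [sextic]; ring]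
    exact h.pow_right.add_mul_left_right _
  · rw [show sextic m n = -m ^ 6 + n * (n ^ 5 + 3 * m ^ 4 * n - 3 * m ^ 2 * n ^ 3
      + 4 * m * (m ^ 2 - n ^ 2) ^ 2 + 16 * m ^ 3 * n ^ 2) by rw [sextic]; ring]
    exact h.symm.pow_right.neg_right.add_mul_left_right _

theorem mul_sextic_ne_sq {m n : ℤ} (h : IsCoprime m n) (hm : m ≠ 0) (hn : n ≠ 0)
    (hne : m ^ 2 ≠ n ^ 2) (c : ℤ) : m * n * sextic m n ≠ c ^ 2 := by
  intro hc
  obtain ⟨a, b, hma, hnb⟩ : ∃ a b : ℤ, (m = a ^ 2 ∨ m = -a ^ 2) ∧ (n = b ^ 2 ∨ n = -b ^ 2) := by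
    obtain ⟨t, ht | ht⟩ := Int.sq_of_isCoprime (isCoprime_mul h) hc
    · obtain ⟨a, ha⟩ := Int.sq_of_isCoprime h ht
      obtain ⟨b, hb⟩ := Int.sq_of_isCoprime h.symm (mul_comm n m ▸ ht)
      exact ⟨a, b, ha, hb⟩
    · obtain ⟨a, ha⟩ := Int.sq_of_isCoprime h.neg_right (c := t) (by linarith)
      obtain ⟨b, hb⟩ := Int.sq_of_isCoprime h.symm.neg_right (c := t) (by linarith)
      exact ⟨a, b, ha, hb⟩
  have ha : a ≠ 0 := by rintro rfl; simp at hma; contradiction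
  have hb : b ≠ 0 := by rintro rfl; simp at hnb; contradiction
  have hab : IsCoprime a b := by
    rw [← IsCoprime.pow_iff two_pos two_pos]
    rcases hma with rfl | rfl <;> rcases hnb with rfl | rfl <;>
      simpa only [IsCoprime.neg_left_iff, IsCoprime.neg_right_iff] using h
  have hne' : a ^ 2 ≠ b ^ 2 := by
    intro he
    apply hne
    rcases hma with rfl | rfl <;> rcases hnb with rfl | rfl <;> rw [he] <;> ring
  have key : ∃ u v : ℤ, IsCoprime u v ∧ u ≠ 0 ∧ u ^ 2 ≠ v ^ 2 ∧
      (a * b) ^ 2 * sextic (u ^ 2) (v ^ 2) = c ^ 2 := by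
    rcases hma with rfl | rfl <;> rcases hnb with rfl | rfl
    · exact ⟨a, b, hab, ha, hne', by rw [← hc]; ring⟩
    · exact ⟨b, a, hab.symm, hb, hne'.symm, by rw [← hc, swap_neg]; ring⟩
    · refine ⟨b, a, hab.symm, hb, hne'.symm, ?_⟩
      rw [← hc]; simp only [sextic]; ring
    · exact ⟨a, b, hab, ha, hne', by rw [← hc, sextic_neg_neg]; ring⟩
  obtain ⟨u, v, huv, hu, huv', hG⟩ := key
  obtain ⟨d, hd⟩ := exists_sq_of_sq_mul (mul_ne_zero ha hb) hG
  exact sextic_sq_sq_ne_sq huv hu huv' d hd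

theorem exists_pythagorean {m n z : ℤ} (h : IsCoprime m n) (hm : m ≠ 0) (hn : ¬ 2 ∣ n)
    (hz : m ^ 2 + n ^ 2 = z ^ 2) :
    ∃ A B e : ℤ, (e = 1 ∨ e = -1) ∧ IsCoprime A B ∧ ¬ 2 ∣ A ∧ B ≠ 0 ∧ 2 ∣ B ∧
      m = e * (2 * A * B) ∧ n = e * (A ^ 2 - B ^ 2) := by
  have hz0 : z ≠ 0 := by rintro rfl; have := sq_pos_of_ne_zero hm; nlinarith [sq_nonneg n]
  have ht : PythagoreanTriple n m |z| := by
    rw [PythagoreanTriple, abs_mul_abs_self]; linarith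
  obtain ⟨A, B, hN, hM, -, hg, hpar, -⟩ := ht.coprime_classification'
    (Int.isCoprime_iff_gcd_eq_one.1 h.symm) (by omega) (abs_pos.2 hz0)
  have hAB := Int.isCoprime_iff_gcd_eq_one.2 hg
  rcases hpar with ⟨hA, hB⟩ | ⟨hA, hB⟩
  · exact ⟨B, -A, -1, Or.inr rfl, hAB.symm.neg_right, by omega, by rintro h0; simp_all, by omega,
      by rw [hM]; ring, by rw [hN]; ring⟩
  · exact ⟨A, B, 1, Or.inl rfl, hAB, by omega, by rintro rfl; simp_all, by omega,
      by rw [hM]; ring, by rw [hN]; ring⟩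

theorem ne_sq_of_sq_add_sq {m n z : ℤ} (h : IsCoprime m n) (hm : m ≠ 0)
    (hpar : ¬ 2 ∣ m + n) (hz : m ^ 2 + n ^ 2 = z ^ 2) (c : ℤ) : sextic m n ≠ c ^ 2 := by
  by_cases h2 : 2 ∣ n
  · exact ne_sq_of_even_right (by omega) h2 c
  obtain ⟨A, B, e, rfl | rfl, hAB, hA, hB, h2B, rfl, rfl⟩ := exists_pythagorean h hm h2 hz
  · simpa only [one_mul] using ne_sq_of_pythagorean_even hAB hA hB h2B
  · simpa only [neg_one_mul, sextic_neg_neg] using ne_sq_of_pythagorean_even hAB hA hB h2B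

theorem ne_sq_of_sq_add_sq_odd {m n z : ℤ} (h : IsCoprime m n) (hne : m ≠ n)
    (hm : ¬ 2 ∣ m) (hn : ¬ 2 ∣ n) (hz : m ^ 2 + n ^ 2 = 2 * z ^ 2) (c : ℤ) :
    sextic m n ≠ 16 * c ^ 2 := by
  intro hc
  obtain ⟨k, hk⟩ := exists_sq_sub_sq_eq hm hn
  rw [eq_of_sq_sub_sq_eq hk] at hc
  obtain ⟨i, rfl⟩ : ∃ i, m = 2 * i + 1 := ⟨m / 2, by omega⟩
  obtain ⟨j, rfl⟩ : ∃ j, n = 2 * j + 1 := ⟨n / 2, by omega⟩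
  have hij : 2 ∣ i + j := by
    by_contra hij
    obtain ⟨t, ht⟩ : ∃ t, (2 * i + 1) * (2 * j + 1) = 4 * t + 3 :=
      ⟨i * j + (i + j) / 2, by
        have : i + j = 2 * ((i + j) / 2) + 1 := by omega
        linear_combination 2 * this⟩
    rw [ht] at hc
    rcases Int.even_or_odd' c with ⟨l, rfl | rfl⟩ <;> ring_nf at hc <;> omega
  have hz' : (i - j) ^ 2 + (i + j + 1) ^ 2 = z ^ 2 := by linarith
  have hcop : IsCoprime (i - j) (i + j + 1) := by
    obtain ⟨u, v, huv⟩ := h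
    exact ⟨u - v, u + v, by linear_combination huv⟩
  have hG : sextic ((i + j + 1) + (i - j)) ((i + j + 1) - (i - j)) = 16 * c ^ 2 := by
    rw [← hc, ← eq_of_sq_sub_sq_eq hk]; congr 1 <;> ring
  obtain ⟨A, B, e, he, hAB, hA, hB, h2B, hM, hN⟩ :=
    exists_pythagorean hcop (by intro h0; apply hne; linarith) (by omega) hz'
  rw [hM, hN, ← mul_add, ← mul_sub] at hG
  apply ne_sq_of_pythagorean_odd (c := c) hAB hA hB h2B
  rcases he with rfl | rfl
  · simpa only [one_mul] using hG
  · simpa only [neg_one_mul, sextic_neg_neg] using hG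

theorem isCoprime_factors {m n P Q G : ℤ} (h : IsCoprime m n) (hP : ¬ 2 ∣ P) (hQ : ¬ 2 ∣ Q)
    (hPd : P ∣ m ^ 2 + n ^ 2) (hQd : Q ∣ m ^ 2 - 2 * m * n - n ^ 2) (hGd : G ∣ sextic m n)
    (hQ0 : Q ≠ 0) (hP0 : P ≠ 0) : IsCoprime P Q ∧ IsCoprime P G ∧ IsCoprime Q G := by
  have hcontra {p : ℤ} (hp : Prime p) (h1 : p ∣ m) (h2 : p ∣ n) : False :=
    hp.not_isUnit (h.isUnit_of_dvd' h1 h2)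
  have hodd {p x : ℤ} (hp : Prime p) (hx : ¬ 2 ∣ x) (hpx : p ∣ x) : ¬ p ∣ 2 := fun h2 =>
    hx (((hp.dvd_prime_iff_associated Int.prime_two).1 h2).dvd_iff_dvd_left.1 hpx)
  refine ⟨?_, ?_, ?_⟩
  · refine isCoprime_of_prime_dvd (fun h => hP0 h.1) fun p hp h1 h2 => ?_
    have h2' := hodd hp hP h1
    have h1 := h1.trans hPd
    have h2 := h2.trans hQd
    have hmn : p ∣ m * n := by
      have h3 : p ∣ 2 * (n * (m + n)) := by
        have := dvd_sub h1 h2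
        ring_nf at this ⊢; exact this
      rcases hp.dvd_or_dvd ((hp.dvd_or_dvd h3).resolve_left h2') with h4 | h4
      · exact h4.mul_left m
      · have : p ∣ 2 * (m * n) := by
          have := dvd_sub (h4.mul_right (m + n)) h1
          ring_nf at this ⊢; exact this
        exact (hp.dvd_or_dvd this).resolve_left h2'
    rcases hp.dvd_or_dvd hmn with h4 | h4
    · exact hcontra hp h4 (hp.dvd_of_dvd_pow ((dvd_add_right (dvd_pow h4 two_ne_zero)).1 h1))
    · exact hcontra hp (hp.dvd_of_dvd_pow ((dvd_add_left (dvd_pow h4 two_ne_zero)).1 h1)) h4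
  · refine isCoprime_of_prime_dvd (fun h => hP0 h.1) fun p hp h1 h2 => ?_
    have h2' := hodd hp hP h1
    have h1 := h1.trans hPd
    have h2 := h2.trans hGd
    have h3 : p ∣ 2 ^ 3 * n ^ 6 := by
      have : p ∣ sextic m n - (m ^ 2 + n ^ 2) * (-m ^ 4 + 4 * m ^ 2 * n ^ 2 - 7 * n ^ 4
        + 4 * m ^ 3 * n + 4 * m * n ^ 3) := dvd_sub h2 (h1.mul_right _)
      rw [sextic] at this
      ring_nf at this ⊢; exact this
    have hn : p ∣ n := hp.dvd_of_dvd_pow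
      ((hp.dvd_or_dvd h3).resolve_left fun h => h2' (hp.dvd_of_dvd_pow h))
    exact hcontra hp (hp.dvd_of_dvd_pow ((dvd_add_left (dvd_pow hn two_ne_zero)).1 h1)) hn
  · refine isCoprime_of_prime_dvd (fun h => hQ0 h.1) fun p hp h1 h2 => ?_
    have h2' := hodd hp hQ h1
    have h1 := h1.trans hQd
    have h2 := h2.trans hGd
    have h3 : p ∣ 2 ^ 3 * (3 * (m * n) ^ 3) := by
      have : p ∣ sextic m n - (m ^ 2 - 2 * m * n - n ^ 2) * (-(m ^ 2 - n ^ 2) ^ 2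
        + 2 * m * n * (m ^ 2 - n ^ 2) + 4 * m ^ 2 * n ^ 2) := dvd_sub h2 (h1.mul_right _)
      rw [sextic] at this
      ring_nf at this ⊢; exact this
    have h4 := (hp.dvd_or_dvd h3).resolve_left fun h => h2' (hp.dvd_of_dvd_pow h)
    rcases hp.dvd_or_dvd h4 with h5 | h5
    · have h6 : (3 : ℤ) ∣ m ^ 2 - 2 * m * n - n ^ 2 :=
        ((hp.dvd_prime_iff_associated Int.prime_three).1 h5).dvd_iff_dvd_left.1 h1
      have h7 : (3 : ℤ) ∣ m ∧ (3 : ℤ) ∣ n := by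
        have hm3 : m % 3 = 0 ∨ m % 3 = 1 ∨ m % 3 = 2 := by omega
        have hn3 : n % 3 = 0 ∨ n % 3 = 1 ∨ n % 3 = 2 := by omega
        rw [Int.dvd_iff_emod_eq_zero] at h6
        rcases hm3 with hm3 | hm3 | hm3 <;> rcases hn3 with hn3 | hn3 | hn3 <;>
          simp [pow_two, Int.sub_emod, Int.mul_emod, hm3, hn3] at h6 <;> omega
      exact hcontra Int.prime_three h7.1 h7.2
    · rcases hp.dvd_or_dvd (hp.dvd_of_dvd_pow h5) with h6 | h6
      · refine hcontra hp h6 (hp.dvd_of_dvd_pow (n := 2) ?_)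
        have := dvd_sub (h6.mul_right (m - 2 * n)) h1
        ring_nf at this; exact this
      · refine hcontra hp (hp.dvd_of_dvd_pow (n := 2) ?_) h6
        have := dvd_add h1 (h6.mul_right (2 * m + n))
        ring_nf at this; exact this

theorem exists_sq_of_neg_mul_eq_sq {P Q G c : ℤ} (hPQ : IsCoprime P Q) (hPG : IsCoprime P G)
    (hQG : IsCoprime Q G) (hP : 0 < P) (h : -(P * Q * G) = c ^ 2) :
    ∃ z g, P = z ^ 2 ∧ (G = g ^ 2 ∨ G = -g ^ 2) := by
  obtain ⟨z, hz⟩ := Int.sq_of_isCoprime (hPQ.mul_right hPG).neg_right (c := c) (by linarith)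
  obtain ⟨g, hg⟩ := Int.sq_of_isCoprime (hPG.symm.mul_right hQG.symm).neg_right (c := c)
    (by linarith)
  refine ⟨z, g, hz.resolve_right fun h => ?_, hg⟩
  nlinarith [sq_nonneg z]

theorem neg_mul_sextic_ne_sq {m n : ℤ} (h : IsCoprime m n) (hm : m ≠ 0) (hn : n ≠ 0)
    (hne : m ^ 2 ≠ n ^ 2) (c : ℤ) :
    -((m ^ 2 + n ^ 2) * (m ^ 2 - 2 * m * n - n ^ 2) * sextic m n) ≠ c ^ 2 := by
  intro hc
  have hP : 0 < m ^ 2 + n ^ 2 := by positivity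
  by_cases hpar : 2 ∣ m + n
  · have hm2 : ¬ 2 ∣ m := fun h2 => Int.prime_two.not_isUnit
      (h.isUnit_of_dvd' h2 ((dvd_add_right h2).1 hpar))
    have hn2 : ¬ 2 ∣ n := by omega
    obtain ⟨k, hk⟩ := exists_sq_sub_sq_eq hm2 hn2
    have hmn : ¬ 2 ∣ m * n := Int.prime_two.not_dvd_mul hm2 hn2
    have hmn3 : ¬ 2 ∣ (m * n) ^ 3 := fun h => hmn (Int.prime_two.dvd_of_dvd_pow h)
    have hn2' : ¬ 2 ∣ n ^ 2 := fun h => hn2 (Int.prime_two.dvd_of_dvd_pow h)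
    obtain ⟨P, hPe, hP2⟩ : ∃ P, m ^ 2 + n ^ 2 = 2 * P ∧ ¬ 2 ∣ P :=
      ⟨4 * k + n ^ 2, by linarith, by omega⟩
    obtain ⟨Q, hQe, hQ2⟩ : ∃ Q, m ^ 2 - 2 * m * n - n ^ 2 = 2 * Q ∧ ¬ 2 ∣ Q :=
      ⟨4 * k - m * n, by linarith, by omega⟩
    obtain ⟨G, hGe, hG2⟩ : ∃ G, sextic m n = 16 * G ∧ ¬ 2 ∣ G :=
      ⟨_, eq_of_sq_sub_sq_eq hk, by omega⟩
    obtain ⟨h1, h2, h3⟩ := isCoprime_factors h hP2 hQ2 ⟨2, by linarith⟩ ⟨2, by linarith⟩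
      ⟨16, by linarith⟩ (by rintro rfl; simp at hQ2) (by rintro rfl; simp at hP2)
    rw [hPe, hQe, hGe] at hc
    obtain ⟨d, hd⟩ := exists_sq_of_sq_mul (x := 8) (G := -(P * Q * G)) (c := c) (by norm_num)
      (by linarith)
    obtain ⟨z, g, rfl, rfl | rfl⟩ := exists_sq_of_neg_mul_eq_sq h1 h2 h3 (by linarith) hd
    · exact ne_sq_of_sq_add_sq_odd h (by rintro rfl; exact hne rfl) hm2 hn2 hPe g hGe
    · refine ne_sq_of_sq_add_sq_odd (m := n) (n := -m) (z := z) h.symm.neg_right ?_ hn2 (by omega)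
        (by linarith) g (by rw [swap_neg, hGe]; ring)
      rintro rfl; apply hne; ring
  · have hodd : ¬ 2 ∣ (m + n) ^ 2 := fun h => hpar (Int.prime_two.dvd_of_dvd_pow h)
    have hP2 : ¬ 2 ∣ m ^ 2 + n ^ 2 := by
      rw [show m ^ 2 + n ^ 2 = (m + n) ^ 2 - 2 * (m * n) by ring]; omega
    have hQ2 : ¬ 2 ∣ m ^ 2 - 2 * m * n - n ^ 2 := by
      rw [show m ^ 2 - 2 * m * n - n ^ 2 = (m + n) ^ 2 - 2 * (2 * (m * n) + n ^ 2) by ring]; omega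
    obtain ⟨h1, h2, h3⟩ := isCoprime_factors h hP2 hQ2 dvd_rfl dvd_rfl dvd_rfl
      (by intro h0; simp [h0] at hQ2) hP.ne'
    obtain ⟨z, g, hz, hg | hg⟩ := exists_sq_of_neg_mul_eq_sq h1 h2 h3 hP hc
    · exact ne_sq_of_sq_add_sq h hm hpar hz g hg
    · exact ne_sq_of_sq_add_sq (m := n) (n := -m) (z := z) h.symm.neg_right hn (by omega)
        (by linarith) g (by rw [swap_neg, hg]; ring)

theorem exists_coprime_param {s : ℚ} (h0 : s ≠ 0) (h1 : s ^ 2 ≠ 1) :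
    ∃ m n : ℤ, IsCoprime m n ∧ m ≠ 0 ∧ n ≠ 0 ∧ m ^ 2 ≠ n ^ 2 ∧ (m + n : ℚ) ≠ 0 ∧
      s = (m - n) / (m + n) := by
  have hs1 : 1 - s ≠ 0 := fun h => h1 (by rw [← sub_eq_zero.1 h]; ring)
  have hs2 : 1 + s ≠ 0 := fun h => h1 (by rw [eq_neg_of_add_eq_zero_right h]; ring)
  obtain ⟨x, hx⟩ : ∃ x, x = (1 + s) / (1 - s) := ⟨_, rfl⟩
  have hd : (x.den : ℚ) ≠ 0 := Nat.cast_ne_zero.2 x.den_ne_zero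
  have hnum : (x.num : ℚ) = x * x.den := (Rat.mul_den_eq_num x).symm
  have hx1 : x + 1 ≠ 0 := by
    rw [hx, div_add_one hs1]
    exact div_ne_zero (by ring_nf; norm_num) hs1
  have hx0 : x ≠ 0 := hx ▸ div_ne_zero hs2 hs1
  have hx2 : x - 1 ≠ 0 := by
    rw [hx, div_sub_one hs1]
    exact div_ne_zero (by ring_nf; simpa using h0) hs1
  refine ⟨x.num, x.den, ?_, Rat.num_ne_zero.2 hx0, by exact_mod_cast x.den_ne_zero, ?_, ?_, ?_⟩
  · exact Int.isCoprime_iff_gcd_eq_one.2 x.reduced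
  · intro h
    have h' : (x.num : ℚ) ^ 2 = (x.den : ℚ) ^ 2 := by exact_mod_cast h
    rw [hnum] at h'
    have : (x + 1) * (x - 1) * (x.den : ℚ) ^ 2 = 0 := by linear_combination h'
    simp [hx1, hx2] at this
  · push_cast
    rw [hnum, show x * x.den + x.den = (x + 1) * (x.den : ℚ) by ring]
    exact mul_ne_zero hx1 hd
  · push_cast
    rw [hnum, show x * x.den + x.den = (x + 1) * (x.den : ℚ) by ring, eq_div_iff
      (mul_ne_zero hx1 hd)]
    have : x * (1 - s) = 1 + s := by rw [hx, div_mul_cancel₀ _ hs1]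
    linear_combination (-(x.den : ℚ)) * this

theorem eval_param {m n s : ℚ} (h : m + n ≠ 0) (hs : s = (m - n) / (m + n)) :
    s ^ 6 + s ^ 4 + 4 * s ^ 3 - s ^ 2 - 1 = -4 * sextic m n / (m + n) ^ 6 := by
  rw [hs, sextic]; field_simp; ring

theorem not_isSquare_mul_sq_sub_one {s : ℚ} (h0 : s ≠ 0) (h1 : s ^ 2 ≠ 1) :
    ¬ IsSquare ((s ^ 6 + s ^ 4 + 4 * s ^ 3 - s ^ 2 - 1) * (s ^ 2 - 1)) := by
  rintro ⟨r, hr⟩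
  obtain ⟨m, n, h, hm, hn, hne, hmn, hs⟩ := exists_coprime_param h0 h1
  obtain ⟨c, hc⟩ : IsSquare (m * n * sextic m n) := by
    refine Kummer.isSquare_of_cast_eq_sq (r := r * (m + n) ^ 4 / 4) ?_
    rw [eval_param hmn hs] at hr
    have h2 : s ^ 2 - 1 = -4 * m * n / (m + n) ^ 2 := by rw [hs]; field_simp; ring
    rw [h2] at hr
    field_simp at hr
    simp only [sextic] at hr ⊢
    push_cast
    linarith
  exact mul_sextic_ne_sq h hm hn hne c (by rw [hc, pow_two])

theorem not_isSquare_mul_sq_add_one {s : ℚ} (h0 : s ≠ 0) (h1 : s ^ 2 ≠ 1) :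
    ¬ IsSquare ((s ^ 6 + s ^ 4 + 4 * s ^ 3 - s ^ 2 - 1) * ((s ^ 2 + 1) * (s ^ 2 + 2 * s - 1))) := by
  rintro ⟨r, hr⟩
  obtain ⟨m, n, h, hm, hn, hne, hmn, hs⟩ := exists_coprime_param h0 h1
  obtain ⟨c, hc⟩ : IsSquare (-((m ^ 2 + n ^ 2) * (m ^ 2 - 2 * m * n - n ^ 2) * sextic m n)) := by
    refine Kummer.isSquare_of_cast_eq_sq (r := r * (m + n) ^ 5 / 4) ?_
    rw [eval_param hmn hs] at hr
    have h2 : s ^ 2 + 1 = 2 * (m ^ 2 + n ^ 2) / (m + n) ^ 2 := by rw [hs]; field_simp; ring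
    have h3 : s ^ 2 + 2 * s - 1 = 2 * (m ^ 2 - 2 * m * n - n ^ 2) / (m + n) ^ 2 := by
      rw [hs]; field_simp; ring
    rw [h2, h3] at hr
    field_simp at hr
    simp only [sextic] at hr ⊢
    push_cast
    linarith
  exact neg_mul_sextic_ne_sq h hm hn hne c (by rw [hc, pow_two])

end Sextic

/-- In a quadratic field the squares of two elements span at most one nontrivial square class. -/
theorem isSquare_or_of_finrank_eq_two {K : Type*} [Field K] [NumberField K]
    (hK : Module.finrank ℚ K = 2) {a b : ℚ} {x y : K} (hx : x ^ 2 = a) (hy : y ^ 2 = b) :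
    IsSquare a ∨ IsSquare b ∨ IsSquare (a * b) := by
  by_cases hr : ∃ q : ℚ, (q : K) = x
  · obtain ⟨q, rfl⟩ := hr
    exact Or.inl ⟨q, by rw [← pow_two]; exact_mod_cast hx.symm⟩
  have hli : LinearIndependent ℚ ![1, x] := by
    refine (LinearIndependent.pair_iff' one_ne_zero).2 fun q hq => hr ⟨q, ?_⟩
    rw [← hq, Rat.smul_def, mul_one]
  have htop := hli.span_eq_top_of_card_eq_finrank (by simp [hK])
  obtain ⟨u, v, huv⟩ : ∃ u v : ℚ, u • (1 : K) + v • x = y := by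
    rw [← Submodule.mem_span_pair]
    have : y ∈ Submodule.span ℚ (Set.range ![1, x]) := htop ▸ Submodule.mem_top
    simpa [Set.pair_comm] using this
  simp only [Rat.smul_def, mul_one] at huv
  have hb : ((b - u ^ 2 - v ^ 2 * a : ℚ) : K) = (2 * u * v : ℚ) * x := by
    push_cast
    rw [← hy, ← huv, ← hx]; ring
  by_cases huv0 : 2 * u * v = 0
  · rw [huv0, Rat.cast_zero, zero_mul, Rat.cast_eq_zero] at hb
    rcases mul_eq_zero.1 huv0 with hu | hv
    · have hu : u = 0 := by simpa using hu
      exact Or.inr (Or.inr ⟨v * a, by subst hu; linear_combination a * hb⟩)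
    · exact Or.inr (Or.inl ⟨u, by subst hv; linear_combination hb⟩)
  · refine absurd ⟨(b - u ^ 2 - v ^ 2 * a) / (2 * u * v), ?_⟩ hr
    rw [Rat.cast_div, hb, mul_div_cancel_left₀ _ (Rat.cast_ne_zero.2 huv0)]

/-- A point of exact period `4` gives a point on the hyperelliptic curve
`y ^ 2 = (s ^ 2 - 1) (s ^ 2 + 1) (s ^ 2 + 2 s - 1)`. -/
theorem HasExactPeriod.exists_curve_point {K : Type*} [Field K] [CharZero K] {c β : K}
    (h : HasExactPeriod c 4 β) :
    ∃ s y : K, s ≠ 0 ∧ s ^ 2 - 1 ≠ 0 ∧ y ≠ 0 ∧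
      y ^ 2 = (s ^ 2 - 1) * (s ^ 2 + 1) * (s ^ 2 + 2 * s - 1) ∧
      (1 - 4 * c) * (s ^ 2 * (s ^ 2 - 1)) = s ^ 6 + s ^ 4 + 4 * s ^ 3 - s ^ 2 - 1 := by
  obtain ⟨a, b, e, rfl, ha, hb, he, hne⟩ : ∃ a b e, (b ^ 2 + c) = e ∧ β ^ 2 + c = a ∧
      a ^ 2 + c = b ∧ e ^ 2 + c = β ∧ b ≠ β :=
    ⟨_, _, _, rfl, rfl, rfl, h.1, h.2 2 (by norm_num) (by norm_num)⟩
  set e := b ^ 2 + c with he'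
  have hd : β - b ≠ 0 := sub_ne_zero.2 hne.symm
  have hts : (a + e) * (β + b) = -1 := by
    apply mul_left_cancel₀ hd
    linear_combination hb - he + (a + e) * (ha + he')
  have hs : β + b ≠ 0 := fun h0 => by simp [h0] at hts
  obtain ⟨s, hsd⟩ : ∃ s, s = β + b := ⟨_, rfl⟩
  obtain ⟨d, hdd⟩ : ∃ d, d = β - b := ⟨_, rfl⟩
  obtain ⟨t, htd⟩ : ∃ t, t = a + e := ⟨_, rfl⟩
  rw [← hsd] at hs hts
  rw [← htd] at hts
  rw [← hdd] at hd
  have hae : a - e = s * d := by rw [hsd, hdd, ← ha, he']; ring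
  have h1 : 2 * t = s ^ 2 + d ^ 2 + 4 * c := by rw [htd, hsd, hdd, ← ha, he']; ring
  have h2 : 2 * s = t ^ 2 + (s * d) ^ 2 + 4 * c := by
    rw [← hae, htd, hsd]
    linear_combination -2 * hb - 2 * he
  have key : d ^ 2 * s ^ 2 * (s ^ 2 - 1) = (s ^ 2 + 1) * (s ^ 2 + 2 * s - 1) := by
    linear_combination s ^ 2 * (h1 - h2) + (1 - 2 * s - s * t) * hts
  have hs1 : s ^ 2 - 1 ≠ 0 := by
    intro h0
    have h3 : s * 4 = 0 := by linear_combination -key + h0 * (d ^ 2 * s ^ 2 - s ^ 2 - 2 * s - 1)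
    simp [hs] at h3
  refine ⟨s, d * s * (s ^ 2 - 1), hs, hs1, mul_ne_zero (mul_ne_zero hd hs) hs1, ?_, ?_⟩
  · linear_combination (s ^ 2 - 1) * key
  · linear_combination key + s ^ 2 * (s ^ 2 - 1) * h1 - 2 * s * (s ^ 2 - 1) * hts

theorem HasExactPeriod.not_four_of_one {K : Type*} [Field K] [NumberField K]
    (hK : Module.finrank ℚ K = 2) {c α β : K} (h1 : HasExactPeriod c 1 α) :
    ¬ HasExactPeriod c 4 β := by
  intro h4
  obtain ⟨s, y, hs, hs1, hy, hys, hc⟩ := h4.exists_curve_point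
  obtain ⟨s, rfl⟩ := Kummer.rational_of_quadratic_point hK hy hys
  have hs : s ≠ 0 := by exact_mod_cast hs
  have hs1 : s ^ 2 - 1 ≠ 0 := by exact_mod_cast hs1
  have hα : α ^ 2 + c = α := h1.1
  have hw : ((2 * α - 1) * s * (s ^ 2 - 1)) ^ 2 =
      (((s ^ 6 + s ^ 4 + 4 * s ^ 3 - s ^ 2 - 1) * (s ^ 2 - 1) : ℚ) : K) := by
    push_cast
    linear_combination ((s : K) ^ 2 - 1) * hc + 4 * s ^ 2 * ((s : K) ^ 2 - 1) ^ 2 * hα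
  have hy2 : y ^ 2 = (((s ^ 2 - 1) * (s ^ 2 + 1) * (s ^ 2 + 2 * s - 1) : ℚ) : K) := by
    push_cast; exact hys
  rcases isSquare_or_of_finrank_eq_two hK hy2 hw with ⟨r, hr⟩ | h | ⟨r, hr⟩
  · refine Kummer.no_rational_point hs (y := r) ?_ (by rw [hr, pow_two])
    rintro rfl
    rw [hr] at hy2
    simp [hy] at hy2
  · exact Sextic.not_isSquare_mul_sq_sub_one hs (sub_ne_zero.1 hs1) h
  · refine Sextic.not_isSquare_mul_sq_add_one hs (sub_ne_zero.1 hs1) ⟨r / (s ^ 2 - 1), ?_⟩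
    field_simp
    linear_combination hr

theorem periods_1and4_unique {K K' : Type*} [Field K] [NumberField K]
    [Field K'] [NumberField K']
    (hK : Module.finrank ℚ K = 2) (hK' : Module.finrank ℚ K' = 2)
    (c : K) (c' : K')
    (h1 : ∃ α : K, HasExactPeriod c 1 α) (h4 : ∃ β : K, HasExactPeriod c 4 β)
    (h1' : ∃ α : K', HasExactPeriod c' 1 α) (h4' : ∃ β : K', HasExactPeriod c' 4 β) :
    ∃ q q' : ℚ, (q : K) = c ∧ (q' : K') = c' ∧ q = q' := by
  obtain ⟨α, hα⟩ := h1
  obtain ⟨β, hβ⟩ := h4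
  exact absurd hβ (hα.not_four_of_one hK)
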